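/- Let d ≥ 2 and δ ∈ (0,1]. There exists a constant d_0 = d_0(d,δ) ∈ (d/2, d) with the following property. For every q ∈ (d_0, d) and p ∈ (d_0·d/q, d) there exist constants b̄ > 0 and N > 0, depending only on d, δ, p, q, such that: for every continuous a : B_1 → S_δ, every continuous b : B_1 → ℝ^d with ‖b‖_{E_{q,1}(B_1)} ≤ b̄, and every function v that is twice continuously differentiable on the closed unit ball and vanishes on ∂B_1, one has for all x ∈ B_1: v(x) ≤ N ‖(Lv)_−‖_{E_{qp/d, d/p}(B_1)}, where Lv = a^{ij} D_{ij} v + b^i D_i v and t_− = max(−t, 0). -/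

import Mathlib

open MeasureTheory Metric ENNReal

/-- The set `S_δ` of symmetric `d×d` matrices with
`δ|ξ|² ≤ aᶦʲξᶦξʲ ≤ δ⁻¹|ξ|²` for all `ξ`. -/
def Sdelta (d : ℕ) (δ : ℝ) : Set (Matrix (Fin d) (Fin d) ℝ) :=
  {a | a.IsSymm ∧ ∀ ξ : Fin d → ℝ,
    δ * ∑ i, ξ i ^ 2 ≤ ∑ i, ∑ j, a i j * ξ i * ξ j ∧
    ∑ i, ∑ j, a i j * ξ i * ξ j ≤ δ⁻¹ * ∑ i, ξ i ^ 2}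

/-- The operator `Lv = aᶦʲ D_{ij} v + bᶦ D_i v`. -/
noncomputable def Lop (d : ℕ) (a : EuclideanSpace ℝ (Fin d) → Matrix (Fin d) (Fin d) ℝ)
    (b : EuclideanSpace ℝ (Fin d) → EuclideanSpace ℝ (Fin d))
    (v : EuclideanSpace ℝ (Fin d) → ℝ) (y : EuclideanSpace ℝ (Fin d)) : ℝ :=
  (∑ i, ∑ j, a y i j *
      iteratedFDeriv ℝ 2 v y ![EuclideanSpace.single i 1, EuclideanSpace.single j 1]) +
  ∑ i, b y i * fderiv ℝ v y (EuclideanSpace.single i 1)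

/-- The Morrey norm `‖g‖_{E_{p,μ}(B_R)} =
`sup_{x ∈ B_R, 0 < ρ ≤ 2R} ρ^μ (|B_{R,ρ}(x)|⁻¹ ∫_{B_{R,ρ}(x)} |g|^p)^{1/p}`,
where `B_{R,ρ}(x) = B_R ∩ B_ρ(x)`, as a value in `ℝ≥0∞`. -/
noncomputable def morreyNorm (d : ℕ) (p μ R : ℝ)
    (g : EuclideanSpace ℝ (Fin d) → ℝ) : ℝ≥0∞ :=
  ⨆ (x : EuclideanSpace ℝ (Fin d)) (_ : x ∈ ball (0 : EuclideanSpace ℝ (Fin d)) R)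
    (ρ : ℝ) (_ : ρ ∈ Set.Ioc (0 : ℝ) (2 * R)),
    ENNReal.ofReal (ρ ^ μ *
      ((volume (ball (0 : EuclideanSpace ℝ (Fin d)) R ∩ ball x ρ)).toReal⁻¹ *
        ∫ y in ball (0 : EuclideanSpace ℝ (Fin d)) R ∩ ball x ρ, |g y| ^ p) ^ (1 / p))

/-- Euclidean space of dimension `d`. -/
abbrev Euc (d : ℕ) : Type := EuclideanSpace ℝ (Fin d)

/-- The standard basis vector. -/
noncomputable abbrev stdVec {d : ℕ} (i : Fin d) : Euc d := EuclideanSpace.single i (1 : ℝ)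

/-- The second derivative as a bilinear form. -/
noncomputable abbrev hess {d : ℕ} (w : Euc d → ℝ) (x : Euc d) : Euc d →L[ℝ] Euc d →L[ℝ] ℝ :=
  fderiv ℝ (fderiv ℝ w) x

/-- Contraction of a matrix with a bilinear form. -/
noncomputable def contr {d : ℕ} (A : Matrix (Fin d) (Fin d) ℝ)
    (B : Euc d →L[ℝ] Euc d →L[ℝ] ℝ) : ℝ :=
  ∑ i, ∑ j, A i j * B (stdVec i) (stdVec j)

lemma Euc.sum_coord_smul {d : ℕ} (x : Euc d) : ∑ i, x i • stdVec i = x := by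
  have := (EuclideanSpace.basisFun (Fin d) ℝ).sum_repr x
  simpa using this

lemma clm_eq_sum {d : ℕ} (L : Euc d →L[ℝ] ℝ) (x : Euc d) :
    L x = ∑ i, x i * L (stdVec i) := by
  conv_lhs => rw [← Euc.sum_coord_smul x]
  simp [map_sum]

lemma Lop_eq {d : ℕ} (a : Euc d → Matrix (Fin d) (Fin d) ℝ) (b : Euc d → Euc d)
    (w : Euc d → ℝ) (x : Euc d) :
    Lop d a b w x = contr (a x) (hess w x) + fderiv ℝ w x (b x) := by
  unfold Lop contr
  rw [clm_eq_sum (fderiv ℝ w x) (b x)]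
  simp [iteratedFDeriv_two_apply]

lemma contr_add {d : ℕ} (A : Matrix (Fin d) (Fin d) ℝ) (B C : Euc d →L[ℝ] Euc d →L[ℝ] ℝ) :
    contr A (B + C) = contr A B + contr A C := by
  simp [contr, mul_add, Finset.sum_add_distrib]

lemma contr_smul {d : ℕ} (A : Matrix (Fin d) (Fin d) ℝ) (c : ℝ) (B : Euc d →L[ℝ] Euc d →L[ℝ] ℝ) :
    contr A (c • B) = c * contr A B := by
  simp only [contr, Finset.mul_sum]
  refine Finset.sum_congr rfl fun i _ => Finset.sum_congr rfl fun j _ => ?_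
  simp; ring

lemma contr_posSemidef {d : ℕ} {A : Matrix (Fin d) (Fin d) ℝ} (hA : A.PosSemidef)
    {B : Euc d →L[ℝ] Euc d →L[ℝ] ℝ} (hB : ∀ u, 0 ≤ B u u) : 0 ≤ contr A B := by
  obtain ⟨m, C, hC⟩ := Matrix.posSemidef_iff_eq_sum_vecMulVec.1 hA
  have key : contr A B = ∑ k, B (∑ i, C k i • stdVec i) (∑ i, C k i • stdVec i) := by
    simp only [contr, hC, Matrix.sum_apply, Matrix.vecMulVec_apply, map_sum,
      _root_.sum_apply, star_trivial, Finset.sum_mul, map_smul,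
      _root_.smul_apply, smul_eq_mul, Finset.mul_sum]
    rw [Finset.sum_congr rfl fun i _ => Finset.sum_comm]
    rw [Finset.sum_comm]
    refine Finset.sum_congr rfl fun k _ => ?_
    rw [Finset.sum_comm]
    refine Finset.sum_congr rfl fun i _ => Finset.sum_congr rfl fun j _ => by ring
  rw [key]
  exact Finset.sum_nonneg fun k _ => hB _

lemma Sdelta_sub_posSemidef {d : ℕ} {δ : ℝ} {A : Matrix (Fin d) (Fin d) ℝ}
    (hA : A ∈ Sdelta d δ) : (A - δ • (1 : Matrix (Fin d) (Fin d) ℝ)).PosSemidef := by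
  obtain ⟨hs, h⟩ := hA
  refine Matrix.PosSemidef.of_dotProduct_mulVec_nonneg ?_ ?_
  · have : A.IsHermitian := by
      unfold Matrix.IsHermitian; rw [Matrix.conjTranspose_eq_transpose_of_trivial]; exact hs
    refine this.sub ?_
    unfold Matrix.IsHermitian
    simp
  · intro ξ
    have h1 := (h ξ).1
    have e : star ξ ⬝ᵥ (A - δ • (1 : Matrix (Fin d) (Fin d) ℝ)).mulVec ξ
        = ∑ i, ∑ j, A i j * ξ i * ξ j - δ * ∑ i, ξ i ^ 2 := by
      rw [Matrix.sub_mulVec, Matrix.smul_mulVec, Matrix.one_mulVec, dotProduct_sub]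
      congr 1
      · simp only [dotProduct, Matrix.mulVec, Finset.mul_sum]
        refine Finset.sum_congr rfl fun i _ => Finset.sum_congr rfl fun j _ => ?_
        simp; ring
      · simp only [dotProduct, Finset.mul_sum]
        refine Finset.sum_congr rfl fun i _ => ?_
        simp; ring
    rw [e]; linarith

lemma contr_one {d : ℕ} (B : Euc d →L[ℝ] Euc d →L[ℝ] ℝ) :
    contr (1 : Matrix (Fin d) (Fin d) ℝ) B = ∑ i, B (stdVec i) (stdVec i) := by
  simp [contr, Matrix.one_apply]

lemma Sdelta_contr_ge {d : ℕ} {δ : ℝ} {A : Matrix (Fin d) (Fin d) ℝ} (hA : A ∈ Sdelta d δ)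
    {B : Euc d →L[ℝ] Euc d →L[ℝ] ℝ} (hB : ∀ u, 0 ≤ B u u) :
    δ * ∑ i, B (stdVec i) (stdVec i) ≤ contr A B := by
  have h := contr_posSemidef (Sdelta_sub_posSemidef hA) hB
  have e : contr (A - δ • (1 : Matrix (Fin d) (Fin d) ℝ)) B
      = contr A B - δ * contr 1 B := by
    simp only [contr, Finset.mul_sum, ← Finset.sum_sub_distrib]
    refine Finset.sum_congr rfl fun i _ => Finset.sum_congr rfl fun j _ => ?_
    simp [sub_mul, mul_assoc]
  rw [e, contr_one] at h
  linarith

lemma Sdelta_contr_nonneg {d : ℕ} {δ : ℝ} (hδ : 0 ≤ δ) {A : Matrix (Fin d) (Fin d) ℝ}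
    (hA : A ∈ Sdelta d δ)
    {B : Euc d →L[ℝ] Euc d →L[ℝ] ℝ} (hB : ∀ u, 0 ≤ B u u) : 0 ≤ contr A B :=
  le_trans (mul_nonneg hδ (Finset.sum_nonneg fun _ _ => hB _)) (Sdelta_contr_ge hA hB)

lemma Sdelta_diag_bounds {d : ℕ} {δ : ℝ} {A : Matrix (Fin d) (Fin d) ℝ} (hA : A ∈ Sdelta d δ)
    (i : Fin d) : δ ≤ A i i ∧ A i i ≤ δ⁻¹ := by
  have h := hA.2 (Pi.single i 1)
  simpa [Pi.single_apply] using h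

lemma Sdelta_abs_le {d : ℕ} {δ : ℝ} (hδ : 0 < δ) {A : Matrix (Fin d) (Fin d) ℝ}
    (hA : A ∈ Sdelta d δ) (i j : Fin d) : |A i j| ≤ δ⁻¹ := by
  have hi := Sdelta_diag_bounds hA i
  have hj := Sdelta_diag_bounds hA j
  by_cases hij : i = j
  · subst hij
    rw [abs_of_nonneg (by linarith)]; exact hi.2
  have hs : A j i = A i j := hA.1.apply i j
  have h1 := hA.2 (Pi.single i 1 + Pi.single j 1)
  have h2 := hA.2 (Pi.single i 1 - Pi.single j 1)
  have q1 : ∑ k, (Pi.single i (1 : ℝ) + Pi.single j 1 : Fin d → ℝ) k ^ 2 = 2 := by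
    have : ∀ k, (Pi.single i (1 : ℝ) + Pi.single j 1 : Fin d → ℝ) k ^ 2
        = (if k = i then 1 else 0) + if k = j then 1 else 0 := by
      intro k
      by_cases ha : k = i <;> by_cases hb : k = j <;> simp_all [Pi.single_apply]
    rw [Finset.sum_congr rfl fun k _ => this k]; simp [Finset.sum_add_distrib]; norm_num
  have q2 : ∑ k, (Pi.single i (1 : ℝ) - Pi.single j 1 : Fin d → ℝ) k ^ 2 = 2 := by
    have : ∀ k, (Pi.single i (1 : ℝ) - Pi.single j 1 : Fin d → ℝ) k ^ 2
        = (if k = i then 1 else 0) + if k = j then 1 else 0 := by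
      intro k
      by_cases ha : k = i <;> by_cases hb : k = j <;> simp_all [Pi.single_apply]
    rw [Finset.sum_congr rfl fun k _ => this k]; simp [Finset.sum_add_distrib]; norm_num
  rw [q1] at h1
  rw [q2] at h2
  have r1 : ∑ k, ∑ l, A k l * (Pi.single i (1 : ℝ) + Pi.single j 1 : Fin d → ℝ) k
      * (Pi.single i (1 : ℝ) + Pi.single j 1 : Fin d → ℝ) l = A i i + A j j + 2 * A i j := by
    simp [Pi.single_apply, mul_add, Finset.sum_add_distrib, hs]; ring
  have r2 : ∑ k, ∑ l, A k l * (Pi.single i (1 : ℝ) - Pi.single j 1 : Fin d → ℝ) k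
      * (Pi.single i (1 : ℝ) - Pi.single j 1 : Fin d → ℝ) l = A i i + A j j - 2 * A i j := by
    simp [Pi.single_apply, mul_sub, Finset.sum_sub_distrib, hs]; ring
  rw [r1] at h1
  rw [r2] at h2
  rw [abs_le]
  constructor <;> linarith [h1.2, h2.2, hi.1, hj.1]

lemma norm_stdVec {d : ℕ} (i : Fin d) : ‖(stdVec i : Euc d)‖ = 1 := by simp

lemma Sdelta_abs_contr_le {d : ℕ} {δ : ℝ} (hδ : 0 < δ) {A : Matrix (Fin d) (Fin d) ℝ}
    (hA : A ∈ Sdelta d δ) (B : Euc d →L[ℝ] Euc d →L[ℝ] ℝ) :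
    |contr A B| ≤ δ⁻¹ * d ^ 2 * ‖B‖ := by
  unfold contr
  have hb : ∀ i j : Fin d, |A i j * B (stdVec i) (stdVec j)| ≤ δ⁻¹ * ‖B‖ := by
    intro i j
    rw [abs_mul]
    refine mul_le_mul (Sdelta_abs_le hδ hA i j) ?_ (abs_nonneg _) (inv_nonneg.2 hδ.le)
    have := B.le_opNorm₂ (stdVec i) (stdVec j)
    rwa [norm_stdVec, norm_stdVec, mul_one, mul_one] at this
  calc |∑ i, ∑ j, A i j * B (stdVec i) (stdVec j)|
      ≤ ∑ i, ∑ j, |A i j * B (stdVec i) (stdVec j)| :=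
        (Finset.abs_sum_le_sum_abs _ _).trans
          (Finset.sum_le_sum fun i _ => Finset.abs_sum_le_sum_abs _ _)
    _ ≤ ∑ _i : Fin d, ∑ _j : Fin d, δ⁻¹ * ‖B‖ :=
        Finset.sum_le_sum fun i _ => Finset.sum_le_sum fun j _ => hb i j
    _ = δ⁻¹ * d ^ 2 * ‖B‖ := by simp; ring

lemma contDiff_fderiv {d : ℕ} {w : Euc d → ℝ} (hw : ContDiff ℝ 2 w) :
    ContDiff ℝ 1 (fderiv ℝ w) := hw.fderiv_right (by norm_num)

lemma hasDerivAt_line {d : ℕ} {w : Euc d → ℝ} (hw : ContDiff ℝ 2 w) (x u : Euc d) (t : ℝ) :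
    HasDerivAt (fun s : ℝ => w (x + s • u)) (fderiv ℝ w (x + t • u) u) t := by
  have h1 : HasDerivAt (fun s : ℝ => x + s • u) u t := by
    simpa using ((hasDerivAt_id t).smul_const u).const_add x
  exact ((hw.differentiable (by norm_num)).differentiableAt.hasFDerivAt.comp_hasDerivAt t h1)

lemma hasDerivAt_line_fderiv {d : ℕ} {w : Euc d → ℝ} (hw : ContDiff ℝ 2 w) (x u : Euc d) (t : ℝ) :
    HasDerivAt (fun s : ℝ => fderiv ℝ w (x + s • u) u) (hess w (x + t • u) u u) t := by
  have h1 : HasDerivAt (fun s : ℝ => x + s • u) u t := by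
    simpa using ((hasDerivAt_id t).smul_const u).const_add x
  have h2 := (((contDiff_fderiv hw).differentiable (by norm_num)).differentiableAt
    (x := x + t • u)).hasFDerivAt.comp_hasDerivAt t h1
  exact (h2.clm_apply (hasDerivAt_const t u)).congr_deriv (by simp)

lemma hess_nonneg_of_isLocalMin {d : ℕ} {w : Euc d → ℝ} (hw : ContDiff ℝ 2 w) {x : Euc d}
    (hx : IsLocalMin w x) (u : Euc d) : 0 ≤ hess w x u u := by
  by_contra! hneg
  set g : ℝ → ℝ := fun s => w (x + s • u) with hg
  have hd1 : deriv g = fun s => fderiv ℝ w (x + s • u) u :=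
    funext fun t => (hasDerivAt_line hw x u t).deriv
  have hd2 : deriv (deriv g) 0 = hess w x u u := by
    rw [hd1, (hasDerivAt_line_fderiv hw x u 0).deriv]; simp
  have hmin : IsLocalMin g 0 := by
    have : Filter.Tendsto (fun s : ℝ => x + s • u) (nhds 0) (nhds x) := by
      have : ContinuousAt (fun s : ℝ => x + s • u) 0 := by fun_prop
      simpa [ContinuousAt] using this
    have h3 := this.eventually hx
    show ∀ᶠ s in nhds 0, g 0 ≤ g s
    simpa [hg] using h3
  have hmax : IsLocalMax g 0 := isLocalMax_of_deriv_deriv_neg (by rw [hd2]; exact hneg)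
    hmin.deriv_eq_zero (hasDerivAt_line hw x u 0).continuousAt
  have hconst : g =ᶠ[nhds 0] fun _ => g 0 := by
    filter_upwards [hmin, hmax] with s h1 h2 using le_antisymm h2 h1
  have : deriv (deriv g) 0 = 0 := by
    rw [(hconst.deriv).deriv_eq]; simp
  rw [hd2] at this
  linarith

lemma hess_mul {d : ℕ} {f g : Euc d → ℝ} (hf : ContDiff ℝ 2 f) (hg : ContDiff ℝ 2 g) (x u v : Euc d) :
    hess (fun y => f y * g y) x u v = f x * hess g x u v + g x * hess f x u v
      + fderiv ℝ f x u * fderiv ℝ g x v + fderiv ℝ g x u * fderiv ℝ f x v := by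
  have h1 : fderiv ℝ (fun y => f y * g y) = fun y => f y • fderiv ℝ g y + g y • fderiv ℝ f y := by
    funext y
    exact fderiv_fun_mul (hf.differentiable (by norm_num)).differentiableAt
      (hg.differentiable (by norm_num)).differentiableAt
  have hf1 := (hf.differentiable (by norm_num)).differentiableAt (x := x)
  have hg1 := (hg.differentiable (by norm_num)).differentiableAt (x := x)
  have hf2 := ((contDiff_fderiv hf).differentiable (by norm_num)).differentiableAt (x := x)
  have hg2 := ((contDiff_fderiv hg).differentiable (by norm_num)).differentiableAt (x := x)
  have h2 := (hf1.hasFDerivAt.smul hg2.hasFDerivAt).add (hg1.hasFDerivAt.smul hf2.hasFDerivAt)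
  unfold hess
  rw [h1]
  have h3 := h2.fderiv
  have h3' : fderiv ℝ (fun y => f y • fderiv ℝ g y + g y • fderiv ℝ f y) x = _ := h3
  rw [h3']
  simp
  ring

lemma hess_add {d : ℕ} {f g : Euc d → ℝ} (hf : ContDiff ℝ 2 f) (hg : ContDiff ℝ 2 g) (x : Euc d) :
    hess (fun y => f y + g y) x = hess f x + hess g x := by
  have h1 : fderiv ℝ (fun y => f y + g y) = fun y => fderiv ℝ f y + fderiv ℝ g y := by
    funext y
    exact fderiv_fun_add (hf.differentiable (by norm_num)).differentiableAt
      (hg.differentiable (by norm_num)).differentiableAt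
  have hf2 := ((contDiff_fderiv hf).differentiable (by norm_num)).differentiableAt (x := x)
  have hg2 := ((contDiff_fderiv hg).differentiable (by norm_num)).differentiableAt (x := x)
  unfold hess
  rw [h1, fderiv_fun_add hf2 hg2]

lemma hess_const_mul {d : ℕ} (c : ℝ) {f : Euc d → ℝ} (hf : ContDiff ℝ 2 f) (x : Euc d) :
    hess (fun y => c * f y) x = c • hess f x := by
  have h1 : fderiv ℝ (fun y => c * f y) = fun y => c • fderiv ℝ f y := by
    funext y
    exact fderiv_const_mul (hf.differentiable (by norm_num)).differentiableAt c
  have hf2 := ((contDiff_fderiv hf).differentiable (by norm_num)).differentiableAt (x := x)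
  unfold hess
  rw [h1, fderiv_fun_const_smul hf2]

lemma continuous_hess {d : ℕ} {w : Euc d → ℝ} (hw : ContDiff ℝ 2 w) : Continuous (hess w) :=
  (contDiff_fderiv hw).continuous_fderiv (by norm_num)

lemma continuous_Lop {d : ℕ} {a : Euc d → Matrix (Fin d) (Fin d) ℝ} {b : Euc d → Euc d}
    (ha : Continuous a) (hb : Continuous b) {w : Euc d → ℝ} (hw : ContDiff ℝ 2 w) :
    Continuous (Lop d a b w) := by
  have h1 := continuous_hess hw
  have h2 := hw.continuous_fderiv (by norm_num)
  have : Lop d a b w = fun x => contr (a x) (hess w x) + fderiv ℝ w x (b x) :=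
    funext fun x => Lop_eq a b w x
  rw [this]
  unfold contr
  refine Continuous.add ?_ (h2.clm_apply hb)
  refine continuous_finsetSum _ fun i _ => continuous_finsetSum _ fun j _ => ?_
  refine Continuous.mul (ha.matrix_elem i j) ?_
  exact (h1.clm_apply continuous_const).clm_apply continuous_const

lemma Lop_add {d : ℕ} (a : Euc d → Matrix (Fin d) (Fin d) ℝ) (b : Euc d → Euc d)
    {f g : Euc d → ℝ} (hf : ContDiff ℝ 2 f) (hg : ContDiff ℝ 2 g) (x : Euc d) :
    Lop d a b (fun y => f y + g y) x = Lop d a b f x + Lop d a b g x := by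
  rw [Lop_eq, Lop_eq, Lop_eq, hess_add hf hg, contr_add,
    fderiv_fun_add (hf.differentiable (by norm_num)).differentiableAt
      (hg.differentiable (by norm_num)).differentiableAt]
  simp; ring

lemma Lop_const_mul {d : ℕ} (a : Euc d → Matrix (Fin d) (Fin d) ℝ) (b : Euc d → Euc d)
    (c : ℝ) {f : Euc d → ℝ} (hf : ContDiff ℝ 2 f) (x : Euc d) :
    Lop d a b (fun y => c * f y) x = c * Lop d a b f x := by
  rw [Lop_eq, Lop_eq, hess_const_mul c hf, contr_smul,
    fderiv_const_mul (hf.differentiable (by norm_num)).differentiableAt c]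
  simp; ring

lemma Lop_nonneg_of_isLocalMin {d : ℕ} {δ : ℝ} (hδ : 0 < δ)
    {a : Euc d → Matrix (Fin d) (Fin d) ℝ} {b : Euc d → Euc d} {w : Euc d → ℝ}
    (hw : ContDiff ℝ 2 w) {x : Euc d} (hax : a x ∈ Sdelta d δ) (hx : IsLocalMin w x) :
    0 ≤ Lop d a b w x := by
  rw [Lop_eq, hx.fderiv_eq_zero]
  simpa using Sdelta_contr_nonneg hδ.le hax (hess_nonneg_of_isLocalMin hw hx)

/-- Strict minimum principle on a ball. -/
lemma nonneg_of_Lop_neg {d : ℕ} {δ R : ℝ} (hδ : 0 < δ)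
    {a : Euc d → Matrix (Fin d) (Fin d) ℝ} {b : Euc d → Euc d} {w : Euc d → ℝ}
    (hw : ContDiff ℝ 2 w) (hax : ∀ x, a x ∈ Sdelta d δ)
    (hbd : ∀ x ∈ sphere (0 : Euc d) R, 0 ≤ w x)
    (hL : ∀ x ∈ closedBall (0 : Euc d) R, Lop d a b w x < 0) :
    ∀ x ∈ closedBall (0 : Euc d) R, 0 ≤ w x := by
  intro x hx
  obtain ⟨y, hy, hmin⟩ := (isCompact_closedBall (0 : Euc d) R).exists_isMinOn ⟨x, hx⟩
    hw.continuous.continuousOn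
  refine le_trans ?_ (hmin hx)
  by_contra! hneg
  have hyb : y ∈ ball (0 : Euc d) R := by
    rcases lt_or_eq_of_le (mem_closedBall.1 hy) with h | h
    · exact mem_ball.2 h
    · exact absurd (hbd y (mem_sphere.2 h)) (not_le.2 hneg)
  have hloc : IsLocalMin w y := by
    filter_upwards [isOpen_ball.mem_nhds hyb] with z hz
    exact hmin (ball_subset_closedBall hz)
  exact absurd (Lop_nonneg_of_isLocalMin (b := b) hδ hw (hax y) hloc) (not_le.2 (hL y hy))

lemma hess_exp_clm {d : ℕ} (l : Euc d →L[ℝ] ℝ) (x u v : Euc d) :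
    hess (fun y => Real.exp (l y)) x u v = Real.exp (l x) * l u * l v := by
  have h1 : fderiv ℝ (fun y => Real.exp (l y)) = fun y => Real.exp (l y) • l := by
    funext y
    exact (l.hasFDerivAt.exp).fderiv
  unfold hess
  rw [h1]
  have h2 : HasFDerivAt (fun y => Real.exp (l y) • l) ((Real.exp (l x) • l).smulRight l) x :=
    (l.hasFDerivAt.exp).smul_const l
  rw [h2.fderiv]
  simp

/-- Existence of a barrier for the operator on a ball. -/
lemma exists_barrier {d : ℕ} (hd : 0 < d) {δ R : ℝ} (hδ : 0 < δ) (hR : 0 < R)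
    {a : Euc d → Matrix (Fin d) (Fin d) ℝ} {b : Euc d → Euc d}
    (hb : Continuous b) (hax : ∀ x, a x ∈ Sdelta d δ) :
    ∃ W : Euc d → ℝ, ContDiff ℝ 2 W ∧ (∀ x ∈ closedBall (0 : Euc d) R, 0 ≤ W x) ∧
      ∀ x ∈ closedBall (0 : Euc d) R, Lop d a b W x ≤ -1 := by
  obtain ⟨M, hM⟩ := (isCompact_closedBall (0 : Euc d) R).exists_bound_of_continuousOn
    hb.continuousOn
  have hM0 : 0 ≤ M := (norm_nonneg _).trans (hM 0 (by simp [hR.le]))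
  let i : Fin d := ⟨0, hd⟩
  set k : ℝ := (M + 1) / δ with hk
  have hk0 : 0 < k := by positivity
  have hkδ : k * δ = M + 1 := by rw [hk]; field_simp
  let l : Euc d →L[ℝ] ℝ := k • (EuclideanSpace.proj i)
  have hl : ∀ x : Euc d, l x = k * x i := fun x => by simp [l]
  have hli : ∀ j : Fin d, l (stdVec j) = if j = i then k else 0 := fun j => by
    rw [hl]; simp [eq_comm]
  set c : ℝ := Real.exp (k * R) / k with hc
  have hc0 : 0 < c := by positivity
  have hce : ContDiff ℝ 2 (fun y : Euc d => Real.exp (l y)) := l.contDiff.exp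
  have hcoord : ∀ x ∈ closedBall (0 : Euc d) R, |x i| ≤ R := fun x hx =>
    (PiLp.norm_apply_le x i).trans (by simpa using hx)
  have hWeq : ∀ x, Lop d a b (fun y => c * Real.exp (k * R) + (-c) * Real.exp (l y)) x
      = (-c) * (Real.exp (l x) * (k ^ 2 * a x i i + k * b x i)) := by
    intro x
    rw [Lop_add a b contDiff_const (contDiff_const.mul hce), Lop_const_mul a b (-c) hce]
    have h0 : Lop d a b (fun _ => c * Real.exp (k * R)) x = 0 := by
      rw [Lop_eq]; simp [hess, contr]
    rw [h0, zero_add, Lop_eq, (l.hasFDerivAt.exp).fderiv]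
    congr 1
    simp only [contr, hess_exp_clm, hli]
    simp [hl]
    ring
  refine ⟨fun y => c * Real.exp (k * R) + (-c) * Real.exp (l y),
    contDiff_const.add (contDiff_const.mul hce), fun x hx => ?_, fun x hx => ?_⟩
  · have : Real.exp (l x) ≤ Real.exp (k * R) := by
      rw [Real.exp_le_exp, hl]
      exact mul_le_mul_of_nonneg_left ((le_abs_self _).trans (hcoord x hx)) hk0.le
    nlinarith
  · rw [hWeq]
    have h1 : Real.exp (-(k * R)) ≤ Real.exp (l x) := by
      rw [Real.exp_le_exp, hl]
      nlinarith [neg_le_of_abs_le (hcoord x hx)]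
    have h2 : -M ≤ b x i := by
      have := (PiLp.norm_apply_le (b x) i).trans (hM x hx)
      exact neg_le_of_abs_le this
    have h3 : δ ≤ a x i i := (Sdelta_diag_bounds (hax x) i).1
    have h4 : k ≤ k ^ 2 * a x i i + k * b x i := by
      have : k * (k * δ) ≤ k * (k * a x i i) := by gcongr
      rw [hkδ] at this
      nlinarith
    have h5 : c * (Real.exp (-(k * R)) * k) = 1 := by
      rw [hc, Real.exp_neg]; field_simp
    have h6 : Real.exp (-(k * R)) * k ≤ Real.exp (l x) * (k ^ 2 * a x i i + k * b x i) :=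
      mul_le_mul h1 h4 hk0.le (Real.exp_pos _).le
    nlinarith [mul_le_mul_of_nonneg_left h6 hc0.le]

open CompactlySupported in
theorem exists_green_measure {d : ℕ} (hd : 0 < d) {δ R : ℝ} (hδ : 0 < δ) (hR : 0 < R)
    {a : Euc d → Matrix (Fin d) (Fin d) ℝ} {b : Euc d → Euc d}
    (ha : Continuous a) (hb : Continuous b) (hax : ∀ x, a x ∈ Sdelta d δ)
    {x0 : Euc d} (hx0 : x0 ∈ ball (0 : Euc d) R) :
    ∃ G : Measure (Euc d), IsFiniteMeasure G ∧ G (closedBall (0 : Euc d) R)ᶜ = 0 ∧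
      ∀ w : Euc d → ℝ, ContDiff ℝ 2 w → (∀ x ∈ sphere (0 : Euc d) R, 0 ≤ w x) →
        ∫ x, -(Lop d a b w x) ∂G ≤ w x0 := by
  obtain ⟨W, hW, hW0, hWL⟩ := exists_barrier hd hδ hR hb hax
  set K := closedBall (0 : Euc d) R with hK
  have hKc : IsCompact K := isCompact_closedBall _ _
  have hx0K : x0 ∈ K := ball_subset_closedBall hx0
  have hSK : sphere (0 : Euc d) R ⊆ K := sphere_subset_closedBall
  let A : C_c(Euc d, ℝ) → Set ℝ := fun g => {t | ∃ w : Euc d → ℝ, ContDiff ℝ 2 w ∧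
    (∀ x ∈ sphere (0 : Euc d) R, 0 ≤ w x) ∧ (∀ x ∈ K, g x ≤ -(Lop d a b w x)) ∧ t = w x0}
  have hgb : ∀ g : C_c(Euc d, ℝ), ∃ M : ℝ, 0 ≤ M ∧ ∀ x ∈ K, |g x| ≤ M := by
    intro g
    obtain ⟨M, hM⟩ := hKc.exists_bound_of_continuousOn (f := g) g.continuous.continuousOn
    exact ⟨M, (norm_nonneg _).trans (hM x0 hx0K), hM⟩
  have hbdd : ∀ g, BddBelow (A g) := by
    intro g
    obtain ⟨M, hM0, hM⟩ := hgb g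
    refine ⟨-((M + 1) * W x0), ?_⟩
    rintro t ⟨w, hw, hw0, hwL, rfl⟩
    have := nonneg_of_Lop_neg (R := R) (b := b) (w := fun y => w y + (M + 1) * W y) hδ
      (hw.add (contDiff_const.mul hW)) hax
      (fun x hx => add_nonneg (hw0 x hx) (mul_nonneg (by linarith) (hW0 x (hSK hx))))
      (fun x hx => by
        rw [Lop_add a b hw (contDiff_const.mul hW), Lop_const_mul a b _ hW]
        have h1 := hwL x hx
        have h2 := (abs_le.1 (hM x hx)).1
        have h3 := hWL x hx
        nlinarith) x0 hx0K
    linarith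
  have hne : ∀ g, (A g).Nonempty := by
    intro g
    obtain ⟨M, hM0, hM⟩ := hgb g
    refine ⟨_, fun y => M * W y, contDiff_const.mul hW,
      fun x hx => mul_nonneg hM0 (hW0 x (hSK hx)), fun x hx => ?_, rfl⟩
    rw [Lop_const_mul a b _ hW]
    have h2 := (abs_le.1 (hM x hx)).2
    have h3 := hWL x hx
    nlinarith
  let p : C_c(Euc d, ℝ) → ℝ := fun g => sInf (A g)
  have hple : ∀ g w, ContDiff ℝ 2 w → (∀ x ∈ sphere (0 : Euc d) R, 0 ≤ w x) →
      (∀ x ∈ K, g x ≤ -(Lop d a b w x)) → p g ≤ w x0 := fun g w h1 h2 h3 =>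
    csInf_le (hbdd g) ⟨w, h1, h2, h3, rfl⟩
  have hle : ∀ c : ℝ, 0 < c → ∀ g, p (c • g) ≤ c * p g := by
    intro c hc g
    have : c⁻¹ * p (c • g) ≤ p g := by
      refine le_csInf (hne g) ?_
      rintro t ⟨w, hw, hw0, hwL, rfl⟩
      have := hple (c • g) (fun y => c * w y) (contDiff_const.mul hw)
        (fun x hx => mul_nonneg hc.le (hw0 x hx)) (fun x hx => by
          rw [Lop_const_mul a b _ hw]
          have := hwL x hx
          simp only [CompactlySupportedContinuousMap.smul_apply, smul_eq_mul]
          nlinarith)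
      rw [inv_mul_le_iff₀ hc]
      exact this
    rwa [inv_mul_le_iff₀ hc] at this
  have N_hom : ∀ c : ℝ, 0 < c → ∀ g, p (c • g) = c * p g := by
    intro c hc g
    refine le_antisymm (hle c hc g) ?_
    have := hle c⁻¹ (inv_pos.2 hc) (c • g)
    rw [smul_smul, inv_mul_cancel₀ hc.ne', one_smul, le_inv_mul_iff₀ hc] at this
    exact this
  have N_add : ∀ g h, p (g + h) ≤ p g + p h := by
    intro g h
    have : p (g + h) - p h ≤ p g := by
      refine le_csInf (hne g) ?_
      rintro t ⟨w, hw, hw0, hwL, rfl⟩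
      have : p (g + h) - w x0 ≤ p h := by
        refine le_csInf (hne h) ?_
        rintro t ⟨v, hv, hv0, hvL, rfl⟩
        have := hple (g + h) (fun y => w y + v y) (hw.add hv)
          (fun x hx => add_nonneg (hw0 x hx) (hv0 x hx)) (fun x hx => by
            rw [Lop_add a b hw hv]
            have h1 := hwL x hx
            have h2 := hvL x hx
            simp only [CompactlySupportedContinuousMap.add_apply]
            linarith)
        linarith
      linarith
    linarith
  have hz0 : ∀ x, Lop d a b (fun _ => (0 : ℝ)) x = 0 := fun x => by
    rw [Lop_eq]; simp [hess, contr]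
  have hneg : ∀ g : C_c(Euc d, ℝ), (∀ x ∈ K, g x ≤ 0) → p g ≤ 0 := fun g hg =>
    hple g (fun _ => 0) contDiff_const (fun _ _ => le_rfl) (fun x hx => by
      rw [hz0]; simpa using hg x hx)
  let f0 : C_c(Euc d, ℝ) →ₗ.[ℝ] ℝ := ⟨⊥, 0⟩
  obtain ⟨Λ, -, hΛ⟩ := exists_extension_of_le_sublinear f0 p N_hom N_add (by
    rintro ⟨x, hx⟩
    have hx' : x = 0 := by simpa [f0] using hx
    subst hx'
    have h0 : p 0 = 0 := by
      have := N_hom 2 (by norm_num) 0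
      rw [smul_zero] at this; linarith
    simp [f0, h0])
  have hΛ0 : ∀ g : C_c(Euc d, ℝ), (∀ x ∈ K, 0 ≤ g x) → 0 ≤ Λ g := by
    intro g hg
    have := (hΛ (-g)).trans (hneg (-g) fun x hx => by simpa using hg x hx)
    rw [map_neg] at this; linarith
  let Λ' : C_c(Euc d, ℝ) →ₚ[ℝ] ℝ := PositiveLinearMap.mk₀ Λ fun g hg => hΛ0 g fun x _ => hg x
  let G := RealRMK.rieszMeasure Λ'
  have hInt : ∀ g : C_c(Euc d, ℝ), ∫ x, g x ∂G = Λ g := fun g =>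
    RealRMK.integral_rieszMeasure Λ' g
  have hGK : G Kᶜ = 0 := by
    rw [(isClosed_closedBall.isOpen_compl : IsOpen Kᶜ).measure_eq_iSup_isCompact]
    simp only [ENNReal.iSup_eq_zero]
    intro C hCK hC
    obtain ⟨f, hf1, hf0, hfc, hfr⟩ := exists_continuous_one_zero_of_isCompact hC
      (isClosed_closedBall : IsClosed K) (Set.disjoint_left.2 fun x hx hx' => hCK hx hx')
    let g : C_c(Euc d, ℝ) := ⟨f, hfc⟩
    have hg0 : Λ g = 0 := by
      refine le_antisymm ((hΛ g).trans (hneg g fun x hx => (hf0 hx).le)) (hΛ0 g fun x hx => (hf0 hx).ge)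
    have h1 : ∫ x, g x ∂G = 0 := by rw [hInt, hg0]
    have h2 : ∫⁻ x, ENNReal.ofReal (g x) ∂G = 0 := by
      rw [← ofReal_integral_eq_lintegral_ofReal]
      · rw [h1]; simp
      · exact g.continuous.integrable_of_hasCompactSupport g.hasCompactSupport
      · exact Filter.Eventually.of_forall fun x => (hfr x).1
    refine le_antisymm ?_ zero_le
    rw [← h2, ← setLIntegral_one]
    refine (setLIntegral_mono_ae (g := fun x => ENNReal.ofReal (g x))
      (by exact (ENNReal.measurable_ofReal.comp g.continuous.measurable).aemeasurable) ?_).trans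
      (setLIntegral_le_lintegral _ _)
    refine Filter.Eventually.of_forall fun x hx => ?_
    have : g x = 1 := hf1 hx
    rw [this]; simp
  refine ⟨G, ⟨?_⟩, hGK, fun w hw hw0 => ?_⟩
  · rw [← measure_add_measure_compl (isClosed_closedBall.measurableSet : MeasurableSet K), hGK,
      add_zero]
    exact hKc.measure_lt_top
  · obtain ⟨χ, hχ1, -, hχc, -⟩ := exists_continuous_one_zero_of_isCompact hKc
      (isClosed_empty) (Set.disjoint_empty K)
    let g : C_c(Euc d, ℝ) := ⟨⟨fun x => χ x * -(Lop d a b w x),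
      χ.continuous.mul (continuous_Lop ha hb hw).neg⟩, hχc.mul_right⟩
    have hgx : ∀ x ∈ K, g x = -(Lop d a b w x) := fun x hx => by
      have : χ x = 1 := hχ1 hx
      show χ x * -(Lop d a b w x) = _
      rw [this, one_mul]
    have h1 : ∫ x, -(Lop d a b w x) ∂G = ∫ x, g x ∂G := by
      refine integral_congr_ae ?_
      have : ∀ᵐ x ∂G, x ∈ K := by
        rw [ae_iff]; exact hGK
      filter_upwards [this] with x hx using (hgx x hx).symm
    rw [h1, hInt]
    exact (hΛ g).trans (hple g w hw hw0 fun x hx => (hgx x hx).le)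

/-- The convex-conjugate-like envelope used in the semi-discrete transport problem. -/
noncomputable def envl {d : ℕ} {ι : Type} [Fintype ι] (x : ι → EuclideanSpace ℝ (Fin d)) (ρ : ℝ)
    (z : ι → ℝ) (p : EuclideanSpace ℝ (Fin d)) : ℝ :=
  (Finset.univ : Finset (Option ι)).sup' ⟨none, Finset.mem_univ _⟩
    (fun o => o.elim 0 fun i => inner ℝ (x i) p - z i - 2 * ρ * ‖p‖)

section envl
variable {d : ℕ} {ι : Type} [Fintype ι] {x : ι → EuclideanSpace ℝ (Fin d)} {ρ : ℝ}

lemma envl_nonneg (z : ι → ℝ) (p : EuclideanSpace ℝ (Fin d)) : 0 ≤ envl x ρ z p :=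
  Finset.le_sup' (f := fun o : Option ι => o.elim 0 fun i => inner ℝ (x i) p - z i - 2 * ρ * ‖p‖)
    (Finset.mem_univ none)

lemma le_envl (z : ι → ℝ) (p : EuclideanSpace ℝ (Fin d)) (i : ι) :
    inner ℝ (x i) p - z i - 2 * ρ * ‖p‖ ≤ envl x ρ z p :=
  Finset.le_sup' (f := fun o : Option ι => o.elim 0 fun i => inner ℝ (x i) p - z i - 2 * ρ * ‖p‖)
    (Finset.mem_univ (some i))

lemma envl_le {z : ι → ℝ} {p : EuclideanSpace ℝ (Fin d)} {c : ℝ} (h0 : 0 ≤ c)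
    (h : ∀ i, inner ℝ (x i) p - z i - 2 * ρ * ‖p‖ ≤ c) : envl x ρ z p ≤ c := by
  refine Finset.sup'_le _ _ ?_
  rintro (_ | i) -
  · exact h0
  · exact h i

lemma continuous_envl_right {z : ι → ℝ} : Continuous (envl x ρ z) := by
  unfold envl
  refine Continuous.finset_sup'_apply _ ?_
  rintro (_ | i) -
  · exact continuous_const
  · simp only [Option.elim]
    fun_prop

lemma continuous_envl_left {p : EuclideanSpace ℝ (Fin d)} :
    Continuous fun z : ι → ℝ => envl x ρ z p := by
  unfold envl
  refine Continuous.finset_sup'_apply _ ?_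
  rintro (_ | i) -
  · exact continuous_const
  · simp only [Option.elim]
    fun_prop

lemma inner_le_of_norm_le {u p : EuclideanSpace ℝ (Fin d)} (h : ‖u‖ ≤ ρ) :
    |inner ℝ u p| ≤ ρ * ‖p‖ :=
  (abs_real_inner_le_norm u p).trans (mul_le_mul_of_nonneg_right h (norm_nonneg _))

lemma envl_le_indicator (hρ : 0 < ρ) (hx : ∀ i, ‖x i‖ ≤ ρ) {K : ℝ} (hK : 0 ≤ K) {z : ι → ℝ}
    (hz : ∀ i, -K ≤ z i) (p : EuclideanSpace ℝ (Fin d)) :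
    envl x ρ z p ≤ (closedBall (0 : EuclideanSpace ℝ (Fin d)) (K / ρ)).indicator (fun _ => K) p := by
  have h1 : ∀ i, inner ℝ (x i) p - z i - 2 * ρ * ‖p‖ ≤ K - ρ * ‖p‖ := fun i => by
    have := (abs_le.1 (inner_le_of_norm_le (p := p) (hx i))).2
    have := hz i
    linarith
  have h3 : 0 ≤ ρ * ‖p‖ := by positivity
  by_cases hp : p ∈ closedBall (0 : EuclideanSpace ℝ (Fin d)) (K / ρ)
  · rw [Set.indicator_of_mem hp]
    exact envl_le hK fun i => (h1 i).trans (by linarith)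
  · rw [Set.indicator_of_notMem hp]
    refine envl_le le_rfl fun i => (h1 i).trans ?_
    have h2 : K / ρ < ‖p‖ := by simpa using hp
    rw [div_lt_iff₀ hρ] at h2
    linarith

lemma integrable_envl_bound (ρ K : ℝ) :
    Integrable ((closedBall (0 : EuclideanSpace ℝ (Fin d)) (K / ρ)).indicator (fun _ => K)) := by
  rw [integrable_indicator_iff isClosed_closedBall.measurableSet]
  exact integrableOn_const (measure_closedBall_lt_top.ne)

lemma integrable_envl (hρ : 0 < ρ) (hx : ∀ i, ‖x i‖ ≤ ρ) {K : ℝ} (hK : 0 ≤ K) {z : ι → ℝ}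
    (hz : ∀ i, -K ≤ z i) : Integrable (envl x ρ z) := by
  refine (integrable_envl_bound ρ K).mono' ?_ (Filter.Eventually.of_forall fun p => ?_)
  · exact continuous_envl_right.aestronglyMeasurable
  · rw [Real.norm_of_nonneg (envl_nonneg _ _)]
    exact envl_le_indicator hρ hx hK hz p

end envl

lemma exists_min_transport {d : ℕ} {ι : Type} [Fintype ι] {x : ι → EuclideanSpace ℝ (Fin d)} {ρ : ℝ}
    (hρ : 0 < ρ) (hx : ∀ i, ‖x i‖ ≤ ρ) (m : ι → ℝ) {K : ℝ} (hK : 0 ≤ K) :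
    ∃ z : ι → ℝ, (∀ i, -K ≤ z i ∧ z i ≤ 0) ∧ ∀ z' : ι → ℝ, (∀ i, -K ≤ z' i ∧ z' i ≤ 0) →
      (∫ p, envl x ρ z p) + ∑ i, m i * z i ≤ (∫ p, envl x ρ z' p) + ∑ i, m i * z' i := by
  let S : Set (ι → ℝ) := Set.Icc (fun _ => -K) (fun _ => 0)
  have hS : ∀ z, z ∈ S ↔ ∀ i, -K ≤ z i ∧ z i ≤ 0 := fun z => by
    simp only [S, Set.mem_Icc, Pi.le_def]; exact forall_and.symm
  have hcont : ContinuousOn (fun z : ι → ℝ => (∫ p, envl x ρ z p) + ∑ i, m i * z i) S := by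
    refine ContinuousOn.add ?_ (by fun_prop)
    refine continuousOn_of_dominated (bound := (closedBall (0 : EuclideanSpace ℝ (Fin d))
      (K / ρ)).indicator (fun _ => K)) ?_ ?_ (integrable_envl_bound ρ K) ?_
    · intro z _
      exact continuous_envl_right.aestronglyMeasurable
    · intro z hz
      refine Filter.Eventually.of_forall fun p => ?_
      rw [Real.norm_of_nonneg (envl_nonneg _ _)]
      exact envl_le_indicator hρ hx hK (fun i => (((hS z).1 hz) i).1) p
    · refine Filter.Eventually.of_forall fun p => ?_
      exact continuous_envl_left.continuousOn
  obtain ⟨z, hz, hmin⟩ := (isCompact_Icc : IsCompact S).exists_isMinOn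
    ⟨fun _ => 0, (hS _).2 fun i => ⟨by linarith, le_rfl⟩⟩ hcont
  exact ⟨z, (hS z).1 hz, fun z' hz' => hmin ((hS z').2 hz')⟩

lemma transport_height_le {d : ℕ} (hd : 0 < d) {ι : Type} [Fintype ι]
    {x : ι → EuclideanSpace ℝ (Fin d)} {ρ : ℝ} (hρ : 0 < ρ) (hx : ∀ i, ‖x i‖ ≤ ρ)
    {m : ι → ℝ} (hm : ∀ i, 0 ≤ m i) {P : ℝ} (hP : 0 < P)
    (hmP : ENNReal.ofReal (∑ i, m i) ≤ volume (ball (0 : EuclideanSpace ℝ (Fin d)) (P / 3)))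
    {z : ι → ℝ} (hz : ∀ i, -(ρ * P + 1) ≤ z i ∧ z i ≤ 0)
    (hmin : ∀ z' : ι → ℝ, (∀ i, -(ρ * P + 1) ≤ z' i ∧ z' i ≤ 0) →
      (∫ p, envl x ρ z p) + ∑ i, m i * z i ≤ (∫ p, envl x ρ z' p) + ∑ i, m i * z' i)
    (i : ι) : -z i ≤ ρ * P := by
  set K : ℝ := ρ * P + 1 with hK
  have hρP : 0 < ρ * P := by positivity
  have hK0 : 0 ≤ K := by linarith
  set φ := envl x ρ z with hφ
  have hφi : Integrable φ := integrable_envl hρ hx hK0 fun i => (hz i).1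
  by_contra! hlt
  set t : ℝ := (-z i - ρ * P) / 2 with ht
  have ht0 : 0 < t := by rw [ht]; linarith
  let z' : ι → ℝ := fun j => min (z j + t) 0
  have hz' : ∀ j, -K ≤ z' j ∧ z' j ≤ 0 := fun j =>
    ⟨le_min (by linarith [(hz j).1]) (by linarith), min_le_right _ _⟩
  have hzz' : ∀ j, z j ≤ z' j := fun j => le_min (by linarith) (hz j).2
  have hφ'i : Integrable (envl x ρ z') := integrable_envl hρ hx hK0 fun i => (hz' i).1
  have hmono : ∀ p, envl x ρ z' p ≤ φ p := fun p =>
    envl_le (envl_nonneg _ _) fun j =>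
      le_trans (by linarith [hzz' j]) (le_envl z p j)
  set U : Set (EuclideanSpace ℝ (Fin d)) := closedBall 0 ((-z i - t) / (3 * ρ)) with hU
  have hUm : MeasurableSet U := isClosed_closedBall.measurableSet
  have hUφ : ∀ p ∈ U, envl x ρ z' p + t ≤ φ p := by
    intro p hp
    have hp' : ‖p‖ ≤ (-z i - t) / (3 * ρ) := by simpa [hU] using hp
    rw [le_div_iff₀ (by positivity)] at hp'
    have htφ : t ≤ φ p := by
      refine le_trans ?_ (le_envl z p i)
      have := (abs_le.1 (inner_le_of_norm_le (p := p) (hx i))).1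
      linarith
    have : envl x ρ z' p ≤ φ p - t := by
      refine envl_le (by linarith) fun j => ?_
      rcases min_choice (z j + t) 0 with h | h
      · have h' : z' j = z j + t := h
        rw [h']
        have := le_envl (x := x) (ρ := ρ) z p j
        linarith
      · have h' : z' j = 0 := h
        rw [h']
        have := (abs_le.1 (inner_le_of_norm_le (p := p) (hx j))).2
        have h3 : 0 ≤ ρ * ‖p‖ := by positivity
        linarith
    linarith
  have hUfin : volume U ≠ ∞ := measure_closedBall_lt_top.ne
  have h1 : t * (volume U).toReal ≤ ∫ p, (φ p - envl x ρ z' p) := by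
    have : ∫ p, U.indicator (fun _ => t) p ≤ ∫ p, (φ p - envl x ρ z' p) := by
      refine integral_mono ?_ (hφi.sub hφ'i) fun p => ?_
      · rw [integrable_indicator_iff hUm]
        exact integrableOn_const hUfin
      · by_cases hp : p ∈ U
        · rw [Set.indicator_of_mem hp]; linarith [hUφ p hp]
        · rw [Set.indicator_of_notMem hp]; linarith [hmono p]
    rw [integral_indicator hUm, setIntegral_const] at this
    simpa [mul_comm, Measure.real] using this
  rw [integral_sub hφi hφ'i] at h1
  have h2 := hmin z' hz'
  have h3 : ∑ j, m j * z' j - ∑ j, m j * z j ≤ t * ∑ j, m j := by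
    rw [← Finset.sum_sub_distrib, Finset.mul_sum]
    refine Finset.sum_le_sum fun j _ => ?_
    have : z' j ≤ z j + t := min_le_left _ _
    nlinarith [hm j]
  have h4 : (volume U).toReal ≤ ∑ j, m j := by
    have : t * (volume U).toReal ≤ t * ∑ j, m j := by linarith
    exact le_of_mul_le_mul_left this ht0
  have h5 : volume U ≤ volume (ball (0 : EuclideanSpace ℝ (Fin d)) (P / 3)) :=
    (ENNReal.le_ofReal_iff_toReal_le hUfin (Finset.sum_nonneg fun j _ => hm j)).2 h4 |>.trans hmP
  have hr : P / 3 < (-z i - t) / (3 * ρ) := by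
    rw [div_lt_div_iff₀ (by norm_num) (by positivity)]
    rw [ht]; nlinarith
  have : Nonempty (Fin d) := ⟨⟨0, hd⟩⟩
  rw [hU, Measure.addHaar_closedBall _ _ (by linarith [show 0 < P / 3 by positivity]),
    Measure.addHaar_ball volume (0 : EuclideanSpace ℝ (Fin d)) (r := P / 3) (by positivity)] at h5
  have h6 : (P / 3) ^ Module.finrank ℝ (EuclideanSpace ℝ (Fin d)) <
      ((-z i - t) / (3 * ρ)) ^ Module.finrank ℝ (EuclideanSpace ℝ (Fin d)) :=
    pow_lt_pow_left₀ hr (by positivity) (by simp [hd.ne'])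
  have h7 := (ENNReal.mul_le_mul_iff_left (measure_ball_pos volume _ one_pos).ne'
    measure_ball_lt_top.ne).1 h5
  rw [ENNReal.ofReal_le_ofReal_iff (by positivity)] at h7
  linarith

lemma transport_cell_ge {d : ℕ} {ι : Type} [Fintype ι]
    {x : ι → EuclideanSpace ℝ (Fin d)} {ρ : ℝ} (hρ : 0 < ρ) (hx : ∀ i, ‖x i‖ ≤ ρ)
    {m : ι → ℝ} {P : ℝ} (hP : 0 < P)
    {z : ι → ℝ} (hz : ∀ i, -(ρ * P + 1) ≤ z i ∧ z i ≤ 0)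
    (hmin : ∀ z' : ι → ℝ, (∀ i, -(ρ * P + 1) ≤ z' i ∧ z' i ≤ 0) →
      (∫ p, envl x ρ z p) + ∑ i, m i * z i ≤ (∫ p, envl x ρ z' p) + ∑ i, m i * z' i)
    (hzP : ∀ i, -z i ≤ ρ * P) (i : ι) :
    ENNReal.ofReal (m i) ≤
      volume {p | envl x ρ z p ≤ inner ℝ (x i) p - z i - 2 * ρ * ‖p‖} := by
  set K : ℝ := ρ * P + 1 with hK
  have hρP : 0 < ρ * P := by positivity
  have hK0 : 0 ≤ K := by linarith
  set φ := envl x ρ z with hφ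
  have hφi : Integrable φ := integrable_envl hρ hx hK0 fun i => (hz i).1
  have hφc : Continuous φ := continuous_envl_right
  let C : ℕ → Set (EuclideanSpace ℝ (Fin d)) := fun n =>
    {p | φ p ≤ inner ℝ (x i) p - z i - 2 * ρ * ‖p‖ + 1 / ((n : ℝ) + 1)}
  have hCm : ∀ n, MeasurableSet (C n) := fun n =>
    (isClosed_le hφc (by fun_prop)).measurableSet
  have hCb : ∀ n, C n ⊆ closedBall 0 (K / ρ) := by
    intro n p hp
    have hp' : φ p ≤ inner ℝ (x i) p - z i - 2 * ρ * ‖p‖ + 1 / ((n : ℝ) + 1) := hp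
    have h0 := envl_nonneg (x := x) (ρ := ρ) z p
    have h1 := (abs_le.1 (inner_le_of_norm_le (p := p) (hx i))).2
    have h2 : 1 / ((n : ℝ) + 1) ≤ 1 := by
      rw [div_le_one (by positivity)]; linarith [(Nat.cast_nonneg n : (0 : ℝ) ≤ n)]
    have h3 := hzP i
    simp only [mem_closedBall, dist_zero_right]
    rw [le_div_iff₀ hρ]
    linarith
  have hCfin : ∀ n, volume (C n) ≠ ∞ := fun n =>
    ((measure_mono (hCb n)).trans_lt measure_closedBall_lt_top).ne
  have hCm' : ∀ n, ENNReal.ofReal (m i) ≤ volume (C n) := by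
    intro n
    classical
    set t : ℝ := 1 / ((n : ℝ) + 1) with ht
    have ht0 : 0 < t := by positivity
    have ht1 : t ≤ 1 := by
      rw [ht, div_le_one (by positivity)]; linarith [(Nat.cast_nonneg n : (0 : ℝ) ≤ n)]
    let z' : ι → ℝ := Function.update z i (z i - t)
    have hz'i : z' i = z i - t := by simp [z']
    have hz'j : ∀ j, j ≠ i → z' j = z j := fun j hj => by simp [z', hj]
    have hz' : ∀ j, -K ≤ z' j ∧ z' j ≤ 0 := by
      intro j
      by_cases hj : j = i
      · subst hj; rw [hz'i]
        exact ⟨by linarith [hzP j], by linarith [(hz j).2]⟩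
      · rw [hz'j j hj]; exact hz j
    have hφ'i : Integrable (envl x ρ z') := integrable_envl hρ hx hK0 fun i => (hz' i).1
    have hub : ∀ p, envl x ρ z' p - φ p ≤ (C n).indicator (fun _ => t) p := by
      intro p
      have hi := le_envl (x := x) (ρ := ρ) z p i
      by_cases hp : p ∈ C n
      · rw [Set.indicator_of_mem hp, sub_le_iff_le_add]
        refine envl_le (by linarith [envl_nonneg (x := x) (ρ := ρ) z p]) fun j => ?_
        by_cases hj : j = i
        · subst hj; rw [hz'i]; linarith
        · rw [hz'j j hj]; linarith [le_envl (x := x) (ρ := ρ) z p j]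
      · rw [Set.indicator_of_notMem hp, sub_nonpos]
        refine envl_le (envl_nonneg _ _) fun j => ?_
        by_cases hj : j = i
        · subst hj; rw [hz'i]
          have : ¬ (φ p ≤ inner ℝ (x j) p - z j - 2 * ρ * ‖p‖ + t) := hp
          linarith
        · rw [hz'j j hj]; exact le_envl z p j
    have h1 : ∫ p, (envl x ρ z' p - φ p) ≤ t * (volume (C n)).toReal := by
      have : ∫ p, (envl x ρ z' p - φ p) ≤ ∫ p, (C n).indicator (fun _ => t) p := by
        refine integral_mono (hφ'i.sub hφi) ?_ hub
        rw [integrable_indicator_iff (hCm n)]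
        exact integrableOn_const (hCfin n)
      rw [integral_indicator (hCm n), setIntegral_const] at this
      simpa [mul_comm, Measure.real] using this
    rw [integral_sub hφ'i hφi] at h1
    have h2 := hmin z' hz'
    have h3 : ∑ j, m j * z' j = ∑ j, m j * z j - m i * t := by
      rw [← Finset.add_sum_erase _ _ (Finset.mem_univ i),
        ← Finset.add_sum_erase (a := i) _ (fun j => m j * z j) (Finset.mem_univ i), hz'i]
      rw [Finset.sum_congr rfl fun j hj => by rw [hz'j j (Finset.ne_of_mem_erase hj)]]
      ring
    have h4 : t * m i ≤ t * (volume (C n)).toReal := by linarith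
    exact (ENNReal.ofReal_le_iff_le_toReal (hCfin n)).2 (le_of_mul_le_mul_left h4 ht0)
  have hanti : Antitone C := by
    intro n k hnk p hp
    have hp' : φ p ≤ inner ℝ (x i) p - z i - 2 * ρ * ‖p‖ + 1 / ((k : ℝ) + 1) := hp
    show φ p ≤ inner ℝ (x i) p - z i - 2 * ρ * ‖p‖ + 1 / ((n : ℝ) + 1)
    have : 1 / ((k : ℝ) + 1) ≤ 1 / ((n : ℝ) + 1) := by
      apply one_div_le_one_div_of_le (by positivity)
      have : (n : ℝ) ≤ k := by exact_mod_cast hnk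
      linarith
    linarith
  have hlim := tendsto_measure_iInter_atTop (μ := volume)
    (fun n => (hCm n).nullMeasurableSet) hanti ⟨0, hCfin 0⟩
  have hle := ge_of_tendsto' hlim hCm'
  refine hle.trans (measure_mono ?_)
  intro p hp
  have hp' : ∀ n : ℕ, φ p ≤ inner ℝ (x i) p - z i - 2 * ρ * ‖p‖ + 1 / ((n : ℝ) + 1) :=
    fun n => Set.mem_iInter.1 hp n
  have hl : Filter.Tendsto (fun n : ℕ => inner ℝ (x i) p - z i - 2 * ρ * ‖p‖ + 1 / ((n : ℝ) + 1))
      Filter.atTop (nhds (inner ℝ (x i) p - z i - 2 * ρ * ‖p‖ + 0)) :=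
    tendsto_const_nhds.add tendsto_one_div_add_atTop_nhds_zero_nat
  have := ge_of_tendsto' hl hp'
  simpa using this

/-- A semi-discrete version of Alexandrov's solution of the Monge-Ampère equation. -/
theorem exists_semidiscrete_potential {d : ℕ} (hd : 0 < d) {ι : Type} [Fintype ι]
    (x : ι → EuclideanSpace ℝ (Fin d)) {ρ : ℝ} (hρ : 0 < ρ) (hx : ∀ i, ‖x i‖ ≤ ρ)
    (m : ι → ℝ) (hm : ∀ i, 0 ≤ m i) {P : ℝ} (hP : 0 < P)
    (hmP : ENNReal.ofReal (∑ i, m i) ≤ volume (ball (0 : EuclideanSpace ℝ (Fin d)) (P / 3))) :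
    ∃ Z : EuclideanSpace ℝ (Fin d) → ℝ, ConvexOn ℝ Set.univ Z ∧
      (∀ u v, |Z u - Z v| ≤ P * ‖u - v‖) ∧ (∀ u, ‖u‖ ≤ 2 * ρ → Z u ≤ 0) ∧ (∀ u, -(ρ * P) ≤ Z u) ∧
      ∀ i, ENNReal.ofReal (m i) ≤ volume {p : EuclideanSpace ℝ (Fin d) |
        ∀ y, Z (x i) + inner ℝ p (y - x i) ≤ Z y} := by
  have hρP : 0 < ρ * P := by positivity
  obtain ⟨z, hz, hmin⟩ := exists_min_transport hρ hx m (show 0 ≤ ρ * P + 1 by linarith)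
  have hzP := transport_height_le hd hρ hx hm hP hmP hz hmin
  have hcell := transport_cell_ge hρ hx hP hz hmin hzP
  set φ := envl x ρ z with hφ
  -- the potential
  let B : Set (EuclideanSpace ℝ (Fin d)) := closedBall 0 P
  have : Nonempty B := ⟨⟨0, by simp [B, hP.le]⟩⟩
  let A : EuclideanSpace ℝ (Fin d) → B → ℝ := fun u p => inner ℝ p.1 u - 2 * ρ * ‖p.1‖ - φ p.1
  have hAB : ∀ u, BddAbove (Set.range (A u)) := by
    intro u
    refine ⟨P * ‖u‖, ?_⟩
    rintro _ ⟨p, rfl⟩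
    have hp : ‖p.1‖ ≤ P := mem_closedBall_zero_iff.1 p.2
    have h1 := (abs_le.1 (inner_le_of_norm_le (p := u) hp)).2
    have h2 := envl_nonneg (x := x) (ρ := ρ) z p.1
    have h3 : 0 ≤ ρ * ‖p.1‖ := by positivity
    show inner ℝ p.1 u - 2 * ρ * ‖p.1‖ - φ p.1 ≤ _
    linarith
  let Z : EuclideanSpace ℝ (Fin d) → ℝ := fun u => ⨆ p : B, A u p
  have hZge : ∀ u (p : B), A u p ≤ Z u := fun u p => le_ciSup (hAB u) p
  have hZlip : ∀ u v, Z u ≤ Z v + P * ‖u - v‖ := by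
    intro u v
    refine ciSup_le fun p => ?_
    have hp : ‖p.1‖ ≤ P := mem_closedBall_zero_iff.1 p.2
    have h1 := (abs_le.1 (inner_le_of_norm_le (p := u - v) hp)).2
    rw [inner_sub_right] at h1
    have h2 := hZge v p
    have h2' : inner ℝ p.1 v - 2 * ρ * ‖p.1‖ - φ p.1 ≤ Z v := h2
    show inner ℝ p.1 u - 2 * ρ * ‖p.1‖ - φ p.1 ≤ _
    linarith
  have hZx : ∀ i, Z (x i) ≤ z i := by
    intro i
    refine ciSup_le fun p => ?_
    have := le_envl (x := x) (ρ := ρ) z p.1 i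
    rw [real_inner_comm] at this
    show inner ℝ p.1 (x i) - 2 * ρ * ‖p.1‖ - φ p.1 ≤ _
    linarith
  refine ⟨Z, ?_, ?_, ?_, ?_, ?_⟩
  · refine ⟨convex_univ, fun u _ v _ s t hs ht hst => ?_⟩
    refine ciSup_le fun p => ?_
    have h1 : inner ℝ p.1 u - 2 * ρ * ‖p.1‖ - φ p.1 ≤ Z u := hZge u p
    have h2 : inner ℝ p.1 v - 2 * ρ * ‖p.1‖ - φ p.1 ≤ Z v := hZge v p
    show inner ℝ p.1 (s • u + t • v) - 2 * ρ * ‖p.1‖ - φ p.1 ≤ s • Z u + t • Z v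
    rw [inner_add_right, inner_smul_right, inner_smul_right, smul_eq_mul, smul_eq_mul]
    have h3 := mul_le_mul_of_nonneg_left h1 hs
    have h4 := mul_le_mul_of_nonneg_left h2 ht
    have ht' : t = 1 - s := by linarith
    subst ht'
    linarith
  · intro u v
    rw [abs_le]
    have h1 := hZlip u v
    have h2 := hZlip v u
    rw [norm_sub_rev] at h2
    constructor <;> linarith
  · intro u hu
    refine ciSup_le fun p => ?_
    have h1 := (abs_le.1 (inner_le_of_norm_le (p := p.1) hu)).2
    rw [real_inner_comm] at h1
    have h2 := envl_nonneg (x := x) (ρ := ρ) z p.1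
    show inner ℝ p.1 u - 2 * ρ * ‖p.1‖ - φ p.1 ≤ _
    linarith
  · intro u
    refine le_trans ?_ (hZge u ⟨0, by simp [B, hP.le]⟩)
    have : φ 0 ≤ ρ * P := envl_le hρP.le fun i => by
      simp only [inner_zero_right, norm_zero]
      linarith [hzP i]
    show _ ≤ inner ℝ 0 u - 2 * ρ * ‖(0 : EuclideanSpace ℝ (Fin d))‖ - φ 0
    simp only [inner_zero_left, norm_zero]
    linarith
  · intro i
    refine (hcell i).trans (measure_mono ?_)
    intro p hp y
    have hp' : φ p ≤ inner ℝ (x i) p - z i - 2 * ρ * ‖p‖ := hp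
    have hpP : ‖p‖ ≤ P := by
      have h0 := envl_nonneg (x := x) (ρ := ρ) z p
      have h1 := (abs_le.1 (inner_le_of_norm_le (p := p) (hx i))).2
      have h2 := hzP i
      have : ρ * ‖p‖ ≤ ρ * P := by linarith
      exact le_of_mul_le_mul_left this hρ
    have h1 : inner ℝ p y - 2 * ρ * ‖p‖ - φ p ≤ Z y := hZge y ⟨p, by simpa [B] using hpP⟩
    rw [inner_sub_right]
    have h2 := hZx i
    have h3 : inner ℝ (x i) p = inner ℝ p (x i) := real_inner_comm _ _
    linarith

lemma sq_mul_le_sum_second_diff {d : ℕ} (hd : 0 < d) {Z : Euc d → ℝ}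
    (hZ : ConvexOn ℝ Set.univ Z) {x : Euc d} {h f : ℝ} (hh : 0 < h)
    (hvol : ENNReal.ofReal ((h * f) ^ d) ≤
      volume {p : Euc d | ∀ y, Z x + inner ℝ p (y - x) ≤ Z y}) :
    h ^ 2 * f ≤ ∑ k, (Z (x + h • stdVec k) + Z (x - h • stdVec k) - 2 * Z x) := by
  set l : Fin d → ℝ := fun k => (Z x - Z (x - h • stdVec k)) / h with hl
  set u : Fin d → ℝ := fun k => (Z (x + h • stdVec k) - Z x) / h with hu
  have hlu : ∀ k, 0 ≤ u k - l k := by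
    intro k
    have := hZ.2 (Set.mem_univ (x + h • stdVec k)) (Set.mem_univ (x - h • stdVec k))
      (by norm_num : (0 : ℝ) ≤ 1 / 2) (by norm_num : (0 : ℝ) ≤ 1 / 2) (by norm_num)
    have e : (1 / 2 : ℝ) • (x + h • stdVec k) + (1 / 2 : ℝ) • (x - h • stdVec k) = x := by
      module
    rw [e] at this
    simp only [smul_eq_mul] at this
    simp only [hl, hu]
    rw [← sub_div]
    apply div_nonneg _ hh.le
    linarith
  have hsub : {p : Euc d | ∀ y, Z x + inner ℝ p (y - x) ≤ Z y} ⊆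
      (WithLp.ofLp : Euc d → Fin d → ℝ) ⁻¹' Set.Icc l u := by
    intro p hp
    refine ⟨fun k => ?_, fun k => ?_⟩
    · have := hp (x - h • stdVec k)
      rw [sub_sub_cancel_left, inner_neg_right, inner_smul_right] at this
      simp only [EuclideanSpace.inner_single_right, one_mul, conj_trivial] at this
      simp only [hl]
      rw [div_le_iff₀ hh]
      linarith
    · have := hp (x + h • stdVec k)
      rw [add_sub_cancel_left, inner_smul_right] at this
      simp only [EuclideanSpace.inner_single_right, one_mul, conj_trivial] at this
      simp only [hu]
      rw [le_div_iff₀ hh]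
      linarith
  have h1 := hvol.trans (measure_mono hsub)
  rw [(PiLp.volume_preserving_ofLp (Fin d)).measure_preimage measurableSet_Icc.nullMeasurableSet,
    Real.volume_Icc_pi, ← ENNReal.ofReal_prod_of_nonneg (fun k _ => hlu k),
    ENNReal.ofReal_le_ofReal_iff (Finset.prod_nonneg fun k _ => hlu k)] at h1
  have h2 : ∏ k, (u k - l k) ≤ (∑ k, (u k - l k)) ^ d := by
    have h3 : ∏ k, (u k - l k) ≤ ∏ k : Fin d, (∑ k, (u k - l k)) :=
      Finset.prod_le_prod (fun k _ => hlu k) fun k hk =>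
        Finset.single_le_sum (f := fun k => u k - l k) (fun k _ => hlu k) hk
    simpa using h3
  have h3 : h * f ≤ ∑ k, (u k - l k) :=
    le_of_pow_le_pow_left₀ hd.ne' (Finset.sum_nonneg fun k _ => hlu k) (h1.trans h2)
  have h4 : ∑ k, (Z (x + h • stdVec k) + Z (x - h • stdVec k) - 2 * Z x)
      = h * ∑ k, (u k - l k) := by
    rw [Finset.mul_sum]
    refine Finset.sum_congr rfl fun k _ => ?_
    simp only [hl, hu]
    field_simp
    ring
  rw [h4]
  nlinarith

/-- Rounding down to the lattice of mesh `h`. -/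
noncomputable def latRound {d : ℕ} (h : ℝ) (x : Euc d) : Euc d :=
  WithLp.toLp 2 fun i => h * (⌊x i / h⌋ : ℝ)

lemma latRound_measurable {d : ℕ} (h : ℝ) : Measurable (latRound h : Euc d → Euc d) := by
  unfold latRound
  refine (WithLp.measurable_toLp 2 (Fin d → ℝ)).comp (measurable_pi_lambda _ fun i => ?_)
  have h1 : Measurable fun x : Euc d => x i := by fun_prop
  exact (((measurable_from_top (f := fun n : ℤ => (n : ℝ))).comp
    (Int.measurable_floor.comp (h1.div_const h)))).const_mul h

lemma latRound_add {d : ℕ} {h : ℝ} (hh : 0 < h) (x : Euc d) (k : Fin d) :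
    latRound h (x + h • stdVec k) = latRound h x + h • stdVec k := by
  ext i
  simp only [latRound, PiLp.add_apply, PiLp.smul_apply, smul_eq_mul,
    PiLp.single_apply]
  by_cases hik : i = k
  · subst hik
    simp only [if_true, mul_one]
    rw [add_div, div_self hh.ne', Int.floor_add_one]
    push_cast; ring
  · simp [hik]

lemma latRound_sub {d : ℕ} {h : ℝ} (hh : 0 < h) (x : Euc d) (k : Fin d) :
    latRound h (x - h • stdVec k) = latRound h x - h • stdVec k := by
  have := latRound_add hh (x - h • stdVec k) k
  rw [sub_add_cancel] at this
  rw [this, add_sub_cancel_right]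

lemma norm_sub_latRound {d : ℕ} {h : ℝ} (hh : 0 < h) (x : Euc d) :
    ‖x - latRound h x‖ ≤ d * h := by
  rw [EuclideanSpace.norm_eq]
  refine Real.sqrt_le_iff.2 ⟨by positivity, ?_⟩
  have : ∀ i, ‖(x - latRound h x) i‖ ^ 2 ≤ h ^ 2 := by
    intro i
    have e : (x - latRound h x) i = h * Int.fract (x i / h) := by
      simp only [latRound, PiLp.sub_apply, Int.fract]
      field_simp
    rw [e, norm_mul, Real.norm_of_nonneg hh.le, Real.norm_of_nonneg (Int.fract_nonneg _), mul_pow]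
    have h1 := Int.fract_nonneg (x i / h)
    have h2 := (Int.fract_lt_one (x i / h)).le
    nlinarith [pow_le_one₀ h1 h2 (n := 2), sq_nonneg h]
  refine (Finset.sum_le_sum fun i _ => this i).trans ?_
  simp only [Finset.sum_const, Finset.card_univ, Fintype.card_fin, nsmul_eq_mul, mul_pow]
  have : (d : ℝ) ≤ (d : ℝ) ^ 2 := by
    rcases Nat.eq_zero_or_pos d with h0 | h0
    · simp [h0]
    · have : (1 : ℝ) ≤ d := by exact_mod_cast h0
      nlinarith
  nlinarith [sq_nonneg h]

/-- The point of the lattice of mesh `h` with integer coordinates `k`. -/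
noncomputable def latPt {d : ℕ} (h : ℝ) (k : Fin d → ℤ) : Euc d :=
  WithLp.toLp 2 fun i => h * (k i : ℝ)

lemma volume_latRound_eq {d : ℕ} {h : ℝ} (hh : 0 < h) (k : Fin d → ℤ) :
    volume {x : Euc d | latRound h x = latPt h k} = ENNReal.ofReal (h ^ d) := by
  have e : {x : Euc d | latRound h x = latPt h k} = (WithLp.ofLp : Euc d → Fin d → ℝ) ⁻¹'
      Set.pi Set.univ fun i => Set.Ico (h * (k i : ℝ)) (h * k i + h) := by
    ext x
    simp only [Set.mem_ofPred_eq, Set.mem_preimage, Set.mem_pi, Set.mem_univ, true_implies,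
      Set.mem_Ico]
    have h1 : latRound h x = latPt h k ↔ ∀ i, ⌊x i / h⌋ = k i := by
      constructor
      · intro hx i
        have := congrArg (fun y : Euc d => y i) hx
        simp only [latRound, latPt] at this
        exact_mod_cast mul_left_cancel₀ hh.ne' this
      · intro hx
        ext i
        simp [latRound, latPt, hx i]
    rw [h1]
    refine forall_congr' fun i => ?_
    rw [Int.floor_eq_iff, le_div_iff₀ hh, div_lt_iff₀ hh]
    constructor <;> rintro ⟨h2, h3⟩ <;> constructor <;> linarith
  rw [e, (PiLp.volume_preserving_ofLp (Fin d)).measure_preimage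
    (MeasurableSet.univ_pi fun i => measurableSet_Ico).nullMeasurableSet, Real.volume_pi_Ico]
  simp [ENNReal.ofReal_pow hh.le]

lemma exists_lattice_finset {d : ℕ} {h : ℝ} (hh : 0 < h) (ρ : ℝ) :
    ∃ S : Finset (Fin d → ℤ), ∀ k, k ∈ S ↔ ‖(latPt h k : Euc d)‖ ≤ ρ := by
  classical
  refine ⟨(Fintype.piFinset fun _ => Finset.Icc (-⌈ρ / h⌉) ⌈ρ / h⌉).filter
    (fun k => ‖(latPt h k : Euc d)‖ ≤ ρ), fun k => ?_⟩
  rw [Finset.mem_filter, and_iff_right_iff_imp]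
  intro hk
  rw [Fintype.mem_piFinset]
  intro i
  rw [Finset.mem_Icc, ← abs_le]
  have h1 := (PiLp.norm_apply_le (latPt h k : Euc d) i).trans hk
  simp only [latPt, norm_mul, Real.norm_of_nonneg hh.le, Real.norm_eq_abs] at h1
  have h2 : (|(k i : ℝ)|) ≤ ρ / h := by rw [le_div_iff₀ hh]; linarith
  have h3 := h2.trans (Int.le_ceil _)
  exact_mod_cast h3

lemma lattice_sum_le {d : ℕ} {F : Euc d → ℝ} (hF0 : ∀ x, 0 ≤ F x)
    (hFi : Integrable F) {h η ρ : ℝ} (hh : 0 < h) (hη : 0 ≤ η) (hh1 : d * h ≤ 1)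
    (hosc : ∀ x y : Euc d, ‖x - y‖ ≤ d * h → |F x - F y| ≤ η)
    (S : Finset (Fin d → ℤ)) (hS : ∀ k ∈ S, ‖(latPt h k : Euc d)‖ ≤ ρ) :
    ∑ k ∈ S, h ^ d * F (latPt h k) ≤
      (∫ x, F x) + η * (volume (closedBall (0 : Euc d) (ρ + 1))).toReal := by
  set Q : (Fin d → ℤ) → Set (Euc d) := fun k => {x | latRound h x = latPt h k} with hQ
  have hQm : ∀ k, MeasurableSet (Q k) := fun k =>
    latRound_measurable h (measurableSet_singleton _)
  have hinj : ∀ k l : Fin d → ℤ, (latPt h k : Euc d) = latPt h l → k = l := by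
    intro k l hkl
    ext i
    have := congrArg (fun y : Euc d => y i) hkl
    simp only [latPt] at this
    exact_mod_cast mul_left_cancel₀ hh.ne' this
  have hB : (⋃ k ∈ S, Q k) ⊆ closedBall (0 : Euc d) (ρ + 1) := by
    refine Set.iUnion₂_subset fun k hk x hx => ?_
    have h1 := norm_sub_latRound hh x
    have h2 : latRound h x = latPt h k := hx
    rw [h2] at h1
    have h3 := hS k hk
    rw [mem_closedBall_zero_iff]
    have := norm_add_le (x - latPt h k) (latPt h k)
    rw [sub_add_cancel] at this
    linarith
  have hfin : volume (closedBall (0 : Euc d) (ρ + 1)) ≠ ∞ := measure_closedBall_lt_top.ne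
  have hiG : IntegrableOn (fun x => F x + η) (closedBall (0 : Euc d) (ρ + 1)) :=
    hFi.integrableOn.add (integrableOn_const hfin)
  calc ∑ k ∈ S, h ^ d * F (latPt h k)
      ≤ ∑ k ∈ S, ∫ x in Q k, (F x + η) := by
        refine Finset.sum_le_sum fun k hk => ?_
        have e : h ^ d * F (latPt h k) = ∫ x in Q k, F (latPt h k) := by
          rw [setIntegral_const]
          simp only [hQ, measureReal_def, volume_latRound_eq hh, smul_eq_mul]
          rw [ENNReal.toReal_ofReal (by positivity)]
        rw [e]
        refine setIntegral_mono_on ?_ (hiG.mono_set ?_) (hQm k) ?_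
        · refine integrableOn_const ?_
          simp only [hQ, volume_latRound_eq hh]; exact ENNReal.ofReal_ne_top
        · exact (Set.subset_biUnion_of_mem (u := Q) hk).trans hB
        · intro x hx
          have h1 := norm_sub_latRound hh x
          have h2 : latRound h x = latPt h k := hx
          rw [h2] at h1
          have := (abs_le.1 (hosc _ _ h1)).1
          linarith
    _ = ∫ x in ⋃ k ∈ S, Q k, (F x + η) := by
        rw [integral_biUnion_finset S (fun k _ => hQm k)]
        · intro k _ l _ hkl
          refine Set.disjoint_left.2 fun x hx hx' => hkl (hinj k l ?_)
          exact (show latRound h x = _ from hx).symm.trans hx'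
        · exact fun k hk => hiG.mono_set ((Set.subset_biUnion_of_mem (u := Q) hk).trans hB)
    _ ≤ ∫ x in closedBall (0 : Euc d) (ρ + 1), (F x + η) :=
        setIntegral_mono_set hiG (Filter.Eventually.of_forall fun x => add_nonneg (hF0 x) hη)
          (LE.le.eventuallyLE hB)
    _ = (∫ x in closedBall (0 : Euc d) (ρ + 1), F x)
        + η * (volume (closedBall (0 : Euc d) (ρ + 1))).toReal := by
        rw [integral_add hFi.integrableOn (integrableOn_const hfin), setIntegral_const]
        simp [measureReal_def, mul_comm]
    _ ≤ _ := by
        exact add_le_add (setIntegral_le_integral hFi (Filter.Eventually.of_forall hF0)) le_rfl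

lemma exists_lattice_potential {d : ℕ} (hd : 0 < d) {f : Euc d → ℝ} (hf : Continuous f)
    (hf0 : ∀ x, 0 ≤ f x) {ρ : ℝ} (hρ : 0 < ρ) (hsupp : ∀ x, ρ < ‖x‖ → f x = 0) {P : ℝ}
    (hP : 0 < P) (hfP : ∫ x, f x ^ d < (volume (ball (0 : Euc d) (P / 3))).toReal) :
    ∃ h₀ > 0, ∀ h, 0 < h → h < h₀ → ∃ Z : Euc d → ℝ, ConvexOn ℝ Set.univ Z ∧
      (∀ u v, |Z u - Z v| ≤ P * ‖u - v‖) ∧ (∀ u, ‖u‖ ≤ 2 * ρ → Z u ≤ 0) ∧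
      (∀ u, -(ρ * P) ≤ Z u) ∧ ∀ x : Euc d, h ^ 2 * f (latRound h x) ≤
        ∑ k, (Z (latRound h x + h • stdVec k) + Z (latRound h x - h • stdVec k)
          - 2 * Z (latRound h x)) := by
  set F : Euc d → ℝ := fun x => f x ^ d with hF
  have hFc : Continuous F := hf.pow d
  have hFs : HasCompactSupport F := by
    refine HasCompactSupport.intro (isCompact_closedBall (0 : Euc d) ρ) fun x hx => ?_
    rw [mem_closedBall_zero_iff, not_le] at hx
    simp [hF, hsupp x hx, hd.ne']
  have hFi : Integrable F := hFc.integrable_of_hasCompactSupport hFs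
  have huc := hFs.uniformContinuous_of_continuous hFc
  set V := (volume (closedBall (0 : Euc d) (ρ + 1))).toReal with hV
  have hV0 : 0 ≤ V := ENNReal.toReal_nonneg
  set gap := (volume (ball (0 : Euc d) (P / 3))).toReal - ∫ x, f x ^ d with hgap
  have hgap0 : 0 < gap := sub_pos.2 hfP
  set η := gap / (V + 1) with hη
  have hη0 : 0 < η := by positivity
  obtain ⟨κ, hκ, hκu⟩ := Metric.uniformContinuous_iff.1 huc η hη0
  have hd' : (0 : ℝ) < d := by exact_mod_cast hd
  refine ⟨min (κ / d) (1 / d), by positivity, fun h hh hh0 => ?_⟩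
  have hh1 : d * h < κ := by
    have := hh0.trans_le (min_le_left _ _)
    rwa [lt_div_iff₀ hd', mul_comm] at this
  have hh2 : d * h ≤ 1 := by
    have := hh0.trans_le (min_le_right _ _)
    rw [lt_div_iff₀ hd', mul_comm] at this
    exact this.le
  obtain ⟨S, hS⟩ := exists_lattice_finset (d := d) hh ρ
  have hsum := lattice_sum_le (F := F) (fun x => pow_nonneg (hf0 x) d) hFi hh hη0.le hh2
    (fun x y hxy => (by
      have := hκu (a := x) (b := y) (by rw [dist_eq_norm]; linarith)
      rw [Real.dist_eq] at this
      exact this.le)) S (fun k hk => (hS k).1 hk)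
  obtain ⟨Z, hZc, hZL, hZ0, hZl, hZm⟩ := exists_semidiscrete_potential hd
    (ι := S) (fun k => latPt h k.1) hρ (fun k => (hS k.1).1 k.2)
    (fun k => (h * f (latPt h k.1)) ^ d)
    (fun k => pow_nonneg (mul_nonneg hh.le (hf0 _)) d) hP (by
      rw [Finset.sum_coe_sort S (fun k => (h * f (latPt h k)) ^ d)]
      rw [← ENNReal.ofReal_toReal (measure_ball_lt_top (μ := (volume : Measure (Euc d)))
        (x := 0) (r := P / 3)).ne]
      apply ENNReal.ofReal_le_ofReal
      have e : ∑ k ∈ S, (h * f (latPt h k)) ^ d = ∑ k ∈ S, h ^ d * F (latPt h k) :=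
        Finset.sum_congr rfl fun k _ => mul_pow _ _ _
      rw [e]
      refine hsum.trans ?_
      have : η * V ≤ gap := by
        rw [hη, div_mul_eq_mul_div, div_le_iff₀ (by positivity)]
        nlinarith
      have h2 : ∫ x, F x = ∫ x, f x ^ d := rfl
      rw [h2]
      linarith)
  refine ⟨Z, hZc, hZL, hZ0, hZl, fun x => ?_⟩
  by_cases hx : ‖latRound h x‖ ≤ ρ
  · have ek : latRound h x = latPt h fun i => ⌊x i / h⌋ := rfl
    have hk : (fun i => ⌊x i / h⌋) ∈ S := (hS _).2 (by rw [← ek]; exact hx)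
    have := hZm ⟨_, hk⟩
    exact sq_mul_le_sum_second_diff hd hZc hh this
  · rw [hsupp _ (not_le.1 hx), mul_zero]
    refine Finset.sum_nonneg fun k _ => ?_
    have := hZc.2 (Set.mem_univ (latRound h x + h • stdVec k))
      (Set.mem_univ (latRound h x - h • stdVec k))
      (by norm_num : (0 : ℝ) ≤ 1 / 2) (by norm_num : (0 : ℝ) ≤ 1 / 2) (by norm_num)
    have e : (1 / 2 : ℝ) • (latRound h x + h • stdVec k)
        + (1 / 2 : ℝ) • (latRound h x - h • stdVec k) = latRound h x := by
      module
    rw [e] at this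
    simp only [smul_eq_mul] at this
    linarith

lemma hasFDerivAt_mollify {d : ℕ} {k Z : Euc d → ℝ} (hk : ContDiff ℝ 1 k)
    (hks : HasCompactSupport k) (hZ : Continuous Z) (x : Euc d) :
    ∃ L : Euc d →L[ℝ] ℝ, HasFDerivAt (fun x => ∫ t, k t * Z (x - t)) L x ∧
      ∀ u, L u = ∫ t, fderiv ℝ k t u * Z (x - t) := by
  refine ⟨_, hks.hasFDerivAt_convolution_left (ContinuousLinearMap.lsmul ℝ ℝ) hk
    hZ.locallyIntegrable x, fun u => ?_⟩
  rw [convolution_def]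
  rw [ContinuousLinearMap.integral_apply]
  · simp
  · have hc : Continuous fun t => ((ContinuousLinearMap.lsmul ℝ ℝ).precompL (Euc d)
        (fderiv ℝ k t)) (Z (x - t)) := by
      have h1 : Continuous (fderiv ℝ k) := hk.continuous_fderiv one_ne_zero
      have h2 : Continuous fun t => Z (x - t) := by fun_prop
      exact (((ContinuousLinearMap.lsmul ℝ ℝ).precompL (Euc d)).continuous.comp h1).clm_apply h2
    refine hc.integrable_of_hasCompactSupport ?_
    refine (hks.fderiv (𝕜 := ℝ)).mono' ?_
    intro t ht
    apply subset_closure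
    intro h0
    apply ht
    simp [h0]

lemma contDiff_mollify {d : ℕ} {k Z : Euc d → ℝ} (hk : ContDiff ℝ 2 k)
    (hks : HasCompactSupport k) (hZ : Continuous Z) :
    ContDiff ℝ 2 (fun x => ∫ t, k t * Z (x - t)) :=
  hks.contDiff_convolution_left (n := 2) (ContinuousLinearMap.lsmul ℝ ℝ) hk hZ.locallyIntegrable

lemma fderiv_fderiv_apply_eq_hess {d : ℕ} {w : Euc d → ℝ} (hw : ContDiff ℝ 2 w) (x u v : Euc d) :
    fderiv ℝ (fun y => fderiv ℝ w y u) x v = hess w x v u := by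
  have h1 : DifferentiableAt ℝ (fderiv ℝ w) x :=
    ((contDiff_fderiv hw).differentiable one_ne_zero) x
  have := (h1.hasFDerivAt.clm_apply (hasFDerivAt_const u x)).fderiv
  rw [this]
  simp

lemma hess_mollify {d : ℕ} {k Z : Euc d → ℝ} (hk : ContDiff ℝ 2 k)
    (hks : HasCompactSupport k) (hZ : Continuous Z) (x u : Euc d) :
    hess (fun x => ∫ t, k t * Z (x - t)) x u u = ∫ t, hess k t u u * Z (x - t) := by
  rw [← fderiv_fderiv_apply_eq_hess (contDiff_mollify hk hks hZ) x u u]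
  have e1 : (fun y => fderiv ℝ (fun x => ∫ t, k t * Z (x - t)) y u)
      = fun y => ∫ t, fderiv ℝ k t u * Z (y - t) := by
    funext y
    obtain ⟨L, hL, hLu⟩ := hasFDerivAt_mollify (hk.of_le one_le_two) hks hZ y
    rw [hL.fderiv, hLu]
  rw [e1]
  have hk' : ContDiff ℝ 1 fun t => fderiv ℝ k t u := (contDiff_fderiv hk).clm_apply contDiff_const
  have hks' : HasCompactSupport fun t => fderiv ℝ k t u := hks.fderiv_apply (𝕜 := ℝ) u
  obtain ⟨L, hL, hLu⟩ := hasFDerivAt_mollify hk' hks' hZ x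
  rw [hL.fderiv, hLu]
  refine integral_congr_ae (Filter.Eventually.of_forall fun t => ?_)
  simp only
  rw [fderiv_fderiv_apply_eq_hess hk]

lemma hess_nonneg_of_convexOn {d : ℕ} {w : Euc d → ℝ} (hw : ContDiff ℝ 2 w)
    (hc : ConvexOn ℝ Set.univ w) (x u : Euc d) : 0 ≤ hess w x u u := by
  have hg : ConvexOn ℝ Set.univ fun s : ℝ => w (x + s • u) := by
    refine ⟨convex_univ, fun s _ t _ a b ha hb hab => ?_⟩
    have := hc.2 (Set.mem_univ (x + s • u)) (Set.mem_univ (x + t • u)) ha hb hab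
    have e : a • (x + s • u) + b • (x + t • u) = x + (a • s + b • t) • u := by
      have : b = 1 - a := by linarith
      subst this
      simp only [smul_eq_mul]
      module
    rwa [e] at this
  have hm := hg.monotoneOn_deriv fun s _ => (hasDerivAt_line hw x u s).differentiableAt
  have e : deriv (fun s : ℝ => w (x + s • u)) = fun s => fderiv ℝ w (x + s • u) u :=
    funext fun s => (hasDerivAt_line hw x u s).deriv
  rw [e, monotoneOn_univ] at hm
  have h2 := (hasDerivAt_line_fderiv hw x u 0)
  rw [zero_smul, add_zero] at h2
  rw [← h2.deriv]
  exact hm.deriv_nonneg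

lemma exists_second_diff_approx {d : ℕ} {k : Euc d → ℝ} (hk : ContDiff ℝ 2 k)
    (hks : HasCompactSupport k) {η : ℝ} (hη : 0 < η) :
    ∃ h₀ > 0, ∀ h, 0 < h → h < h₀ → ∀ t u : Euc d, ‖u‖ = 1 →
      |(k (t + h • u) + k (t - h • u) - 2 * k t) / h ^ 2 - hess k t u u| ≤ η := by
  have hc : Continuous (hess k) := continuous_hess hk
  have hs : HasCompactSupport (hess k) := (hks.fderiv (𝕜 := ℝ)).fderiv (𝕜 := ℝ)
  have huc : UniformContinuous (hess k) := hs.uniformContinuous_of_continuous hc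
  obtain ⟨κ, hκ, hu⟩ : ∃ κ > 0, ∀ ⦃x y : Euc d⦄, dist x y < κ →
      dist (hess k x) (hess k y) < η / 2 := Metric.uniformContinuous_iff.1 huc (η / 2) (by positivity)
  refine ⟨κ, hκ, fun h hh hhκ t u hu1 => ?_⟩
  have hD1 : ∀ s : ℝ, |s| ≤ h →
      |fderiv ℝ k (t + s • u) u - fderiv ℝ k t u - s * hess k t u u| ≤ η / 2 * |s| := by
    intro s hs
    have key := Convex.norm_image_sub_le_of_norm_hasDerivWithin_le
      (f := fun s : ℝ => fderiv ℝ k (t + s • u) u - s * hess k t u u)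
      (f' := fun s : ℝ => hess k (t + s • u) u u - hess k t u u) (s := Set.Icc (-h) h) (C := η / 2)
      (x := 0) (y := s) ?_ ?_ (convex_Icc _ _) ⟨by linarith, hh.le⟩ (abs_le.1 hs)
    · simp only [zero_smul, add_zero, zero_mul, sub_zero, Real.norm_eq_abs] at key
      convert key using 2
      ring
    · intro r _
      have := (hasDerivAt_line_fderiv hk t u r).sub ((hasDerivAt_id r).mul_const (hess k t u u))
      simp only [id, one_mul] at this
      exact this.hasDerivWithinAt
    · intro r hr
      have h1 : ‖hess k (t + r • u) - hess k t‖ < η / 2 := by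
        have e0 : dist (hess k (t + r • u)) (hess k t) = ‖hess k (t + r • u) - hess k t‖ :=
          dist_eq_norm (E := Euc d →L[ℝ] Euc d →L[ℝ] ℝ) _ _
        rw [← e0]
        apply hu
        rw [dist_eq_norm, add_sub_cancel_left, norm_smul, hu1, mul_one, Real.norm_eq_abs]
        exact (abs_le.2 hr).trans_lt hhκ
      have h2 := (hess k (t + r • u) - hess k t).le_opNorm₂ u u
      rw [hu1, mul_one, mul_one] at h2
      exact h2.trans h1.le
  have key := Convex.norm_image_sub_le_of_norm_hasDerivWithin_le
      (f := fun s : ℝ => k (t + s • u) + k (t + s • (-u)) - s ^ 2 * hess k t u u)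
      (f' := fun s : ℝ => fderiv ℝ k (t + s • u) u + fderiv ℝ k (t + s • (-u)) (-u)
        - 2 * s * hess k t u u) (s := Set.Icc 0 h) (C := η * h) (x := 0) (y := h)
      ?_ ?_ (convex_Icc _ _) ⟨le_rfl, hh.le⟩ ⟨hh.le, le_rfl⟩
  · simp only [zero_smul, add_zero, smul_neg, Real.norm_eq_abs, sub_zero, neg_zero] at key
    have h3 : ∀ A B : ℝ, A / h ^ 2 - B = (A - h ^ 2 * B) / h ^ 2 := by
      intro A B; field_simp
    rw [h3, abs_div, abs_of_pos (by positivity : 0 < h ^ 2), div_le_iff₀ (by positivity)]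
    rw [abs_of_pos hh] at key
    have e : k (t + h • u) + k (t - h • u) - 2 * k t - h ^ 2 * hess k t u u
        = k (t + h • u) + k (t + -(h • u)) - h ^ 2 * hess k t u u
          - (k t + k t - 0 ^ 2 * hess k t u u) := by
      rw [sub_eq_add_neg t]; ring
    rw [e]; refine key.trans (le_of_eq (by ring))
  · intro r _
    have := ((hasDerivAt_line hk t u r).add (hasDerivAt_line hk t (-u) r)).sub
      ((hasDerivAt_pow 2 r).mul_const (hess k t u u))
    simp only [Nat.cast_ofNat, Nat.add_one_sub_one, pow_one] at this
    exact this.hasDerivWithinAt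
  · intro r hr
    have hr' : |r| ≤ h := by rw [abs_of_nonneg hr.1]; exact hr.2
    have a1 := hD1 r hr'
    have a2 := hD1 (-r) (by rwa [abs_neg])
    rw [abs_neg] at a2
    have e : t + r • (-u) = t + (-r) • u := by simp
    rw [e, map_neg, Real.norm_eq_abs]
    have h5 : η / 2 * |r| ≤ η / 2 * h := by gcongr
    rw [abs_le] at a1 a2 ⊢
    constructor <;> linarith [a1.1, a1.2, a2.1, a2.2]

lemma integrable_mul_of_abs_le {d : ℕ} {k g G : Euc d → ℝ} (hk : Continuous k)
    (hks : HasCompactSupport k) (hg : Measurable g) (hG : Continuous G) (h : ∀ t, |g t| ≤ G t) :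
    Integrable fun t => k t * g t := by
  have hi : Integrable fun t => |k t| * G t := by
    refine (hk.abs.mul hG).integrable_of_hasCompactSupport ?_
    refine hks.mono fun t ht hk0 => ht ?_
    simp [hk0]
  refine hi.mono' ((hk.measurable.mul hg).aestronglyMeasurable)
    (Filter.Eventually.of_forall fun t => ?_)
  rw [norm_mul, Real.norm_eq_abs, Real.norm_eq_abs]
  exact mul_le_mul_of_nonneg_left (h t) (abs_nonneg _)

lemma integral_add_sub_two_mul_div {d : ℕ} {A B C : Euc d → ℝ} (hA : Integrable A)
    (hB : Integrable B) (hC : Integrable C) (q : ℝ) :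
    ∫ t, (A t + B t - 2 * C t) / q = ((∫ t, A t) + (∫ t, B t) - 2 * ∫ t, C t) / q := by
  rw [integral_div]
  congr 1
  have h1 : ∫ t, (A t + B t - 2 * C t) = (∫ t, (A t + B t)) - ∫ t, 2 * C t :=
    integral_sub (hA.add hB) (hC.const_mul 2)
  rw [h1, integral_add hA hB, integral_const_mul]

lemma integral_second_diff_mul_ge {d : ℕ} {k f : Euc d → ℝ} (hk : Continuous k)
    (hks : HasCompactSupport k) (hk0 : ∀ t, 0 ≤ k t) (hk1 : ∫ t, k t = 1) {x : Euc d} {h c P : ℝ}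
    (hh : 0 < h) (hP : 0 ≤ P)
    (hf : ∀ t, k t ≠ 0 → c ≤ f (latRound h (x - t))) {Z : Euc d → ℝ}
    (hZL : ∀ u v, |Z u - Z v| ≤ P * ‖u - v‖)
    (hZ : ∀ x : Euc d, h ^ 2 * f (latRound h x) ≤
        ∑ k, (Z (latRound h x + h • stdVec k) + Z (latRound h x - h • stdVec k)
          - 2 * Z (latRound h x))) :
    c ≤ ∑ i, ∫ t, (k (t + h • stdVec i) + k (t - h • stdVec i) - 2 * k t) / h ^ 2
      * Z (latRound h (x - t)) := by
  have hZc : Continuous Z := by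
    have : LipschitzWith P.toNNReal Z := LipschitzWith.of_dist_le_mul fun u v => by
      rw [Real.dist_eq, dist_eq_norm, Real.coe_toNNReal P hP]; exact hZL u v
    exact this.continuous
  have hZm : Measurable fun y : Euc d => Z (latRound h y) :=
    hZc.measurable.comp (latRound_measurable h)
  have hZb : ∀ y : Euc d, |Z (latRound h y)| ≤ |Z y| + P * (d * h) := by
    intro y
    have h1 := hZL (latRound h y) y
    have h2 := norm_sub_latRound hh y
    rw [norm_sub_rev] at h2
    have h3 := mul_le_mul_of_nonneg_left h2 hP
    have h4 := abs_sub_abs_le_abs_sub (Z (latRound h y)) (Z y)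
    linarith
  have hInt : ∀ w : Euc d, Integrable fun t => k t * Z (latRound h (x - t + w)) := fun w =>
    integrable_mul_of_abs_le hk hks (hZm.comp (by fun_prop : Measurable fun t : Euc d => x - t + w))
      (G := fun t => |Z (x - t + w)| + P * (d * h)) (by fun_prop) fun t => hZb _
  have hint2 : ∀ w : Euc d, Integrable fun t => k (t + w) * Z (latRound h (x - t)) := by
    intro w
    have := (hInt w).comp_add_right w
    refine this.congr (Filter.Eventually.of_forall fun t => ?_)
    simp only
    congr 3; abel
  have hshift : ∀ w : Euc d, ∫ t, k (t + w) * Z (latRound h (x - t))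
      = ∫ t, k t * Z (latRound h (x - t + w)) := by
    intro w
    rw [← integral_add_right_eq_self (fun t => k t * Z (latRound h (x - t + w))) w]
    refine integral_congr_ae (Filter.Eventually.of_forall fun t => ?_)
    simp only
    congr 3; abel
  have hi0 : Integrable fun t => k t * Z (latRound h (x - t)) := by simpa using hInt 0
  have e1 : ∀ i : Fin d, ∫ t, (k (t + h • stdVec i) + k (t - h • stdVec i) - 2 * k t) / h ^ 2
      * Z (latRound h (x - t)) = ∫ t, k t * ((Z (latRound h (x - t) + h • stdVec i)
        + Z (latRound h (x - t) - h • stdVec i) - 2 * Z (latRound h (x - t))) / h ^ 2) := by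
    intro i
    have a1 := hint2 (h • stdVec i)
    have a2 := hint2 (-(h • stdVec i))
    have b1 := hInt (h • stdVec i)
    have b2 := hInt (-(h • stdVec i))
    calc _ = ∫ t, ((k (t + h • stdVec i) * Z (latRound h (x - t))
          + k (t + -(h • stdVec i)) * Z (latRound h (x - t)))
          - 2 * (k t * Z (latRound h (x - t)))) / h ^ 2 := by
          refine integral_congr_ae (Filter.Eventually.of_forall fun t => ?_)
          simp only [sub_eq_add_neg]
          ring
      _ = ∫ t, ((k t * Z (latRound h (x - t + h • stdVec i))
          + k t * Z (latRound h (x - t + -(h • stdVec i))))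
          - 2 * (k t * Z (latRound h (x - t)))) / h ^ 2 := by
          rw [integral_add_sub_two_mul_div a1 a2 hi0, integral_add_sub_two_mul_div b1 b2 hi0,
            hshift, hshift]
      _ = _ := by
          refine integral_congr_ae (Filter.Eventually.of_forall fun t => ?_)
          simp only
          rw [latRound_add hh, ← sub_eq_add_neg, latRound_sub hh]
          ring
  have hint3 : ∀ i : Fin d, Integrable fun t => k t * ((Z (latRound h (x - t) + h • stdVec i)
        + Z (latRound h (x - t) - h • stdVec i) - 2 * Z (latRound h (x - t))) / h ^ 2) := by
    intro i
    have b1 := hInt (h • stdVec i)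
    have b2 := hInt (-(h • stdVec i))
    refine (((b1.add b2).sub (hi0.const_mul 2)).div_const (h ^ 2)).congr
      (Filter.Eventually.of_forall fun t => ?_)
    simp only [Pi.add_apply, Pi.sub_apply]
    rw [latRound_add hh, ← sub_eq_add_neg, latRound_sub hh]
    ring
  rw [Finset.sum_congr rfl fun i _ => e1 i, ← integral_finsetSum _ fun i _ => hint3 i]
  have hkI : Integrable k := hk.integrable_of_hasCompactSupport hks
  have e2 : c = ∫ t, k t * c := by rw [integral_mul_const, hk1, one_mul]
  rw [e2]
  refine integral_mono (hkI.mul_const c) (integrable_finsetSum _ fun i _ => hint3 i) fun t => ?_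
  simp only
  rw [← Finset.mul_sum, ← Finset.sum_div]
  by_cases ht : k t = 0
  · simp [ht]
  refine mul_le_mul_of_nonneg_left ?_ (hk0 t)
  rw [le_div_iff₀ (by positivity)]
  have h1 := hZ (x - t)
  have h2 := mul_le_mul_of_nonneg_left (hf t ht) (sq_nonneg h)
  linarith

lemma exists_mollifier (d : ℕ) {r : ℝ} (hr0 : 0 < r) :
    ∃ k : Euc d → ℝ, ContDiff ℝ 2 k ∧ HasCompactSupport k ∧ (∀ t, 0 ≤ k t) ∧ ∫ t, k t = 1 ∧
      ∀ t, k t ≠ 0 → ‖t‖ < r := by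
  let φ : ContDiffBump (0 : Euc d) := ⟨r / 2, r, by positivity, by linarith⟩
  refine ⟨φ.normed volume, φ.contDiff_normed (n := 2), φ.hasCompactSupport_normed,
    fun t => φ.nonneg_normed t, φ.integral_normed, fun t ht => ?_⟩
  have : t ∈ Function.support (φ.normed volume) := ht
  rw [φ.support_normed_eq, mem_ball_zero_iff] at this
  exact this

lemma hess_eq_zero_of_support {d : ℕ} {k : Euc d → ℝ} {r : ℝ} (hksupp : ∀ t, k t ≠ 0 → ‖t‖ < r)
    (t : Euc d) (ht : r < ‖t‖) : hess k t = 0 := by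
  have hsub : tsupport k ⊆ closedBall 0 r :=
    closure_minimal (fun t ht => mem_closedBall_zero_iff.2 (hksupp t ht).le) isClosed_closedBall
  have h0 : t ∉ tsupport (fderiv ℝ (fderiv ℝ k)) := by
    intro h1
    have h2 := (tsupport_fderiv_subset ℝ (f := fderiv ℝ k)) h1
    have h3 := hsub ((tsupport_fderiv_subset ℝ (f := k)) h2)
    rw [mem_closedBall_zero_iff] at h3
    exact absurd h3 (not_le.2 ht)
  exact image_eq_zero_of_notMem_tsupport h0

lemma exists_hess_bound {d : ℕ} {k : Euc d → ℝ} (hk : ContDiff ℝ 2 k) (hks : HasCompactSupport k) :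
    ∃ C : ℝ, 0 ≤ C ∧ ∀ t, ‖hess k t‖ ≤ C := by
  have hs : HasCompactSupport (hess k) := (hks.fderiv (𝕜 := ℝ)).fderiv (𝕜 := ℝ)
  have hc : Continuous fun t => ‖hess k t‖  :=
    Continuous.comp (continuous_norm (E := Euc d →L[ℝ] Euc d →L[ℝ] ℝ)) (continuous_hess hk)
  have hs' : HasCompactSupport fun t => ‖hess k t‖ :=
    HasCompactSupport.comp_left hs (norm_zero (E := Euc d →L[ℝ] Euc d →L[ℝ] ℝ))
  obtain ⟨C, hC⟩ := hs'.exists_bound_of_continuous hc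
  refine ⟨max C 0, le_max_right _ _, fun t => ?_⟩
  have h1 := (le_abs_self _).trans (hC t)
  exact h1.trans (le_max_left _ _)

lemma exists_convex_potential {d : ℕ} (hd : 0 < d) {f : Euc d → ℝ} (hf : Continuous f)
    (hf0 : ∀ x, 0 ≤ f x) {ρ : ℝ} (hρ : 0 < ρ) (hsupp : ∀ x, ρ < ‖x‖ → f x = 0) {P : ℝ}
    (hP : 0 < P) (hfP : ∫ x, f x ^ d < (volume (ball (0 : Euc d) (P / 3))).toReal)
    {ε : ℝ} (hε : 0 < ε) :
    ∃ z : Euc d → ℝ, ContDiff ℝ 2 z ∧ (∀ x u, 0 ≤ hess z x u u) ∧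
      (∀ x, ‖fderiv ℝ z x‖ ≤ P) ∧ (∀ x, ‖x‖ ≤ 2 * ρ → 0 ≤ z x ∧ z x ≤ 2 * ρ * P) ∧
      ∀ x, ‖x‖ ≤ 2 * ρ → f x - ε ≤ ∑ i, hess z x (stdVec i) (stdVec i) := by
  have hfs : HasCompactSupport f := by
    refine HasCompactSupport.intro (isCompact_closedBall (0 : Euc d) ρ) fun x hx => ?_
    rw [mem_closedBall_zero_iff, not_le] at hx
    exact hsupp x hx
  obtain ⟨κ, hκ, hκu⟩ := Metric.uniformContinuous_iff.1
    (hfs.uniformContinuous_of_continuous hf) (ε / 2) (by positivity)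
  set r := min ρ (κ / 4) with hr
  have hr0 : 0 < r := by positivity
  have hrρ : r ≤ ρ := min_le_left _ _
  have hrκ : r ≤ κ / 4 := min_le_right _ _
  obtain ⟨k, hkc, hks, hk0, hk1, hksupp⟩ := exists_mollifier d hr0
  obtain ⟨C, hC0, hC⟩ := exists_hess_bound hkc hks
  have hsuppH : ∀ t u : Euc d, r < ‖t‖ → hess k t u u = 0 := by
    intro t u ht
    rw [hess_eq_zero_of_support hksupp t ht]
    simp
  set V := (volume (closedBall (0 : Euc d) (2 * r))).toReal with hV
  have hV0 : 0 ≤ V := ENNReal.toReal_nonneg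
  have hd' : (0 : ℝ) < d := by exact_mod_cast hd
  set η := min 1 (ε / (4 * (d * (V + 1) * (4 * ρ * P)))) with hη
  have hη0 : 0 < η := by positivity
  obtain ⟨h₁, hh₁, happ⟩ := exists_second_diff_approx hkc hks hη0
  obtain ⟨h₂, hh₂, hpot⟩ := exists_lattice_potential hd hf hf0 hρ hsupp hP hfP
  obtain ⟨h, hh, hlt1, hlt2, hlt3, hlt4⟩ : ∃ h > 0, h < h₁ ∧ h < h₂ ∧ d * h ≤ r ∧
      d * (V + 1) * ((C + 1) * (P * (d * h))) ≤ ε / 4 := by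
    set m := min (min h₁ h₂) (min (r / d) (ε / (4 * (d * (V + 1) * ((C + 1) * (P * d)))))) with hm
    have hm0 : 0 < m := by positivity
    have m1 : m ≤ h₁ := (min_le_left _ _).trans (min_le_left _ _)
    have m2 : m ≤ h₂ := (min_le_left _ _).trans (min_le_right _ _)
    have m3 : m ≤ r / d := (min_le_right _ _).trans (min_le_left _ _)
    have m4 : m ≤ ε / (4 * (d * (V + 1) * ((C + 1) * (P * d)))) :=
      (min_le_right _ _).trans (min_le_right _ _)
    refine ⟨m / 2, by positivity, by linarith, by linarith, ?_, ?_⟩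
    · rw [le_div_iff₀ hd'] at m3
      nlinarith
    · rw [le_div_iff₀ (by positivity)] at m4
      have : 0 ≤ d * (V + 1) * ((C + 1) * (P * d)) := by positivity
      nlinarith
  obtain ⟨Z, hZc, hZL, hZ0, hZl, hZd⟩ := hpot h hh hlt2
  have hZlip : LipschitzWith P.toNNReal Z := LipschitzWith.of_dist_le_mul fun u v => by
    rw [Real.dist_eq, dist_eq_norm, Real.coe_toNNReal P hP.le]; exact hZL u v
  have hZcont := hZlip.continuous
  have hkcont := hkc.continuous
  have hkI : Integrable k := hkcont.integrable_of_hasCompactSupport hks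
  have hInt : ∀ x : Euc d, Integrable fun t => k t * Z (x - t) := fun x =>
    (hkcont.mul (by fun_prop)).integrable_of_hasCompactSupport hks.mul_right
  set z0 : Euc d → ℝ := fun x => ∫ t, k t * Z (x - t) with hz0
  have hz0c : ContDiff ℝ 2 z0 := contDiff_mollify hkc hks hZcont
  have hz0lip : ∀ x y, |z0 x - z0 y| ≤ P * ‖x - y‖ := by
    intro x y
    rw [hz0]
    simp only
    rw [← integral_sub (hInt x) (hInt y)]
    have e : P * ‖x - y‖ = ∫ t, k t * (P * ‖x - y‖) := by
      rw [integral_mul_const, hk1, one_mul]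
    rw [e, ← Real.norm_eq_abs]
    refine norm_integral_le_of_norm_le (hkI.mul_const _) (Filter.Eventually.of_forall fun t => ?_)
    rw [← mul_sub, norm_mul, Real.norm_of_nonneg (hk0 t)]
    refine mul_le_mul_of_nonneg_left ?_ (hk0 t)
    have := hZL (x - t) (y - t)
    rwa [sub_sub_sub_cancel_right] at this
  have hz0conv : ConvexOn ℝ Set.univ z0 := by
    refine ⟨convex_univ, fun x _ y _ a b ha hb hab => ?_⟩
    simp only [hz0, smul_eq_mul]
    rw [← integral_const_mul, ← integral_const_mul,
      ← integral_add ((hInt x).const_mul a) ((hInt y).const_mul b)]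
    refine integral_mono (hInt _) (((hInt x).const_mul a).add ((hInt y).const_mul b)) fun t => ?_
    have h1 := hZc.2 (Set.mem_univ (x - t)) (Set.mem_univ (y - t)) ha hb hab
    have e : a • (x - t) + b • (y - t) = a • x + b • y - t := by
      have : b = 1 - a := by linarith
      subst this
      module
    rw [e] at h1
    simp only [smul_eq_mul] at h1
    have := mul_le_mul_of_nonneg_left h1 (hk0 t)
    simp only
    linarith
  have hzadd : ∀ x, fderiv ℝ (fun y => z0 y + ρ * P) x = fderiv ℝ z0 x := fun x =>
    fderiv_add_const _
  have hzh : ∀ x, hess (fun y => z0 y + ρ * P) x = hess z0 x := by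
    intro x
    unfold hess
    rw [funext hzadd]
  have hconstlow : ∀ (x : Euc d) (c : ℝ), (∀ t, k t ≠ 0 → c ≤ Z (x - t)) → c ≤ z0 x := by
    intro x c hc
    have e : c = ∫ t, k t * c := by rw [integral_mul_const, hk1, one_mul]
    rw [e]
    refine integral_mono (hkI.mul_const c) (hInt x) fun t => ?_
    by_cases ht : k t = 0
    · simp [ht]
    · exact mul_le_mul_of_nonneg_left (hc t ht) (hk0 t)
  have hconsthigh : ∀ (x : Euc d) (c : ℝ), (∀ t, k t ≠ 0 → Z (x - t) ≤ c) → z0 x ≤ c := by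
    intro x c hc
    have e : c = ∫ t, k t * c := by rw [integral_mul_const, hk1, one_mul]
    rw [e]
    refine integral_mono (hInt x) (hkI.mul_const c) fun t => ?_
    by_cases ht : k t = 0
    · simp [ht]
    · exact mul_le_mul_of_nonneg_left (hc t ht) (hk0 t)
  refine ⟨fun y => z0 y + ρ * P, hz0c.add contDiff_const, fun x u => ?_, fun x => ?_,
    fun x hx => ⟨?_, ?_⟩, fun x hx => ?_⟩
  · rw [hzh]; exact hess_nonneg_of_convexOn hz0c hz0conv x u
  · rw [hzadd]
    have hl : LipschitzWith P.toNNReal z0 := LipschitzWith.of_dist_le_mul fun u v => by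
      rw [Real.dist_eq, dist_eq_norm, Real.coe_toNNReal P hP.le]; exact hz0lip u v
    have := norm_fderiv_le_of_lipschitz ℝ hl (x₀ := x)
    rwa [Real.coe_toNNReal P hP.le] at this
  · have := hconstlow x (-(ρ * P)) fun t _ => hZl _
    linarith
  · have := hconsthigh x (ρ * P) fun t ht => by
      have h1 := (abs_le.1 (hZL (x - t) x)).2
      rw [sub_sub_cancel_left, norm_neg] at h1
      have h2 := hZ0 x hx
      have h3 : P * ‖t‖ ≤ P * ρ := by
        gcongr
        exact (hksupp t ht).le.trans hrρ
      linarith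
    linarith
  · rw [hzh]
    have hmain := integral_second_diff_mul_ge (f := f) (x := x) (c := f x - ε / 2) hkcont hks hk0
      hk1 hh hP.le (fun t ht => by
        have h1 := norm_sub_latRound hh (x - t)
        have h2 := hksupp t ht
        have h3 : dist (latRound h (x - t)) x < κ := by
          rw [dist_eq_norm]
          have e : latRound h (x - t) - x = -(x - t - latRound h (x - t)) - t := by abel
          rw [e]
          refine (norm_sub_le _ _).trans_lt ?_
          rw [norm_neg]
          linarith
        have h4 := hκu h3
        rw [Real.dist_eq] at h4
        linarith [(abs_lt.1 h4).1]) hZL hZd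
    have hZb : ∀ u : Euc d, ‖u‖ ≤ 4 * ρ → |Z u| ≤ 4 * ρ * P := by
      intro u hu
      rw [abs_le]
      constructor
      · have := hZl u
        have : 0 < ρ * P := by positivity
        linarith
      · have h1 := (abs_le.1 (hZL u 0)).2
        have h2 := hZ0 0 (by simp; positivity)
        rw [sub_zero] at h1
        have : P * ‖u‖ ≤ P * (4 * ρ) := by gcongr
        linarith
    have herr : ∀ i : Fin d, |(∫ t, hess k t (stdVec i) (stdVec i) * Z (x - t)) -
        ∫ t, (k (t + h • stdVec i) + k (t - h • stdVec i) - 2 * k t) / h ^ 2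
          * Z (latRound h (x - t))| ≤ (η * (4 * ρ * P) + (C + 1) * (P * (d * h))) * V := by
      intro i
      have hψc : Continuous fun t : Euc d =>
          (k (t + h • stdVec i) + k (t - h • stdVec i) - 2 * k t) / h ^ 2 := by
        fun_prop
      have hψs : ∀ t : Euc d, 2 * r < ‖t‖ →
          (k (t + h • stdVec i) + k (t - h • stdVec i) - 2 * k t) / h ^ 2 = 0 := by
        intro t ht
        have hhr : h ≤ r := by
          have : (1 : ℝ) ≤ d := by exact_mod_cast hd
          nlinarith
        have hn : ‖(h • stdVec i : Euc d)‖ = h := by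
          rw [norm_smul, norm_stdVec, mul_one, Real.norm_of_nonneg hh.le]
        have h1 : k (t + h • stdVec i) = 0 := by
          by_contra h0
          have := hksupp _ h0
          have h2 := norm_sub_le (t + h • stdVec i) (h • stdVec i)
          rw [add_sub_cancel_right] at h2
          linarith
        have h2 : k (t - h • stdVec i) = 0 := by
          by_contra h0
          have := hksupp _ h0
          have h2 := norm_add_le (t - h • stdVec i) (h • stdVec i)
          rw [sub_add_cancel] at h2
          linarith
        have h3 : k t = 0 := by
          by_contra h0
          have := hksupp _ h0
          linarith
        simp [h1, h2, h3]
      have hψcs : HasCompactSupport fun t : Euc d =>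
          (k (t + h • stdVec i) + k (t - h • stdVec i) - 2 * k t) / h ^ 2 := by
        refine HasCompactSupport.intro (isCompact_closedBall (0 : Euc d) (2 * r)) fun t ht => ?_
        rw [mem_closedBall_zero_iff, not_le] at ht
        exact hψs t ht
      have hHc : Continuous fun t : Euc d => hess k t (stdVec i) (stdVec i) :=
        ((continuous_hess hkc).clm_apply continuous_const).clm_apply continuous_const
      have hHs : HasCompactSupport fun t : Euc d => hess k t (stdVec i) (stdVec i) := by
        refine HasCompactSupport.intro (isCompact_closedBall (0 : Euc d) r) fun t ht => ?_
        rw [mem_closedBall_zero_iff, not_le] at ht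
        exact hsuppH t _ ht
      have hI1 : Integrable fun t => hess k t (stdVec i) (stdVec i) * Z (x - t) :=
        (hHc.mul (by fun_prop)).integrable_of_hasCompactSupport hHs.mul_right
      have hI2 : Integrable fun t => (k (t + h • stdVec i) + k (t - h • stdVec i) - 2 * k t) / h ^ 2
          * Z (latRound h (x - t)) := by
        refine integrable_mul_of_abs_le hψc hψcs
          (hZcont.measurable.comp ((latRound_measurable h).comp (by fun_prop)))
          (G := fun t => |Z (x - t)| + P * (d * h)) (by fun_prop) fun t => ?_
        have h1 := hZL (latRound h (x - t)) (x - t)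
        have h2 := norm_sub_latRound hh (x - t)
        rw [norm_sub_rev] at h2
        have h3 := mul_le_mul_of_nonneg_left h2 hP.le
        have h4 := abs_sub_abs_le_abs_sub (Z (latRound h (x - t))) (Z (x - t))
        linarith
      rw [← integral_sub hI1 hI2, ← Real.norm_eq_abs]
      rw [← setIntegral_eq_integral_of_forall_compl_eq_zero (s := closedBall (0 : Euc d) (2 * r))]
      · refine norm_setIntegral_le_of_norm_le_const measure_closedBall_lt_top fun t ht => ?_
        rw [mem_closedBall_zero_iff] at ht
        have hψ := happ h hh hlt1 t (stdVec i) (norm_stdVec i)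
        set ψ := (k (t + h • stdVec i) + k (t - h • stdVec i) - 2 * k t) / h ^ 2 with hψd
        have hZ1 : |Z (x - t)| ≤ 4 * ρ * P := hZb _ (by
          have := norm_sub_le x t
          linarith)
        have hZ2 : |Z (x - t) - Z (latRound h (x - t))| ≤ P * (d * h) :=
          (hZL _ _).trans (mul_le_mul_of_nonneg_left (norm_sub_latRound hh _) hP.le)
        have hHb : |hess k t (stdVec i) (stdVec i)| ≤ C := by
          have := (hess k t).le_opNorm₂ (stdVec i) (stdVec i)
          rw [norm_stdVec, mul_one, mul_one] at this
          exact this.trans (hC t)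
        have hψb : |ψ| ≤ C + 1 := by
          have h1 : η ≤ 1 := min_le_left _ _
          have h2 := abs_sub_abs_le_abs_sub ψ (hess k t (stdVec i) (stdVec i))
          linarith
        rw [abs_sub_comm] at hψ
        have e : hess k t (stdVec i) (stdVec i) * Z (x - t) - ψ * Z (latRound h (x - t))
            = (hess k t (stdVec i) (stdVec i) - ψ) * Z (x - t)
              + ψ * (Z (x - t) - Z (latRound h (x - t))) := by ring
        rw [e, Real.norm_eq_abs]
        refine (abs_add_le _ _).trans ?_
        rw [abs_mul, abs_mul]
        exact add_le_add (mul_le_mul hψ hZ1 (abs_nonneg _) hη0.le)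
          (mul_le_mul hψb hZ2 (abs_nonneg _) (by positivity))
      · intro t ht
        rw [mem_closedBall_zero_iff, not_le] at ht
        rw [hψs t ht, hsuppH t _ (by linarith)]
        simp
    have hη1 : d * (V + 1) * (η * (4 * ρ * P)) ≤ ε / 4 := by
      have : η ≤ ε / (4 * (d * (V + 1) * (4 * ρ * P))) := min_le_right _ _
      rw [le_div_iff₀ (by positivity)] at this
      linarith
    have hsum : ∑ i : Fin d, ((∫ t, (k (t + h • stdVec i) + k (t - h • stdVec i) - 2 * k t) / h ^ 2
          * Z (latRound h (x - t))) - (η * (4 * ρ * P) + (C + 1) * (P * (d * h))) * V) ≤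
        ∑ i, hess z0 x (stdVec i) (stdVec i) := by
      refine Finset.sum_le_sum fun i _ => ?_
      rw [hess_mollify hkc hks hZcont]
      have := (abs_le.1 (herr i)).1
      linarith
    rw [Finset.sum_sub_distrib, Finset.sum_const, Finset.card_univ, Fintype.card_fin,
      nsmul_eq_mul] at hsum
    have h6 : 0 ≤ d * (η * (4 * ρ * P) + (C + 1) * (P * (d * h))) := by positivity
    linarith

lemma hess_comp_sub {d : ℕ} (z : Euc d → ℝ) (y x : Euc d) :
    hess (fun x => z (x - y)) x = hess z (x - y) := by
  unfold hess
  have : fderiv ℝ (fun x => z (x - y)) = fun x => fderiv ℝ z (x - y) :=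
    funext fun x => fderiv_comp_sub y
  rw [this]
  exact fderiv_comp_sub (f := fderiv ℝ z) y

lemma exists_cutoff (d : ℕ) : ∃ C : ℝ, 0 ≤ C ∧ ∀ (y : Euc d) (r : ℝ), 0 < r →
    ∃ ζ : Euc d → ℝ, ContDiff ℝ 2 ζ ∧ (∀ x, 0 ≤ ζ x) ∧ (∀ x, ζ x ≤ 1) ∧
      (∀ x, ‖x - y‖ ≤ r → ζ x = 1) ∧ (∀ x, ζ x ≠ 0 → ‖x - y‖ < 3 / 2 * r) ∧
      (∀ x, ‖fderiv ℝ ζ x‖ ≤ C / r) ∧ ∀ x, ‖hess ζ x‖ ≤ C / r ^ 2 := by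
  let φ : ContDiffBump (0 : Euc d) := ⟨1, 3 / 2, by norm_num, by norm_num⟩
  have hφ : ContDiff ℝ 2 φ := φ.contDiff
  obtain ⟨C1, hC1, hb1⟩ := exists_hess_bound hφ φ.hasCompactSupport
  obtain ⟨C2, hb2⟩ : ∃ C2 : ℝ, ∀ x, ‖fderiv ℝ φ x‖ ≤ C2 := by
    have hc : Continuous (fderiv ℝ φ) := (contDiff_fderiv hφ).continuous
    exact (φ.hasCompactSupport.fderiv (𝕜 := ℝ)).exists_bound_of_continuous hc
  have hC2 : 0 ≤ C2 := (norm_nonneg _).trans (hb2 0)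
  refine ⟨C1 + C2, by positivity, fun y r hr => ?_⟩
  have hA : ∀ x, HasFDerivAt (fun x : Euc d => r⁻¹ • (x - y))
      (r⁻¹ • ContinuousLinearMap.id ℝ (Euc d)) x := fun x =>
    ((hasFDerivAt_id x).sub_const y).const_smul r⁻¹
  have hnorm : ∀ x : Euc d, ‖r⁻¹ • (x - y)‖ = ‖x - y‖ / r := by
    intro x
    rw [norm_smul, norm_inv, Real.norm_of_nonneg hr.le]; field_simp
  have h1 : ∀ x, fderiv ℝ (fun x => φ (r⁻¹ • (x - y))) x = r⁻¹ • fderiv ℝ φ (r⁻¹ • (x - y)) := by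
    intro x
    have := ((hφ.differentiable two_ne_zero _).hasFDerivAt.comp x (hA x)).fderiv
    rw [show (fun x => φ (r⁻¹ • (x - y))) = φ ∘ fun x => r⁻¹ • (x - y) from rfl, this]
    ext v
    simp
  have h2 : ∀ x, hess (fun x => φ (r⁻¹ • (x - y))) x
      = r⁻¹ • r⁻¹ • hess φ (r⁻¹ • (x - y)) := by
    intro x
    unfold hess
    rw [funext h1]
    have hd : DifferentiableAt ℝ (fderiv ℝ φ) (r⁻¹ • (x - y)) :=
      (contDiff_fderiv hφ).differentiable one_ne_zero _
    have := ((hd.hasFDerivAt.comp x (hA x)).const_smul r⁻¹).fderiv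
    refine Eq.trans this ?_
    ext v w
    simp
  refine ⟨fun x => φ (r⁻¹ • (x - y)), by fun_prop, fun x => φ.nonneg, fun x => φ.le_one,
    fun x hx => ?_, fun x hx => ?_, fun x => ?_, fun x => ?_⟩
  · apply φ.one_of_mem_closedBall
    rw [mem_closedBall_zero_iff, hnorm, div_le_iff₀ hr]
    simpa [φ] using hx
  · have : r⁻¹ • (x - y) ∈ Function.support φ := hx
    rw [φ.support_eq, mem_ball_zero_iff, hnorm, div_lt_iff₀ hr] at this
    exact this
  · rw [h1, norm_smul, norm_inv, Real.norm_of_nonneg hr.le, inv_mul_eq_div]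
    gcongr
    linarith [hb2 (r⁻¹ • (x - y))]
  · rw [h2]
    refine ContinuousLinearMap.opNorm_le_bound₂ _ (by positivity) fun u v => ?_
    simp only [_root_.smul_apply, smul_eq_mul]
    rw [norm_mul, norm_mul, norm_inv, Real.norm_of_nonneg hr.le]
    have h3 := (hess φ (r⁻¹ • (x - y))).le_opNorm₂ u v
    have h4 := hb1 (r⁻¹ • (x - y))
    calc r⁻¹ * (r⁻¹ * ‖hess φ (r⁻¹ • (x - y)) u v‖)
        ≤ r⁻¹ * (r⁻¹ * ((C1 + C2) * ‖u‖ * ‖v‖)) := by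
          gcongr
          refine h3.trans ?_
          gcongr
          linarith
      _ = (C1 + C2) / r ^ 2 * ‖u‖ * ‖v‖ := by field_simp

/-- `G` is a nonnegative finite measure with `L* G ≤ 0` in the ball `B_R`. -/
def IsAdjSuper (d : ℕ) (a : Euc d → Matrix (Fin d) (Fin d) ℝ) (b : Euc d → Euc d) (R : ℝ)
    (G : Measure (Euc d)) : Prop :=
  ∀ w : Euc d → ℝ, ContDiff ℝ 2 w → (∀ x, 0 ≤ w x) → (∀ x ∉ ball (0 : Euc d) R, w x = 0) →
    ∫ x, Lop d a b w x ∂G ≤ 0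

lemma Lop_cutoff_mul_ge {d : ℕ} {δ : ℝ} (hδ : 0 < δ) {a : Euc d → Matrix (Fin d) (Fin d) ℝ}
    {b : Euc d → Euc d} {x : Euc d} (hax : a x ∈ Sdelta d δ) {ζ z : Euc d → ℝ}
    (hζ : ContDiff ℝ 2 ζ) (hz : ContDiff ℝ 2 z) {C P r m : ℝ} (hC : 0 ≤ C) (hP : 0 ≤ P)
    (hr : 0 < r)
    (hζ0 : 0 ≤ ζ x) (hζ1 : ζ x ≤ 1) (hDζ : ‖fderiv ℝ ζ x‖ ≤ C / r) (hHζ : ‖hess ζ x‖ ≤ C / r ^ 2)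
    (hz0 : 0 ≤ z x) (hz1 : z x ≤ 2 * r * P) (hDz : ‖fderiv ℝ z x‖ ≤ P)
    (hHz : ∀ u, 0 ≤ hess z x u u) (hm : m ≤ ∑ i, hess z x (stdVec i) (stdVec i)) :
    ζ x * (δ * m) - δ⁻¹ * d ^ 2 * (4 * C) * P / r - (1 + 2 * C) * P * ‖b x‖ ≤
      Lop d a b (fun y => ζ y * z y) x := by
  set B : Euc d →L[ℝ] Euc d →L[ℝ] ℝ := hess (fun y => ζ y * z y) x + (-ζ x) • hess z x with hB
  have e1 : contr (a x) (hess (fun y => ζ y * z y) x)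
      = ζ x * contr (a x) (hess z x) + contr (a x) B := by
    rw [hB, contr_add, contr_smul]; ring
  have hBn : ‖B‖ ≤ 4 * C * P / r := by
    refine ContinuousLinearMap.opNorm_le_bound₂ _ (by positivity) fun u v => ?_
    have e : B u v = z x * hess ζ x u v + fderiv ℝ ζ x u * fderiv ℝ z x v
        + fderiv ℝ ζ x v * fderiv ℝ z x u := by
      have := hess_mul hζ hz x u v
      simp only [hB, _root_.add_apply, _root_.smul_apply, smul_eq_mul]
      rw [this]; ring
    rw [e, Real.norm_eq_abs]
    have t1 : |z x * hess ζ x u v| ≤ 2 * r * P * (C / r ^ 2 * ‖u‖ * ‖v‖) := by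
      rw [abs_mul, abs_of_nonneg hz0]
      refine mul_le_mul hz1 ?_ (abs_nonneg _) (by positivity)
      refine ((hess ζ x).le_opNorm₂ u v).trans ?_
      gcongr
    have t2 : ∀ u v, |fderiv ℝ ζ x u * fderiv ℝ z x v| ≤ C / r * ‖u‖ * (P * ‖v‖) := by
      intro u v
      rw [abs_mul]
      refine mul_le_mul (((fderiv ℝ ζ x).le_opNorm u).trans ?_)
        (((fderiv ℝ z x).le_opNorm v).trans ?_) (abs_nonneg _) (by positivity)
      · gcongr
      · gcongr
    have t3 := abs_add_three (z x * hess ζ x u v) (fderiv ℝ ζ x u * fderiv ℝ z x v)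
      (fderiv ℝ ζ x v * fderiv ℝ z x u)
    have e2 : 2 * r * P * (C / r ^ 2 * ‖u‖ * ‖v‖) + C / r * ‖u‖ * (P * ‖v‖)
        + C / r * ‖v‖ * (P * ‖u‖) = 4 * C * P / r * ‖u‖ * ‖v‖ := by
      field_simp; ring
    linarith [t2 u v, t2 v u]
  have h1 : |contr (a x) B| ≤ δ⁻¹ * d ^ 2 * (4 * C * P / r) :=
    (Sdelta_abs_contr_le hδ hax B).trans (by gcongr)
  have h2 : δ * m ≤ contr (a x) (hess z x) :=
    (mul_le_mul_of_nonneg_left hm hδ.le).trans (Sdelta_contr_ge hax hHz)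
  have h3 : fderiv ℝ (fun y => ζ y * z y) x = ζ x • fderiv ℝ z x + z x • fderiv ℝ ζ x :=
    fderiv_mul (hζ.differentiable two_ne_zero x) (hz.differentiable two_ne_zero x)
  have h4 : |fderiv ℝ (fun y => ζ y * z y) x (b x)| ≤ (1 + 2 * C) * P * ‖b x‖ := by
    rw [h3]
    simp only [_root_.add_apply, _root_.smul_apply, smul_eq_mul]
    refine (abs_add_le _ _).trans ?_
    rw [abs_mul, abs_mul, abs_of_nonneg hζ0, abs_of_nonneg hz0]
    have s1 : |fderiv ℝ z x (b x)| ≤ P * ‖b x‖ :=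
      ((fderiv ℝ z x).le_opNorm _).trans (by gcongr)
    have s2 : |fderiv ℝ ζ x (b x)| ≤ C / r * ‖b x‖ :=
      ((fderiv ℝ ζ x).le_opNorm _).trans (by gcongr)
    have s3 := mul_le_mul hζ1 s1 (abs_nonneg _) zero_le_one
    have s4 := mul_le_mul hz1 s2 (abs_nonneg _) (by positivity)
    have e : 2 * r * P * (C / r * ‖b x‖) = 2 * C * P * ‖b x‖ := by field_simp
    linarith
  rw [Lop_eq, e1]
  have h5 := mul_le_mul_of_nonneg_left h2 hζ0
  have e : δ⁻¹ * d ^ 2 * (4 * C * P / r) = δ⁻¹ * d ^ 2 * (4 * C) * P / r := by ring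
  linarith [(abs_le.1 h1).1, (abs_le.1 h4).1]

lemma Lop_eq_zero_of_eventually {d : ℕ} (a : Euc d → Matrix (Fin d) (Fin d) ℝ) (b : Euc d → Euc d)
    {w : Euc d → ℝ} {x : Euc d} (h : w =ᶠ[nhds x] 0) : Lop d a b w x = 0 := by
  have h1 : fderiv ℝ w =ᶠ[nhds x] fderiv ℝ (0 : Euc d → ℝ) := h.fderiv
  have h2 : hess w x = 0 := by
    unfold hess
    rw [h1.fderiv_eq]
    have : fderiv ℝ (0 : Euc d → ℝ) = 0 := by
      funext y; exact fderiv_const_apply 0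
    rw [this]
    exact fderiv_const_apply 0
  have h3 : fderiv ℝ w x = 0 := by
    rw [h.fderiv_eq]; exact fderiv_const_apply 0
  rw [Lop_eq, h2, h3]
  simp [contr]

lemma exists_local_estimate_continuous (d : ℕ) (hd : 0 < d) {δ : ℝ} (hδ : 0 < δ) :
    ∃ K : ℝ, 0 < K ∧ ∀ (a : Euc d → Matrix (Fin d) (Fin d) ℝ) (b : Euc d → Euc d),
      Continuous a → Continuous b → (∀ x, a x ∈ Sdelta d δ) →
      ∀ (R : ℝ) (G : Measure (Euc d)), IsFiniteMeasure G → IsAdjSuper d a b R G →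
      ∀ (y : Euc d) (r : ℝ), 0 < r → ball y (2 * r) ⊆ ball 0 R →
      ∀ f : Euc d → ℝ, Continuous f → (∀ x, 0 ≤ f x) → (∀ x, r < ‖x - y‖ → f x = 0) →
      ∀ P : ℝ, 0 < P → ∫ x, f x ^ d < (volume (ball (0 : Euc d) (P / 3))).toReal →
      ∫ x, f x ∂G ≤ K * P * (r⁻¹ * G.real (closedBall y (3 / 2 * r))
        + ∫ x in closedBall y (3 / 2 * r), ‖b x‖ ∂G) := by
  obtain ⟨C, hC, hcut⟩ := exists_cutoff d
  set K := δ⁻¹ * d ^ 2 * (4 * C) + (1 + 2 * C) with hK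
  have hK1 : δ⁻¹ * d ^ 2 * (4 * C) ≤ K := by rw [hK]; linarith
  have hK2 : 1 + 2 * C ≤ K := by
    have : 0 ≤ δ⁻¹ * d ^ 2 * (4 * C) := by positivity
    linarith
  have hK0 : 0 < K := by linarith
  refine ⟨δ⁻¹ * K, by positivity, ?_⟩
  intro a b ha hb hax R G hGf hG y r hr hball f hf hf0 hfs P hP hfP
  obtain ⟨ζ, hζ, hζ0, hζ1, hζone, hζs, hDζ, hHζ⟩ := hcut y r hr
  set M := r⁻¹ * G.real (closedBall y (3 / 2 * r)) + ∫ x in closedBall y (3 / 2 * r), ‖b x‖ ∂G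
    with hM
  refine le_of_forall_pos_le_add fun ε' hε' => ?_
  set ε := ε' / (G.real Set.univ + 1) with hε
  have hu0 : 0 ≤ G.real Set.univ := measureReal_nonneg
  have hε0 : 0 < ε := by positivity
  obtain ⟨z0, hz0, hz0h, hz0d, hz0b, hz0l⟩ := exists_convex_potential hd
    (f := fun x => f (x + y)) (by fun_prop) (fun x => hf0 _) hr
    (fun x hx => hfs _ (by simpa using hx)) hP (by
      rwa [integral_add_right_eq_self (fun x => f x ^ d) y]) hε0
  set z : Euc d → ℝ := fun x => z0 (x - y) with hz
  have hzc : ContDiff ℝ 2 z := hz0.comp (contDiff_id.sub contDiff_const)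
  set w : Euc d → ℝ := fun x => ζ x * z x with hw
  have hwc : ContDiff ℝ 2 w := hζ.mul hzc
  have hw0 : ∀ x, 3 / 2 * r ≤ ‖x - y‖ → w x = 0 := by
    intro x hx
    have : ζ x = 0 := by
      by_contra h0
      exact absurd (hζs x h0) (not_lt.2 hx)
    simp [hw, this]
  have hneg := hG w hwc (fun x => by
      by_cases hx : ζ x = 0
      · simp [hw, hx]
      · have := hζs x hx
        exact mul_nonneg (hζ0 x) (hz0b _ (by linarith)).1) (fun x hx => by
      apply hw0
      by_contra h0
      exact hx (hball (by rw [mem_ball, dist_eq_norm]; linarith)))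
  have hLc := continuous_Lop ha hb hwc
  have hLs : ∀ x, 3 / 2 * r < ‖x - y‖ → Lop d a b w x = 0 := by
    intro x hx
    apply Lop_eq_zero_of_eventually
    have : {x : Euc d | 3 / 2 * r < ‖x - y‖} ∈ nhds x :=
      (isOpen_lt continuous_const (by fun_prop)).mem_nhds hx
    filter_upwards [this] with x' hx'
    exact hw0 x' (le_of_lt hx')
  have hB : IsCompact (closedBall y (3 / 2 * r)) := isCompact_closedBall _ _
  have hpt : ∀ x, δ * f x - δ * ε - (closedBall y (3 / 2 * r)).indicator
      (fun x => K * P * (r⁻¹ + ‖b x‖)) x ≤ Lop d a b w x := by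
    intro x
    by_cases hx : x ∈ closedBall y (3 / 2 * r)
    · rw [Set.indicator_of_mem hx]
      rw [mem_closedBall, dist_eq_norm] at hx
      have hx2 : ‖x - y‖ ≤ 2 * r := by linarith
      have hfd : fderiv ℝ z x = fderiv ℝ z0 (x - y) := fderiv_comp_sub y
      have key := Lop_cutoff_mul_ge (a := a) (b := b) hδ (hax x) hζ hzc (P := P) (m := f x - ε)
        hC hP.le hr (hζ0 x) (hζ1 x) (hDζ x) (hHζ x) (hz0b _ hx2).1 (hz0b _ hx2).2
        (by rw [hfd]; exact hz0d _) (fun u => by rw [hess_comp_sub]; exact hz0h _ _)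
        (by
          rw [hess_comp_sub]
          have := hz0l _ hx2
          rwa [sub_add_cancel] at this)
      have h1 : δ * f x - δ * ε ≤ ζ x * (δ * (f x - ε)) := by
        by_cases hfx : f x = 0
        · rw [hfx]
          have := mul_le_mul_of_nonneg_right (hζ1 x) (mul_pos hδ hε0).le
          linarith
        · have : ‖x - y‖ ≤ r := by
            by_contra h0
            exact hfx (hfs x (not_le.1 h0))
          rw [hζone x this]; linarith
      have h2 : δ⁻¹ * d ^ 2 * (4 * C) * P / r ≤ K * P * r⁻¹ := by
        rw [div_eq_mul_inv]; gcongr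
      have h3 : (1 + 2 * C) * P * ‖b x‖ ≤ K * P * ‖b x‖ := by gcongr
      linarith
    · rw [Set.indicator_of_notMem hx]
      rw [mem_closedBall, dist_eq_norm, not_le] at hx
      rw [hLs x hx, hfs x (by linarith)]
      have := mul_pos hδ hε0
      linarith
  have hfi : Integrable f G := by
    refine hf.integrable_of_hasCompactSupport ?_
    refine HasCompactSupport.intro (isCompact_closedBall y r) fun x hx => hfs x ?_
    rwa [mem_closedBall, dist_eq_norm, not_le] at hx
  have hLi : Integrable (Lop d a b w) G := by
    refine hLc.integrable_of_hasCompactSupport ?_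
    refine HasCompactSupport.intro hB fun x hx => hLs x ?_
    rwa [mem_closedBall, dist_eq_norm, not_le] at hx
  have hbi : IntegrableOn (fun x => ‖b x‖) (closedBall y (3 / 2 * r)) G :=
    hb.norm.continuousOn.integrableOn_compact hB
  have hci : IntegrableOn (fun _ => r⁻¹) (closedBall y (3 / 2 * r)) G :=
    integrableOn_const (measure_ne_top _ _)
  have hIi : Integrable ((closedBall y (3 / 2 * r)).indicator
      (fun x => K * P * (r⁻¹ + ‖b x‖))) G := by
    rw [integrable_indicator_iff hB.measurableSet]
    exact (hci.add hbi).const_mul _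
  have hd1 : Integrable (fun x => δ * f x - δ * ε) G :=
    (hfi.const_mul δ).sub (integrable_const (δ * ε))
  have hle : ∫ x, (δ * f x - δ * ε - (closedBall y (3 / 2 * r)).indicator
      (fun x => K * P * (r⁻¹ + ‖b x‖)) x) ∂G ≤ ∫ x, Lop d a b w x ∂G :=
    integral_mono (hd1.sub hIi) hLi hpt
  have e1 : ∫ x, (δ * f x - δ * ε - (closedBall y (3 / 2 * r)).indicator
      (fun x => K * P * (r⁻¹ + ‖b x‖)) x) ∂G = δ * (∫ x, f x ∂G) - δ * ε * G.real Set.univ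
        - K * P * M := by
    have s1 : ∫ x, (δ * f x - δ * ε - (closedBall y (3 / 2 * r)).indicator
      (fun x => K * P * (r⁻¹ + ‖b x‖)) x) ∂G = (∫ x, (δ * f x - δ * ε) ∂G)
        - ∫ x, (closedBall y (3 / 2 * r)).indicator
      (fun x => K * P * (r⁻¹ + ‖b x‖)) x ∂G := integral_sub hd1 hIi
    have s2 : ∫ x, (δ * f x - δ * ε) ∂G = (∫ x, δ * f x ∂G) - ∫ _, δ * ε ∂G :=
      integral_sub (hfi.const_mul δ) (integrable_const (μ := G) (δ * ε))
    refine s1.trans ?_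
    refine congrArg₂ _ (s2.trans ?_) ?_
    · rw [integral_const_mul, integral_const, smul_eq_mul]; ring
    · rw [integral_indicator hB.measurableSet, integral_const_mul, integral_add hci hbi,
        setIntegral_const, smul_eq_mul, hM]
      ring
  rw [e1] at hle
  have h7 : ε * G.real Set.univ ≤ ε' := by
    rw [hε, div_mul_eq_mul_div, div_le_iff₀ (by positivity)]
    nlinarith
  have h8 : δ * (∫ x, f x ∂G) ≤ δ * ε * G.real Set.univ + K * P * M := by linarith
  have h9 : ∫ x, f x ∂G ≤ δ⁻¹ * (δ * ε * G.real Set.univ + K * P * M) := by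
    rw [inv_mul_eq_div, le_div_iff₀ hδ]; linarith
  have e2 : δ⁻¹ * (δ * ε * G.real Set.univ + K * P * M)
      = ε * G.real Set.univ + δ⁻¹ * K * P * M := by field_simp
  linarith

/-- A lower semicontinuous function is an increasing limit of Lipschitz functions. -/
lemma LowerSemicontinuous.exists_continuous_iSup {E : Type*} [PseudoMetricSpace E] {g : E → ℝ≥0∞}
    (hg : LowerSemicontinuous g) :
    ∃ u : ℕ → E → NNReal, (∀ n, Continuous (u n)) ∧ Monotone u ∧
      ∀ x, ⨆ n, (u n x : ℝ≥0∞) = g x := by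
  set v : ℕ → E → ℝ≥0∞ := fun n x => ⨅ y, min (g y) n + n * edist x y with hv
  have hvle : ∀ n x, v n x ≤ min (g x) n := fun n x =>
    (iInf_le _ x).trans (by simp)
  have hvtop : ∀ n x, v n x ≠ ∞ := fun n x =>
    ne_top_of_le_ne_top (natCast_ne_top n) ((hvle n x).trans (min_le_right _ _))
  have hlip : ∀ n x x', v n x ≤ v n x' + n * edist x x' := by
    intro n x x'
    rw [hv]
    simp only
    rw [ENNReal.iInf_add]
    refine le_iInf fun y => (iInf_le _ y).trans ?_
    rw [add_assoc, ← mul_add]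
    gcongr
    rw [add_comm]
    exact edist_triangle _ _ _
  have hcont : ∀ n, Continuous (v n) := by
    intro n
    refine _root_.continuous_of_le_add_edist n (natCast_ne_top n) (hlip n)
  have hmono : Monotone v := by
    intro n m hnm x
    refine le_iInf fun y => (iInf_le _ y).trans ?_
    gcongr
  refine ⟨fun n x => (v n x).toNNReal, fun n => ?_, ?_, fun x => ?_⟩
  · exact ENNReal.continuousOn_toNNReal.comp_continuous (hcont n) (hvtop n)
  · intro n m hnm x
    exact ENNReal.toNNReal_mono (hvtop m x) (hmono hnm x)
  · simp only [ENNReal.coe_toNNReal (hvtop _ x)]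
    refine le_antisymm (iSup_le fun n => (hvle n x).trans (min_le_left _ _)) ?_
    refine le_of_forall_lt fun c hc => ?_
    obtain ⟨c', hcc', hc'⟩ := exists_between hc
    obtain ⟨ε, hε, hball⟩ := EMetric.mem_nhds_iff.1 (hg x c' hc')
    have hc't : c' ≠ ∞ := ne_top_of_lt hc'
    obtain ⟨n, hn⟩ := ENNReal.exists_nat_mul_gt hε.ne' hc't
    obtain ⟨m, hm⟩ := ENNReal.exists_nat_gt hc't
    refine hcc'.trans_le (le_trans ?_ (le_iSup _ (max n m)))
    refine le_iInf fun y => ?_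
    by_cases hy : edist x y < ε
    · refine le_trans (le_min ?_ ?_) le_self_add
      · exact (hball (by rwa [Metric.mem_eball, edist_comm])).le
      · exact hm.le.trans (by exact_mod_cast le_max_right n m)
    · refine le_trans ?_ le_add_self
      refine hn.le.trans ?_
      gcongr
      · exact le_max_left n m
      · exact not_lt.1 hy

/-- The local estimate for solutions of `L* G ≤ 0`, for arbitrary measurable functions. -/
lemma exists_local_estimate_lintegral (d : ℕ) (hd : 0 < d) {δ : ℝ} (hδ : 0 < δ) :
    ∃ C : ℝ≥0∞, C ≠ ∞ ∧ ∀ (a : Euc d → Matrix (Fin d) (Fin d) ℝ) (b : Euc d → Euc d),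
      Continuous a → Continuous b → (∀ x, a x ∈ Sdelta d δ) →
      ∀ (R : ℝ) (G : Measure (Euc d)), IsFiniteMeasure G → IsAdjSuper d a b R G →
      ∀ (y : Euc d) (r : ℝ), 0 < r → ball y (2 * r) ⊆ ball 0 R →
      ∀ f : Euc d → ℝ≥0∞, Measurable f → ∫⁻ x in ball y r, f x ∂G ≤
        C * (∫⁻ x in ball y r, f x ^ (d : ℝ)) ^ (1 / d : ℝ) *
          (ENNReal.ofReal r⁻¹ * G (ball y (2 * r)) +
            ∫⁻ x in closedBall y (3 / 2 * r), ‖b x‖ₑ ∂G) := by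
  obtain ⟨K, hK, hest⟩ := exists_local_estimate_continuous d hd hδ
  have hd0 : (0 : ℝ) < d := by exact_mod_cast hd
  have hd0' : (d : ℝ) ≠ 0 := hd0.ne'
  set ω : ℝ := (volume (ball (0 : Euc d) 1)).toReal with hω
  have hω0 : 0 < ω := ENNReal.toReal_pos (measure_ball_pos _ _ one_pos).ne' measure_ball_lt_top.ne
  set C : ℝ := K * 3 * (ω⁻¹) ^ (1 / d : ℝ) with hC
  refine ⟨ENNReal.ofReal C, ofReal_ne_top, ?_⟩
  intro a b ha hb hax R G hGf hG y r hr hball f hf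
  set M := ENNReal.ofReal r⁻¹ * G (ball y (2 * r)) + ∫⁻ x in closedBall y (3 / 2 * r), ‖b x‖ₑ ∂G
    with hM
  have hsub : closedBall y (3 / 2 * r) ⊆ ball y (2 * r) := closedBall_subset_ball (by linarith)
  have hbi : IntegrableOn (fun x => ‖b x‖) (closedBall y (3 / 2 * r)) G :=
    hb.norm.continuousOn.integrableOn_compact (isCompact_closedBall _ _)
  have hbM : ∫⁻ x in closedBall y (3 / 2 * r), ‖b x‖ₑ ∂G
      = ENNReal.ofReal (∫ x in closedBall y (3 / 2 * r), ‖b x‖ ∂G) := by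
    rw [ofReal_integral_eq_lintegral_ofReal hbi (ae_of_all _ fun x => norm_nonneg _)]
    simp
  have hMt : M ≠ ∞ := by
    rw [hM, hbM]
    finiteness
  -- continuous functions
  have step1 : ∀ f : Euc d → NNReal, Continuous f → (∀ x ∉ ball y r, f x = 0) →
      ∫⁻ x, (f x : ℝ≥0∞) ^ (d : ℝ) ≠ ∞ → ∫⁻ x, f x ∂G ≤
        ENNReal.ofReal C * (∫⁻ x, (f x : ℝ≥0∞) ^ (d : ℝ)) ^ (1 / d : ℝ) * M := by
    intro f hfc hf0 hfi
    set S := ∫⁻ x, (f x : ℝ≥0∞) ^ (d : ℝ) with hS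
    have hsupp : ∀ x, r < ‖x - y‖ → f x = 0 := fun x hx => hf0 x fun h => by
      rw [mem_ball, dist_eq_norm] at h; linarith
    have hcs : HasCompactSupport f :=
      HasCompactSupport.intro (isCompact_closedBall y r) fun x hx => hsupp x (by
        rwa [mem_closedBall, dist_eq_norm, not_le] at hx)
    have hfr : Continuous fun x => (f x : ℝ) := by fun_prop
    have hfG : Integrable (fun x => (f x : ℝ)) G :=
      hfr.integrable_of_hasCompactSupport (hcs.comp_left (g := fun t : NNReal => (t : ℝ)) rfl)
    have e1 : ∫⁻ x, f x ∂G = ENNReal.ofReal (∫ x, (f x : ℝ) ∂G) := by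
      rw [ofReal_integral_eq_lintegral_ofReal hfG (ae_of_all _ fun x => (f x).2)]
      simp
    have e2 : S = ENNReal.ofReal (∫ x, (f x : ℝ) ^ d) := by
      have : Integrable (fun x => (f x : ℝ) ^ d) :=
        (hfr.pow d).integrable_of_hasCompactSupport
          (hcs.comp_left (g := fun t : NNReal => (t : ℝ) ^ d) (by simp [hd.ne']))
      rw [ofReal_integral_eq_lintegral_ofReal this (ae_of_all _ fun x => by positivity), hS]
      refine lintegral_congr fun x => ?_
      rw [ENNReal.rpow_natCast, ← NNReal.coe_pow, ENNReal.ofReal_coe_nnreal, ENNReal.coe_pow]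
    set s : ℝ := ∫ x, (f x : ℝ) ^ d with hs
    have hs0 : 0 ≤ s := integral_nonneg fun x => by positivity
    set m : ℝ := r⁻¹ * G.real (closedBall y (3 / 2 * r))
        + ∫ x in closedBall y (3 / 2 * r), ‖b x‖ ∂G with hm
    have hm0 : 0 ≤ m := by
      have : 0 ≤ ∫ x in closedBall y (3 / 2 * r), ‖b x‖ ∂G := integral_nonneg fun x => norm_nonneg _
      positivity
    have hmM : ENNReal.ofReal m ≤ M := by
      rw [hm, hM, ENNReal.ofReal_add (by positivity) (integral_nonneg fun x => norm_nonneg _), hbM,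
        ENNReal.ofReal_mul (by positivity), Measure.real, ENNReal.ofReal_toReal (measure_ne_top _ _)]
      gcongr
    have key : ∀ η : ℝ, 0 < η → ∫ x, (f x : ℝ) ∂G ≤ C * (s + η) ^ (1 / d : ℝ) * m := by
      intro η hη
      set P : ℝ := 3 * ((s + η) * ω⁻¹) ^ (1 / d : ℝ) with hP
      have hP0 : 0 < P := by positivity
      have hv : (volume (ball (0 : Euc d) (P / 3))).toReal = s + η := by
        rw [Measure.addHaar_ball_of_pos _ _ (by positivity), ENNReal.toReal_mul, ← hω,
          ENNReal.toReal_ofReal (by positivity), finrank_euclideanSpace_fin, hP,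
          mul_div_cancel_left₀ _ (by norm_num : (3 : ℝ) ≠ 0), ← Real.rpow_natCast,
          ← Real.rpow_mul (by positivity), one_div, inv_mul_cancel₀ hd0', Real.rpow_one]
        field_simp
      have := hest a b ha hb hax R G hGf hG y r hr hball (fun x => (f x : ℝ)) hfr
        (fun x => (f x).2) (fun x hx => by simp [hsupp x hx]) P hP0 (by rw [hv]; linarith)
      refine this.trans (le_of_eq ?_)
      rw [← hm, hP, hC, Real.mul_rpow (by positivity) (by positivity)]
      ring
    have hle : ∫ x, (f x : ℝ) ∂G ≤ C * s ^ (1 / d : ℝ) * m := by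
      have hc : Continuous fun η : ℝ => C * (s + η) ^ (1 / d : ℝ) * m := by
        have : Continuous fun t : ℝ => t ^ (1 / d : ℝ) :=
          Real.continuous_rpow_const (by positivity)
        fun_prop
      have ht := (hc.tendsto 0).mono_left (nhdsWithin_le_nhds (s := Set.Ioi 0))
      simp only [add_zero] at ht
      exact ge_of_tendsto ht (eventually_nhdsWithin_of_forall fun η hη => key η hη)
    rw [e1, e2]
    refine (ENNReal.ofReal_le_ofReal hle).trans ?_
    rw [ENNReal.ofReal_mul (by positivity), ENNReal.ofReal_mul (by positivity),
      ENNReal.ofReal_rpow_of_nonneg hs0 (by positivity)]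
    gcongr
  -- lower semicontinuous functions
  have step2 : ∀ g : Euc d → ℝ≥0∞, LowerSemicontinuous g → ∫⁻ x in ball y r, g x ^ (d : ℝ) ≠ ∞ →
      ∫⁻ x in ball y r, g x ∂G ≤
        ENNReal.ofReal C * (∫⁻ x in ball y r, g x ^ (d : ℝ)) ^ (1 / d : ℝ) * M := by
    intro g hg hgi
    have hg' : LowerSemicontinuous ((ball y r).indicator g) := by
      intro x c hc
      have hx : x ∈ ball y r := by
        by_contra h
        rw [Set.indicator_of_notMem h] at hc
        exact absurd hc ENNReal.not_lt_zero
      rw [Set.indicator_of_mem hx] at hc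
      filter_upwards [hg x c hc, isOpen_ball.mem_nhds hx] with x' h1 h2
      rwa [Set.indicator_of_mem h2]
    obtain ⟨u, huc, hum, hus⟩ := hg'.exists_continuous_iSup
    have hle : ∀ n x, (u n x : ℝ≥0∞) ≤ (ball y r).indicator g x := fun n x => by
      rw [← hus x]; exact le_iSup (fun n => (u n x : ℝ≥0∞)) n
    rw [← lintegral_indicator measurableSet_ball]
    simp only [← hus]
    rw [lintegral_iSup (fun n => by fun_prop) (fun n m hnm x => ENNReal.coe_le_coe.2 (hum hnm x))]
    refine iSup_le fun n => ?_
    have h3 : ∫⁻ x, (u n x : ℝ≥0∞) ^ (d : ℝ) ≤ ∫⁻ x in ball y r, g x ^ (d : ℝ) := by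
      rw [← lintegral_indicator measurableSet_ball]
      refine lintegral_mono fun x => ?_
      by_cases hx : x ∈ ball y r
      · have := hle n x
        rw [Set.indicator_of_mem hx] at this ⊢
        gcongr
      · have := hle n x
        rw [Set.indicator_of_notMem hx] at this ⊢
        simp only [nonpos_iff_eq_zero] at this ⊢
        rw [this, ENNReal.zero_rpow_of_pos hd0]
    refine (step1 (u n) (huc n) (fun x hx => ?_) (ne_top_of_le_ne_top hgi h3)).trans ?_
    · have := hle n x
      rw [Set.indicator_of_notMem hx] at this
      simpa using this
    · gcongr
  by_cases hM0 : M = 0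
  · have h0 : G (ball y r) = 0 := by
      have h1 : ENNReal.ofReal r⁻¹ * G (ball y (2 * r)) = 0 := by
        rw [hM] at hM0
        exact (add_eq_zero.1 hM0).1
      rcases mul_eq_zero.1 h1 with h | h
      · rw [ENNReal.ofReal_eq_zero] at h
        exact absurd (inv_pos.2 hr) (not_lt.2 h)
      · exact measure_mono_null (ball_subset_ball (by linarith)) h
    rw [Measure.restrict_eq_zero.2 h0]
    simp
  by_cases hft : ∫⁻ x in ball y r, f x ^ (d : ℝ) = ∞
  · have hC0 : ENNReal.ofReal C ≠ 0 := by
      rw [Ne, ENNReal.ofReal_eq_zero, not_le, hC]; positivity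
    rw [hft, ENNReal.top_rpow_of_pos (by positivity), ENNReal.mul_top hC0, ENNReal.top_mul hM0]
    exact le_top
  have hlim : ∀ ε : ℝ≥0∞, ε ≠ 0 → ε ≠ ∞ → ∫⁻ x in ball y r, f x ∂G ≤
      ENNReal.ofReal C * ((∫⁻ x in ball y r, f x ^ (d : ℝ)) + ε) ^ (1 / d : ℝ) * M := by
    intro ε hε hεt
    obtain ⟨F, hfF, hFl, hFi⟩ := exists_le_lowerSemicontinuous_lintegral_ge
      (volume.restrict (ball y r)) (fun x => f x ^ (d : ℝ)) (by fun_prop) hε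
    have hFd : ∀ x, (F x ^ (1 / d : ℝ)) ^ (d : ℝ) = F x := by
      intro x
      rw [← ENNReal.rpow_mul, one_div, inv_mul_cancel₀ hd0', ENNReal.rpow_one]
    have h2 := step2 (fun x => F x ^ (1 / d : ℝ))
      ((ENNReal.continuous_rpow_const).comp_lowerSemicontinuous hFl
        (ENNReal.monotone_rpow_of_nonneg (by positivity))) (by
        simp only [hFd]
        exact ne_top_of_le_ne_top (ENNReal.add_ne_top.2 ⟨hft, hεt⟩) hFi)
    simp only [hFd] at h2
    refine le_trans (lintegral_mono fun x => ?_) (h2.trans ?_)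
    · have := ENNReal.rpow_le_rpow (hfF x) (by positivity : (0 : ℝ) ≤ 1 / d)
      rwa [← ENNReal.rpow_mul, one_div, mul_inv_cancel₀ hd0', ENNReal.rpow_one, ← one_div] at this
    · gcongr
  have htend : Filter.Tendsto (fun ε : ℝ≥0∞ => ENNReal.ofReal C *
      ((∫⁻ x in ball y r, f x ^ (d : ℝ)) + ε) ^ (1 / d : ℝ) * M) (nhdsWithin 0 (Set.Ioi 0))
      (nhds (ENNReal.ofReal C * ((∫⁻ x in ball y r, f x ^ (d : ℝ)) + 0) ^ (1 / d : ℝ) * M)) := by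
    refine Filter.Tendsto.mono_left ?_ nhdsWithin_le_nhds
    refine ENNReal.Tendsto.mul_const ?_ (Or.inr hMt)
    refine ENNReal.Tendsto.const_mul ?_ (Or.inr ofReal_ne_top)
    exact (ENNReal.continuous_rpow_const.comp (continuous_const.add continuous_id)).tendsto 0
  rw [add_zero] at htend
  refine ge_of_tendsto htend ?_
  have : ∀ᶠ ε : ℝ≥0∞ in nhdsWithin 0 (Set.Ioi 0), ε < 1 :=
    nhdsWithin_le_nhds (gt_mem_nhds one_pos)
  filter_upwards [this, self_mem_nhdsWithin] with ε h1 h2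
  exact hlim ε (ne_of_gt h2) (ne_top_of_lt h1)

lemma ENNReal.le_of_le_add_half {A X Y : ℝ≥0∞} (hA : A ≠ ∞) (h : A ≤ X + 2⁻¹ * (A + Y)) :
    A ≤ 2 * X + Y := by
  have h2 : (2 : ℝ≥0∞) * 2⁻¹ = 1 := ENNReal.mul_inv_cancel two_ne_zero ofNat_ne_top
  have h1 : A + A ≤ A + (2 * X + Y) := by
    calc A + A = 2 * A := (two_mul A).symm
      _ ≤ 2 * (X + 2⁻¹ * (A + Y)) := by gcongr
      _ = A + (2 * X + Y) := by rw [mul_add, ← mul_assoc, h2, one_mul]; ring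
  exact (ENNReal.add_le_add_iff_left hA).1 h1

/-- Self-improvement of integrability from a reverse Hölder inequality on level sets. -/
lemma exists_lintegral_rpow_le_of_level_sets {α : Type*} [MeasurableSpace α] (μ : Measure α)
    {m c C : ℝ} (hm : 1 < m) (hc : 0 < c) (hc1 : c ≤ 1) (hC : 0 < C) :
    ∃ σ : ℝ, 0 < σ ∧ σ ≤ 1 ∧ ∃ C' : ℝ≥0∞, C' ≠ ∞ ∧ ∀ Φ : α → ℝ≥0∞, Measurable Φ →
      ∫⁻ x, Φ x ∂μ ≠ ∞ → ∀ t₀ : ℝ, 0 < t₀ →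
      (∀ t : ℝ, t₀ ≤ t → ∫⁻ x in {x | ENNReal.ofReal t < Φ x}, Φ x ^ m ∂μ ≤
        ENNReal.ofReal (C * t ^ (m - 1)) * ∫⁻ x in {x | ENNReal.ofReal (c * t) < Φ x}, Φ x ∂μ) →
      ∫⁻ x, Φ x ^ (m + σ) ∂μ ≤ C' * ENNReal.ofReal t₀ ^ (m + σ - 1) * ∫⁻ x, Φ x ∂μ := by
  set k : ℝ := C * (c ^ m)⁻¹ / (m - 1) with hk
  have hm1 : 0 < m - 1 := by linarith
  have hk0 : 0 < k := by positivity
  set σ : ℝ := min 1 (1 / (2 * k)) with hσ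
  have hσ0 : 0 < σ := by positivity
  have hσ1 : σ ≤ 1 := min_le_left _ _
  have hσk : σ * k ≤ 1 / 2 := by
    have : σ ≤ 1 / (2 * k) := min_le_right _ _
    calc σ * k ≤ 1 / (2 * k) * k := by gcongr
      _ = 1 / 2 := by field_simp
  refine ⟨σ, hσ0, hσ1, ENNReal.ofReal (2 * C + 2), ofReal_ne_top, ?_⟩
  intro Φ hΦ hJ t₀ ht₀ hlev
  set J := ∫⁻ x, Φ x ∂μ with hJdef
  set p := m + σ - 1 with hp
  have hp0 : 0 < p := by linarith
  set U : Set α := {x | ENNReal.ofReal t₀ < Φ x} with hU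
  have hUm : MeasurableSet U := measurableSet_lt measurable_const hΦ
  set H := ∫⁻ x in U, Φ x ^ m ∂μ with hH
  have hHJ : H ≤ ENNReal.ofReal (C * t₀ ^ (m - 1)) * J :=
    (hlev t₀ le_rfl).trans (by gcongr; exact setLIntegral_le_lintegral _ _)
  have hHt : H ≠ ∞ := ne_top_of_le_ne_top (ENNReal.mul_ne_top ofReal_ne_top hJ) hHJ
  set μm := (μ.restrict U).withDensity (fun x => Φ x ^ m) with hμm
  set μ1 := μ.withDensity Φ with hμ1
  -- the truncated integral
  have main : ∀ T : ℝ, 0 < T → ∫⁻ x in U, min (Φ x) (ENNReal.ofReal T) ^ σ * Φ x ^ m ∂μ ≤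
      ENNReal.ofReal (2 * C + 1) * ENNReal.ofReal t₀ ^ p * J := by
    intro T hT
    set A := ∫⁻ x in U, min (Φ x) (ENNReal.ofReal T) ^ σ * Φ x ^ m ∂μ with hA
    have hAt : A ≠ ∞ := by
      refine ne_top_of_le_ne_top (ENNReal.mul_ne_top (b := H)
        (ENNReal.rpow_ne_top_of_nonneg hσ0.le (ofReal_ne_top (r := T))) hHt) ?_
      rw [hA, hH, ← lintegral_const_mul _ (by fun_prop)]
      gcongr
      exact min_le_right _ _
    set F : α → ℝ := fun x => (min (Φ x) (ENNReal.ofReal T)).toReal with hF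
    set F' : α → ℝ := fun x => (min (ENNReal.ofReal c⁻¹ * Φ x) (ENNReal.ofReal T)).toReal with hF'
    have hFt : ∀ x, min (Φ x) (ENNReal.ofReal T) ≠ ∞ := fun x =>
      ne_top_of_le_ne_top ofReal_ne_top (min_le_right _ _)
    have hFt' : ∀ x, min (ENNReal.ofReal c⁻¹ * Φ x) (ENNReal.ofReal T) ≠ ∞ := fun x =>
      ne_top_of_le_ne_top ofReal_ne_top (min_le_right _ _)
    have hFm : Measurable F := by fun_prop
    have hFm' : Measurable F' := by fun_prop
    have hFs : ∀ (q : ℝ), 0 ≤ q → ∀ x,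
        ENNReal.ofReal (F x ^ q) = min (Φ x) (ENNReal.ofReal T) ^ q := by
      intro q hq x
      rw [hF, ← ENNReal.ofReal_rpow_of_nonneg toReal_nonneg hq, ENNReal.ofReal_toReal (hFt x)]
    have hFs' : ∀ (q : ℝ), 0 ≤ q → ∀ x, ENNReal.ofReal (F' x ^ q)
        = min (ENNReal.ofReal c⁻¹ * Φ x) (ENNReal.ofReal T) ^ q := by
      intro q hq x
      rw [hF', ← ENNReal.ofReal_rpow_of_nonneg toReal_nonneg hq, ENNReal.ofReal_toReal (hFt' x)]
    have lt_iff : ∀ (ψ : ℝ≥0∞) (t : ℝ), 0 ≤ t → (t < (min ψ (ENNReal.ofReal T)).toReal ↔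
        ENNReal.ofReal t < ψ ∧ t < T) := by
      intro ψ t ht
      have : min ψ (ENNReal.ofReal T) ≠ ∞ := ne_top_of_le_ne_top ofReal_ne_top (min_le_right _ _)
      rw [← ENNReal.ofReal_lt_iff_lt_toReal ht this, lt_min_iff, ENNReal.ofReal_lt_ofReal_iff hT]
    have eA : A = ∫⁻ x, ENNReal.ofReal (F x ^ σ) ∂μm := by
      rw [hμm, lintegral_withDensity_eq_lintegral_mul _ (by fun_prop) (by fun_prop), hA]
      refine lintegral_congr fun x => ?_
      rw [Pi.mul_apply, hFs σ hσ0.le, mul_comm]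
    have lc1 := lintegral_rpow_eq_lintegral_meas_lt_mul μm (ae_of_all _ fun x => toReal_nonneg)
      hFm.aemeasurable hσ0
    have lc2 := lintegral_rpow_eq_lintegral_meas_lt_mul μm (f := fun _ => t₀)
      (ae_of_all _ fun x => ht₀.le) measurable_const.aemeasurable hσ0
    have lc3 := lintegral_rpow_eq_lintegral_meas_lt_mul μ1 (ae_of_all _ fun x => toReal_nonneg)
      hFm'.aemeasurable hp0
    have hpt : ∀ t ∈ Set.Ioi (0 : ℝ), μm {x | t < F x} * ENNReal.ofReal (t ^ (σ - 1)) ≤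
        μm {x | t < t₀} * ENNReal.ofReal (t ^ (σ - 1)) +
          ENNReal.ofReal C * (μ1 {x | t < F' x} * ENNReal.ofReal (t ^ (p - 1))) := by
      intro t ht
      have ht : 0 < t := ht
      by_cases htt : t < t₀
      · refine le_trans ?_ le_self_add
        exact mul_le_mul_left (measure_mono fun x _ => htt) _
      refine le_trans ?_ le_add_self
      by_cases htT : t < T
      · have e1 : μm {x | t < F x} ≤ ∫⁻ x in {x | ENNReal.ofReal t < Φ x}, Φ x ^ m ∂μ := by
          have hms : MeasurableSet {x | t < F x} := measurableSet_lt measurable_const hFm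
          rw [hμm, withDensity_apply _ hms, Measure.restrict_restrict hms]
          refine lintegral_mono_set fun x hx => ?_
          exact ((lt_iff _ t ht.le).1 hx.1).1
        have e2 : μ1 {x | t < F' x} = ∫⁻ x in {x | ENNReal.ofReal (c * t) < Φ x}, Φ x ∂μ := by
          have hms : MeasurableSet {x | t < F' x} := measurableSet_lt measurable_const hFm'
          rw [hμ1, withDensity_apply _ hms]
          congr 2
          ext x
          simp only [Set.mem_ofPred_eq, hF']
          rw [lt_iff _ t ht.le, and_iff_left htT, ENNReal.ofReal_mul hc.le,
            ENNReal.ofReal_inv_of_pos hc, mul_comm (ENNReal.ofReal c)⁻¹, ← div_eq_mul_inv,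
            ENNReal.lt_div_iff_mul_lt (Or.inl (by simpa using hc)) (Or.inl ofReal_ne_top), mul_comm]
        have h3 := e1.trans (hlev t (not_lt.1 htt))
        rw [← e2] at h3
        refine (mul_le_mul_left h3 _).trans (le_of_eq ?_)
        have e3 : ENNReal.ofReal (t ^ (p - 1)) = ENNReal.ofReal (t ^ (m - 1)) *
            ENNReal.ofReal (t ^ (σ - 1)) := by
          rw [← ENNReal.ofReal_mul (by positivity), ← Real.rpow_add ht]
          congr 2; rw [hp]; ring
        rw [e3, ENNReal.ofReal_mul hC.le]; ring
      · have : {x | t < F x} = ∅ := by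
          ext x
          simp only [Set.mem_ofPred_eq, Set.mem_empty_iff_false, iff_false]
          exact fun h => htT ((lt_iff _ t ht.le).1 h).2
        rw [this]; simp
    have hmono : ∫⁻ t in Set.Ioi (0 : ℝ), μm {x | t < F x} * ENNReal.ofReal (t ^ (σ - 1)) ≤
        (∫⁻ t in Set.Ioi (0 : ℝ), μm {x | t < t₀} * ENNReal.ofReal (t ^ (σ - 1))) +
          ENNReal.ofReal C *
            ∫⁻ t in Set.Ioi (0 : ℝ), μ1 {x | t < F' x} * ENNReal.ofReal (t ^ (p - 1)) := by
      rw [← lintegral_const_mul' _ _ ofReal_ne_top, ← lintegral_add_left]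
      · exact setLIntegral_mono' measurableSet_Ioi hpt
      · refine Measurable.mul (Antitone.measurable ?_) (by fun_prop)
        intro t t' h
        exact measure_mono fun x hx => lt_of_le_of_lt h hx
    have hF'le : ∫⁻ x, ENNReal.ofReal (F' x ^ p) ∂μ1 ≤ ENNReal.ofReal (c ^ m)⁻¹ *
        (A + ENNReal.ofReal t₀ ^ p * J) := by
      rw [hμ1, lintegral_withDensity_eq_lintegral_mul _ hΦ (by fun_prop)]
      have e1 : ∀ x, (Φ * fun x => ENNReal.ofReal (F' x ^ p)) x ≤
          ENNReal.ofReal (c ^ m)⁻¹ * (Φ x * min (Φ x) (ENNReal.ofReal T) ^ p) := by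
        intro x
        rw [Pi.mul_apply, hFs' p hp0.le]
        have h1 : min (ENNReal.ofReal c⁻¹ * Φ x) (ENNReal.ofReal T) ≤
            ENNReal.ofReal c⁻¹ * min (Φ x) (ENNReal.ofReal T) := by
          have hci : (1 : ℝ≥0∞) ≤ ENNReal.ofReal c⁻¹ := by
            rw [ENNReal.one_le_ofReal]; exact (one_le_inv₀ hc).2 hc1
          rw [mul_min]
          refine min_le_min_left _ ?_
          exact le_mul_of_one_le_left zero_le hci
        have h2 : ENNReal.ofReal c⁻¹ ^ p ≤ ENNReal.ofReal (c ^ m)⁻¹ := by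
          rw [ENNReal.ofReal_rpow_of_pos (by positivity), ← Real.inv_rpow hc.le]
          refine ENNReal.ofReal_le_ofReal ?_
          exact Real.rpow_le_rpow_of_exponent_le ((one_le_inv₀ hc).2 hc1) (by linarith)
        calc Φ x * min (ENNReal.ofReal c⁻¹ * Φ x) (ENNReal.ofReal T) ^ p
            ≤ Φ x * (ENNReal.ofReal c⁻¹ * min (Φ x) (ENNReal.ofReal T)) ^ p := by gcongr
          _ = ENNReal.ofReal c⁻¹ ^ p * (Φ x * min (Φ x) (ENNReal.ofReal T) ^ p) := by
            rw [ENNReal.mul_rpow_of_nonneg _ _ hp0.le]; ring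
          _ ≤ _ := by gcongr
      refine (lintegral_mono e1).trans ?_
      rw [lintegral_const_mul _ (by fun_prop)]
      gcongr
      rw [← lintegral_add_compl _ hUm]
      refine add_le_add ?_ ?_
      · refine lintegral_mono fun x => ?_
        have e2 : p = σ + (m - 1) := by rw [hp]; ring
        have e3 : Φ x ^ m = Φ x ^ (m - 1) * Φ x := by
          have := ENNReal.rpow_add_of_nonneg (x := Φ x) _ _ hm1.le zero_le_one
          rwa [sub_add_cancel, ENNReal.rpow_one] at this
        rw [e2, ENNReal.rpow_add_of_nonneg _ _ hσ0.le hm1.le, e3]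
        calc Φ x * (min (Φ x) (ENNReal.ofReal T) ^ σ * min (Φ x) (ENNReal.ofReal T) ^ (m - 1))
            = min (Φ x) (ENNReal.ofReal T) ^ σ * (min (Φ x) (ENNReal.ofReal T) ^ (m - 1) * Φ x) := by
              ring
          _ ≤ _ := by gcongr; exact min_le_left _ _
      · rw [← lintegral_const_mul _ hΦ]
        refine le_trans (lintegral_mono_ae ?_) (setLIntegral_le_lintegral Uᶜ _)
        refine (ae_restrict_iff' hUm.compl).2 (ae_of_all _ fun x hx => ?_)
        have hx : Φ x ≤ ENNReal.ofReal t₀ := not_lt.1 hx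
        rw [mul_comm]
        gcongr
        exact (min_le_left _ _).trans hx
    have hAle : A ≤ ENNReal.ofReal t₀ ^ σ * H + 2⁻¹ * (A + ENNReal.ofReal t₀ ^ p * J) := by
      have h1 : A ≤ ENNReal.ofReal (t₀ ^ σ) * H + ENNReal.ofReal σ * (ENNReal.ofReal C *
          ∫⁻ t in Set.Ioi (0 : ℝ), μ1 {x | t < F' x} * ENNReal.ofReal (t ^ (p - 1))) := by
        have e1 : ∫⁻ _, ENNReal.ofReal (t₀ ^ σ) ∂μm = ENNReal.ofReal (t₀ ^ σ) * H := by
          rw [lintegral_const, hμm, withDensity_apply _ MeasurableSet.univ, Measure.restrict_univ]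
        rw [← e1, lc2, ← mul_add, eA]
        refine lc1.le.trans ?_
        gcongr
      have h2 : ENNReal.ofReal (m - 1) *
          ∫⁻ t in Set.Ioi (0 : ℝ), μ1 {x | t < F' x} * ENNReal.ofReal (t ^ (p - 1)) ≤
          ENNReal.ofReal (c ^ m)⁻¹ * (A + ENNReal.ofReal t₀ ^ p * J) := by
        refine le_trans ?_ (lc3.symm.le.trans hF'le)
        gcongr
        linarith
      rw [mul_comm, ← ENNReal.le_div_iff_mul_le (Or.inl (by simpa using hm1))
        (Or.inl ofReal_ne_top)] at h2
      refine h1.trans ?_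
      rw [ENNReal.ofReal_rpow_of_pos ht₀]
      refine add_le_add le_rfl ?_
      calc _ ≤ ENNReal.ofReal σ * (ENNReal.ofReal C * (ENNReal.ofReal (c ^ m)⁻¹ *
            (A + ENNReal.ofReal t₀ ^ p * J) / ENNReal.ofReal (m - 1))) := by gcongr
        _ = ENNReal.ofReal (σ * k) * (A + ENNReal.ofReal t₀ ^ p * J) := by
          rw [hk, ENNReal.ofReal_mul hσ0.le, div_eq_mul_inv _ (m - 1),
            ENNReal.ofReal_mul (p := C * (c ^ m)⁻¹) (by positivity),
            ENNReal.ofReal_mul hC.le, ENNReal.ofReal_inv_of_pos hm1, div_eq_mul_inv]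
          ring
        _ ≤ _ := by
          gcongr
          rw [← one_div]
          refine (ENNReal.ofReal_le_ofReal hσk).trans (le_of_eq ?_)
          rw [ENNReal.ofReal_div_of_pos two_pos, ENNReal.ofReal_one, ENNReal.ofReal_ofNat]
    refine (ENNReal.le_of_le_add_half hAt hAle).trans ?_
    have e : ENNReal.ofReal (C * t₀ ^ (m - 1)) * ENNReal.ofReal t₀ ^ σ =
        ENNReal.ofReal C * ENNReal.ofReal t₀ ^ p := by
      rw [ENNReal.ofReal_mul hC.le, ← ENNReal.ofReal_rpow_of_pos ht₀, mul_assoc,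
        ← ENNReal.rpow_add _ _ (by simpa using ht₀) ofReal_ne_top]
      congr 2; rw [hp]; ring
    calc 2 * (ENNReal.ofReal t₀ ^ σ * H) + ENNReal.ofReal t₀ ^ p * J
        ≤ 2 * (ENNReal.ofReal t₀ ^ σ * (ENNReal.ofReal (C * t₀ ^ (m - 1)) * J))
          + ENNReal.ofReal t₀ ^ p * J := by gcongr
      _ = 2 * (ENNReal.ofReal (C * t₀ ^ (m - 1)) * ENNReal.ofReal t₀ ^ σ) * J
          + ENNReal.ofReal t₀ ^ p * J := by ring
      _ = _ := by
        rw [e, ENNReal.ofReal_add (by positivity) zero_le_one, ENNReal.ofReal_mul zero_le_two,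
          ENNReal.ofReal_one, ENNReal.ofReal_ofNat]
        ring
  have hUint : ∫⁻ x in U, Φ x ^ (m + σ) ∂μ ≤
      ENNReal.ofReal (2 * C + 1) * ENNReal.ofReal t₀ ^ p * J := by
    have hsup : ∀ x, Φ x ^ (m + σ) = ⨆ n : ℕ, min (Φ x) (ENNReal.ofReal (n + 1)) ^ σ * Φ x ^ m := by
      intro x
      have ht : Filter.Tendsto (fun n : ℕ => ENNReal.ofReal ((n : ℝ) + 1)) Filter.atTop (nhds ∞) :=
        ENNReal.tendsto_ofReal_atTop.comp
          (Filter.tendsto_atTop_add_const_right _ _ tendsto_natCast_atTop_atTop)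
      have h1 : Filter.Tendsto (fun n : ℕ => min (Φ x) (ENNReal.ofReal (n + 1)) ^ σ)
          Filter.atTop (nhds (min (Φ x) ∞ ^ σ)) :=
        (ENNReal.continuous_rpow_const.tendsto _).comp (tendsto_const_nhds.min ht)
      have hmon : Monotone fun n : ℕ => min (Φ x) (ENNReal.ofReal (n + 1)) ^ σ := by
        intro n n' h
        simp only
        gcongr
      have h2 := tendsto_nhds_unique h1 (tendsto_atTop_iSup hmon)
      rw [← ENNReal.iSup_mul, ← h2, min_eq_left le_top, add_comm,
        ENNReal.rpow_add_of_nonneg _ _ hσ0.le (by linarith)]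
    simp only [hsup]
    rw [lintegral_iSup (fun n => by fun_prop)]
    · exact iSup_le fun n => main _ (by positivity)
    · intro n n' h x
      simp only
      gcongr
  have hUc : ∫⁻ x in Uᶜ, Φ x ^ (m + σ) ∂μ ≤ ENNReal.ofReal t₀ ^ p * J := by
    rw [← lintegral_const_mul _ hΦ]
    refine le_trans (lintegral_mono_ae ?_) (setLIntegral_le_lintegral Uᶜ _)
    refine (ae_restrict_iff' hUm.compl).2 (ae_of_all _ fun x hx => ?_)
    have hx : Φ x ≤ ENNReal.ofReal t₀ := not_lt.1 hx
    have e : m + σ = p + 1 := by rw [hp]; ring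
    rw [e, ENNReal.rpow_add_of_nonneg _ _ hp0.le zero_le_one, ENNReal.rpow_one]
    gcongr
  rw [← lintegral_add_compl _ hUm]
  refine (add_le_add hUint hUc).trans (le_of_eq ?_)
  have e : ENNReal.ofReal (2 * C + 2) = ENNReal.ofReal (2 * C + 1) + 1 := by
    rw [← ENNReal.ofReal_one, ← ENNReal.ofReal_add (by positivity) zero_le_one]
    congr 1; ring
  rw [e]
  ring

lemma ENNReal.le_rpow_of_le_mul_rpow {X K : ℝ≥0∞} (hX : X ≠ ∞) {p q : ℝ} (hp : 0 < p) (hq : 0 < q)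
    (hpq : 1 / p + 1 / q = 1) (h : X ≤ K * X ^ (1 / q)) : X ≤ K ^ p := by
  by_cases hX0 : X = 0
  · rw [hX0]; exact zero_le
  have hq0 : X ^ (1 / q) ≠ 0 := (ENNReal.rpow_pos (pos_iff_ne_zero.2 hX0) hX).ne'
  have hqt : X ^ (1 / q) ≠ ∞ := ENNReal.rpow_ne_top_of_nonneg (by positivity) hX
  have e : X = X ^ (1 / p) * X ^ (1 / q) := by
    rw [← ENNReal.rpow_add _ _ hX0 hX, hpq, ENNReal.rpow_one]
  have h1 : X ^ (1 / p) * X ^ (1 / q) ≤ K * X ^ (1 / q) := by rwa [← e]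
  have h2 : X ^ (1 / p) ≤ K := (ENNReal.mul_le_mul_iff_left hq0 hqt).1 h1
  have := ENNReal.rpow_le_rpow h2 hp.le
  rwa [← ENNReal.rpow_mul, one_div, inv_mul_cancel₀ hp.ne', ENNReal.rpow_one] at this

/-- Dual form of the local estimate: existence of a density in `L^{d/(d-1)}` together with a
reverse Hölder inequality. -/
lemma exists_density_of_local_estimate {d : ℕ} (hd : 2 ≤ d) {A : ℝ≥0∞} {B₀ : Set (Euc d)}
    (hB₀ : IsOpen B₀) {G : Measure (Euc d)} [IsFiniteMeasure G]
    (H : ∀ (y : Euc d) (r : ℝ), 0 < r → ball y (2 * r) ⊆ B₀ → ∀ f : Euc d → ℝ≥0∞, Measurable f →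
      ∫⁻ x in ball y r, f x ∂G ≤ A * ENNReal.ofReal r⁻¹ *
        (∫⁻ x in ball y r, f x ^ (d : ℝ)) ^ (1 / d : ℝ) * G (ball y (2 * r))) :
    ∃ g : Euc d → ℝ≥0∞, Measurable g ∧ G.restrict B₀ = volume.withDensity g ∧
      ∀ (y : Euc d) (r : ℝ), 0 < r → ball y (2 * r) ⊆ B₀ →
        ∫⁻ x in ball y r, g x ^ ((d : ℝ) / (d - 1)) ≤
          (A * ENNReal.ofReal r⁻¹ * G (ball y (2 * r))) ^ ((d : ℝ) / (d - 1)) := by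
  have hd2 : (2 : ℝ) ≤ d := by exact_mod_cast hd
  have hd0 : (0 : ℝ) < d := by linarith
  have hd1 : (0 : ℝ) < d - 1 := by linarith
  set m : ℝ := (d : ℝ) / (d - 1) with hm
  have hm1 : m - 1 = 1 / (d - 1) := by rw [hm]; field_simp; ring
  have hm1' : 0 < m - 1 := by rw [hm1]; positivity
  have hmd : (m - 1) * d = m := by rw [hm1, hm]; ring
  have hconj : 1 / m + 1 / (d : ℝ) = 1 := by rw [hm]; field_simp; ring
  have hac : G.restrict B₀ ≪ volume := by
    refine Measure.AbsolutelyContinuous.mk fun s hs hs0 => ?_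
    rw [Measure.restrict_apply hs]
    refine measure_null_of_locally_null _ fun y hy => ?_
    obtain ⟨ε, hε, hball⟩ := Metric.isOpen_iff.1 hB₀ y hy.2
    refine ⟨s ∩ ball y (ε / 2), ?_, ?_⟩
    · refine Filter.mem_of_superset (inter_mem_nhdsWithin _ (ball_mem_nhds y (half_pos hε))) ?_
      exact Set.inter_subset_inter_left _ Set.inter_subset_left
    · have := H y (ε / 2) (half_pos hε) (by rwa [mul_div_cancel₀ _ (two_ne_zero' ℝ)])
        (s.indicator fun _ => 1) (measurable_const.indicator hs)
      have e0 : ∫⁻ x in ball y (ε / 2), (s.indicator (fun _ => (1 : ℝ≥0∞)) x) ^ (d : ℝ) = 0 := by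
        refine le_antisymm ((setLIntegral_le_lintegral _ _).trans (le_of_eq ?_)) zero_le
        rw [lintegral_eq_zero_iff ((measurable_const.indicator hs).pow_const _)]
        have : ∀ᵐ x : Euc d, x ∉ s := measure_eq_zero_iff_ae_notMem.1 hs0
        filter_upwards [this] with x hx
        rw [Set.indicator_of_notMem hx, ENNReal.zero_rpow_of_pos hd0]; rfl
      rw [e0, ENNReal.zero_rpow_of_pos (by positivity), lintegral_indicator_const hs,
        Measure.restrict_apply hs] at this
      simpa using this
  refine ⟨(G.restrict B₀).rnDeriv volume, Measure.measurable_rnDeriv _ _,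
    (Measure.withDensity_rnDeriv_eq _ _ hac).symm, ?_⟩
  set g := (G.restrict B₀).rnDeriv volume with hg
  have hgm : Measurable g := Measure.measurable_rnDeriv _ _
  have hGg : volume.withDensity g = G.restrict B₀ := Measure.withDensity_rnDeriv_eq _ _ hac
  intro y r hr hball
  have hsub : ball y r ⊆ B₀ := (ball_subset_ball (by linarith)).trans hball
  have hInt : ∀ f : Euc d → ℝ≥0∞, Measurable f →
      ∫⁻ x in ball y r, f x ∂G = ∫⁻ x in ball y r, g x * f x := by
    intro f hf
    have e1 : G.restrict (ball y r) = (G.restrict B₀).restrict (ball y r) := by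
      rw [Measure.restrict_restrict_of_subset hsub]
    rw [e1, ← hGg, restrict_withDensity measurableSet_ball,
      lintegral_withDensity_eq_lintegral_mul _ hgm hf]
    rfl
  set K := A * ENNReal.ofReal r⁻¹ * G (ball y (2 * r)) with hK
  have htr : ∀ T : ℝ, ∫⁻ x in ball y r, min (g x) (ENNReal.ofReal T) ^ m ≤ K ^ m := by
    intro T
    set X := ∫⁻ x in ball y r, min (g x) (ENNReal.ofReal T) ^ m with hX
    have hXt : X ≠ ∞ := by
      refine ne_top_of_le_ne_top (b := ENNReal.ofReal T ^ m * volume (ball y r))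
        (ENNReal.mul_ne_top (ENNReal.rpow_ne_top_of_nonneg (by linarith) ofReal_ne_top)
          measure_ball_lt_top.ne) ?_
      rw [← setLIntegral_const]
      refine lintegral_mono fun x => ?_
      exact ENNReal.rpow_le_rpow (min_le_right _ _) (by linarith)
    refine ENNReal.le_rpow_of_le_mul_rpow hXt (by linarith) hd0 hconj ?_
    have h1 := H y r hr hball (fun x => min (g x) (ENNReal.ofReal T) ^ (m - 1)) (by fun_prop)
    simp only [← ENNReal.rpow_mul, hmd] at h1
    rw [hInt _ (by fun_prop), ← hX] at h1
    refine le_trans ?_ (h1.trans (le_of_eq (by rw [hK]; ring)))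
    refine lintegral_mono fun x => ?_
    have h2 := ENNReal.rpow_add_of_nonneg (x := min (g x) (ENNReal.ofReal T)) _ _ zero_le_one
      hm1'.le
    rw [add_sub_cancel, ENNReal.rpow_one] at h2
    simp only [h2]
    gcongr
    exact min_le_left _ _
  have hsup : ∀ x, g x ^ m = ⨆ n : ℕ, min (g x) (ENNReal.ofReal n) ^ m := by
    intro x
    have ht : Filter.Tendsto (fun n : ℕ => ENNReal.ofReal (n : ℝ)) Filter.atTop (nhds ∞) :=
      ENNReal.tendsto_ofReal_atTop.comp tendsto_natCast_atTop_atTop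
    have h1 : Filter.Tendsto (fun n : ℕ => min (g x) (ENNReal.ofReal n) ^ m)
        Filter.atTop (nhds (min (g x) ∞ ^ m)) :=
      (ENNReal.continuous_rpow_const.tendsto _).comp (tendsto_const_nhds.min ht)
    have hmon : Monotone fun n : ℕ => min (g x) (ENNReal.ofReal n) ^ m := by
      intro n n' h
      simp only
      gcongr
    have h2 := tendsto_nhds_unique h1 (tendsto_atTop_iSup hmon)
    rw [← h2, min_eq_left le_top]
  simp only [hsup]
  rw [lintegral_iSup (fun n => by fun_prop)]
  · exact iSup_le fun n => htr n
  · intro n n' h x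
    simp only
    gcongr

lemma volume_closedBall_eq {d : ℕ} (hd : 0 < d) (x : Euc d) {r : ℝ} (hr : 0 ≤ r) :
    volume (closedBall x r) =
      ENNReal.ofReal ((volume (ball (0 : Euc d) 1)).toReal * r ^ d) := by
  have : Nonempty (Fin d) := ⟨⟨0, hd⟩⟩
  rw [Measure.addHaar_closedBall _ _ hr, finrank_euclideanSpace_fin,
    ENNReal.ofReal_mul toReal_nonneg, ENNReal.ofReal_toReal measure_ball_lt_top.ne, mul_comm]

/-- Calderón–Zygmund stopping radius. -/
lemma exists_stopping_radius {d : ℕ} (hd : 0 < d) {g : Euc d → ℝ≥0∞} {x : Euc d}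
    (hx : Filter.Tendsto (fun r => (∫⁻ y in closedBall x r, g y) / volume (closedBall x r))
      (nhdsWithin 0 (Set.Ioi 0)) (nhds (g x))) {D t : ℝ} (hD : 0 < D) (ht : 0 < t)
    (htx : ENNReal.ofReal t < ENNReal.ofReal D ^ d * g x)
    (hI : ∫⁻ y, g y ≤ ENNReal.ofReal ((volume (ball (0 : Euc d) 1)).toReal * t * (1 / 32) ^ d)) :
    ∃ r : ℝ, 0 < r ∧ r ≤ D / 64 ∧
      ENNReal.ofReal ((volume (ball (0 : Euc d) 1)).toReal * t * (r / D) ^ d) <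
        ∫⁻ y in closedBall x r, g y ∧
      ∫⁻ y in closedBall x (16 * r), g y ≤
        ENNReal.ofReal ((volume (ball (0 : Euc d) 1)).toReal * t * (16 * r / D) ^ d) := by
  set ω : ℝ := (volume (ball (0 : Euc d) 1)).toReal with hω
  have hω0 : 0 < ω := ENNReal.toReal_pos (measure_ball_pos _ _ one_pos).ne' measure_ball_lt_top.ne
  set Q : ℕ → Prop := fun k => ENNReal.ofReal (ω * t * ((1 / 2) ^ k) ^ d) <
    ∫⁻ y in closedBall x ((1 / 2) ^ k * D), g y with hQ
  have hex : ∃ k, Q k := by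
    have h1 : Filter.Tendsto (fun k : ℕ => (1 / 2 : ℝ) ^ k * D) Filter.atTop
        (nhdsWithin 0 (Set.Ioi 0)) := by
      refine tendsto_nhdsWithin_iff.2 ⟨?_, Filter.Eventually.of_forall fun k => ?_⟩
      · have := (tendsto_pow_atTop_nhds_zero_of_lt_one (r := (1 / 2 : ℝ)) (by norm_num)
          (by norm_num)).mul_const D
        rwa [zero_mul] at this
      · exact mul_pos (by positivity) hD
    have h2 : ENNReal.ofReal (t / D ^ d) < g x := by
      rw [ENNReal.ofReal_div_of_pos (by positivity), ENNReal.ofReal_pow hD.le]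
      exact ENNReal.div_lt_of_lt_mul' htx
    obtain ⟨k, hk⟩ := ((hx.comp h1).eventually (lt_mem_nhds h2)).exists
    refine ⟨k, ?_⟩
    simp only [Function.comp] at hk
    rw [volume_closedBall_eq hd x (by positivity), ← hω,
      ENNReal.lt_div_iff_mul_lt (Or.inl (by
        rw [Ne, ENNReal.ofReal_eq_zero, not_le]; positivity)) (Or.inl ofReal_ne_top),
      ← ENNReal.ofReal_mul (by positivity)] at hk
    have e : t / D ^ d * (ω * ((1 / 2) ^ k * D) ^ d) = ω * t * ((1 / 2) ^ k) ^ d := by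
      rw [mul_pow]
      field_simp
    rwa [e] at hk
  classical
  have hk0 : Q (Nat.find hex) := Nat.find_spec hex
  have hkm : ∀ j < Nat.find hex, ¬ Q j := fun j hj => Nat.find_min hex hj
  set k := Nat.find hex
  have hk6 : 6 ≤ k := by
    by_contra hlt
    have h5 : k ≤ 5 := by omega
    refine absurd hk0 (not_lt.2 ?_)
    refine (setLIntegral_le_lintegral _ _).trans (hI.trans (ENNReal.ofReal_le_ofReal ?_))
    gcongr
    calc (1 / 32 : ℝ) = (1 / 2) ^ 5 := by norm_num
      _ ≤ (1 / 2) ^ k := pow_le_pow_of_le_one (by norm_num) (by norm_num) h5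
  refine ⟨(1 / 2) ^ k * D, by positivity, ?_, ?_, ?_⟩
  · have : (1 / 2 : ℝ) ^ k ≤ (1 / 2) ^ 6 := pow_le_pow_of_le_one (by norm_num) (by norm_num) hk6
    calc (1 / 2 : ℝ) ^ k * D ≤ (1 / 2) ^ 6 * D := by gcongr
      _ = D / 64 := by ring
  · rw [mul_div_cancel_right₀ _ hD.ne']
    exact hk0
  · have h4 := hkm (k - 4) (by omega)
    have e : (1 / 2 : ℝ) ^ (k - 4) = 16 * (1 / 2) ^ k := by
      have : (1 / 2 : ℝ) ^ k = (1 / 2) ^ (k - 4) * (1 / 2) ^ 4 := by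
        rw [← pow_add]; congr 1; omega
      rw [this]; ring
    simp only [hQ, not_lt, e] at h4
    rw [← mul_assoc, mul_div_cancel_right₀ _ hD.ne']
    exact h4

/-- Comparison on a single stopping ball. -/
lemma lintegral_stopping_ball_le {d : ℕ} (hd : 2 ≤ d) {A : ℝ} (hA : 0 < A) {g : Euc d → ℝ≥0∞}
    (hg : Measurable g) {z : Euc d} {ρ : ℝ}
    (hRH : ∀ (y : Euc d) (r : ℝ), 0 < r → ball y (2 * r) ⊆ ball z (2 * ρ) →
      ∫⁻ x in ball y r, g x ^ ((d : ℝ) / (d - 1)) ≤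
        (ENNReal.ofReal A * ENNReal.ofReal r⁻¹ * ∫⁻ x in ball y (2 * r), g x) ^
          ((d : ℝ) / (d - 1))) {ω t r : ℝ} (hω : ω = (volume (ball (0 : Euc d) 1)).toReal)
    (ht : 0 < t) {y : Euc d} (hD : 0 < 2 * ρ - dist y z) (hr : 0 < r)
    (hrD : r ≤ (2 * ρ - dist y z) / 64)
    (h1 : ENNReal.ofReal (ω * t * (r / (2 * ρ - dist y z)) ^ d) < ∫⁻ x in closedBall y r, g x)
    (h2 : ∫⁻ x in closedBall y (16 * r), g x ≤
      ENNReal.ofReal (ω * t * (16 * r / (2 * ρ - dist y z)) ^ d)) :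
    ∫⁻ x in ball y (8 * r), (ENNReal.ofReal (2 * ρ - dist x z) ^ d * g x) ^ ((d : ℝ) / (d - 1)) ≤
      ENNReal.ofReal ((32 ^ d * A * ω / 8) ^ ((d : ℝ) / (d - 1)) * 2 ^ (d + 1) / ω *
        t ^ ((d : ℝ) / (d - 1) - 1)) *
      ∫⁻ x in closedBall y r ∩ {x | ENNReal.ofReal ((1 / 2) ^ (d + 1) * t) <
        ENNReal.ofReal (2 * ρ - dist x z) ^ d * g x},
          ENNReal.ofReal (2 * ρ - dist x z) ^ d * g x := by
  have hd2 : (2 : ℝ) ≤ d := by exact_mod_cast hd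
  have hd1 : (0 : ℝ) < d - 1 := by linarith
  set m : ℝ := (d : ℝ) / (d - 1) with hm
  have hm0 : 0 < m := by positivity
  set D := 2 * ρ - dist y z with hDdef
  have hω0 : 0 < ω := by
    rw [hω]
    exact ENNReal.toReal_pos (measure_ball_pos _ _ one_pos).ne' measure_ball_lt_top.ne
  set Φ : Euc d → ℝ≥0∞ := fun x => ENNReal.ofReal (2 * ρ - dist x z) ^ d * g x with hΦ
  have hΦm : Measurable Φ := by fun_prop
  set V := {x | ENNReal.ofReal ((1 / 2) ^ (d + 1) * t) < Φ x} with hV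
  have hVm : MeasurableSet V := measurableSet_lt measurable_const hΦm
  set W := ∫⁻ x in closedBall y r ∩ V, Φ x with hW
  -- upper bound
  have up : ∫⁻ x in ball y (8 * r), Φ x ^ m ≤
      ENNReal.ofReal ((32 ^ d * A * ω / 8) ^ m * t ^ m * r ^ d) := by
    have s1 : ∫⁻ x in ball y (8 * r), Φ x ^ m ≤
        ENNReal.ofReal ((2 * D) ^ d) ^ m * ∫⁻ x in ball y (8 * r), g x ^ m := by
      rw [← lintegral_const_mul _ (by fun_prop)]
      refine setLIntegral_mono' measurableSet_ball fun x hx => ?_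
      rw [← ENNReal.mul_rpow_of_nonneg _ _ hm0.le]
      refine ENNReal.rpow_le_rpow (mul_le_mul_left ?_ _) hm0.le
      rw [ENNReal.ofReal_pow (by positivity)]
      gcongr
      rw [mem_ball] at hx
      have := dist_triangle y x z
      rw [dist_comm y x] at this
      linarith
    have s2 := hRH y (8 * r) (by positivity) (by
      refine ball_subset_ball' ?_
      linarith)
    have s3 : ∫⁻ x in ball y (2 * (8 * r)), g x ≤ ENNReal.ofReal (ω * t * (16 * r / D) ^ d) := by
      refine le_trans (lintegral_mono_set ?_) h2
      rw [show 2 * (8 * r) = 16 * r by ring]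
      exact ball_subset_closedBall
    have e : (2 * D) ^ d * (A * (8 * r)⁻¹ * (ω * t * (16 * r / D) ^ d)) =
        (32 ^ d * A * ω / 8) * t * (r ^ d / r) := by
      rw [div_pow, mul_pow, mul_pow, show (32 : ℝ) = 2 * 16 by norm_num, mul_pow 2 16]
      field_simp
    have e2 : (r ^ d / r) ^ m = r ^ d := by
      have : r ^ d / r = r ^ ((d : ℝ) - 1) := by
        rw [Real.rpow_sub hr, Real.rpow_one, Real.rpow_natCast]
      rw [this, ← Real.rpow_mul hr.le, ← Real.rpow_natCast, hm]
      congr 1; field_simp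
    calc ∫⁻ x in ball y (8 * r), Φ x ^ m
        ≤ ENNReal.ofReal ((2 * D) ^ d) ^ m * (ENNReal.ofReal A * ENNReal.ofReal (8 * r)⁻¹ *
          ENNReal.ofReal (ω * t * (16 * r / D) ^ d)) ^ m := by
            refine s1.trans ?_
            refine mul_le_mul_right (s2.trans ?_) _
            gcongr
      _ = ENNReal.ofReal ((2 * D) ^ d * (A * (8 * r)⁻¹ * (ω * t * (16 * r / D) ^ d))) ^ m := by
            rw [← ENNReal.mul_rpow_of_nonneg _ _ hm0.le, ← ENNReal.ofReal_mul hA.le,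
              ← ENNReal.ofReal_mul (by positivity), ← ENNReal.ofReal_mul (by positivity)]
      _ = _ := by
            rw [e, ENNReal.ofReal_rpow_of_nonneg (by positivity) hm0.le,
              Real.mul_rpow (by positivity) (by positivity),
              Real.mul_rpow (by positivity) (by positivity), e2]
  -- lower bound
  have low : ENNReal.ofReal (1 / 2 * ω * t * (r / 2) ^ d) ≤ W := by
    have hΦg : ∀ x ∈ closedBall y r, g x ≤ ENNReal.ofReal ((2 / D) ^ d) * Φ x := by
      intro x hx
      rw [mem_closedBall] at hx
      have h3 : D / 2 ≤ 2 * ρ - dist x z := by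
        have := dist_triangle x y z
        linarith
      have h4 : (1 : ℝ≥0∞) ≤ ENNReal.ofReal ((2 / D) ^ d) *
          ENNReal.ofReal (2 * ρ - dist x z) ^ d := by
        rw [← ENNReal.ofReal_pow (by linarith), ← ENNReal.ofReal_mul (by positivity), ← mul_pow,
          ENNReal.one_le_ofReal]
        refine one_le_pow₀ ?_
        calc (1 : ℝ) = 2 / D * (D / 2) := by field_simp
          _ ≤ _ := by gcongr
      rw [hΦ]
      simp only
      rw [← mul_assoc]
      exact le_mul_of_one_le_left zero_le h4
    have s1 : ∫⁻ x in closedBall y r ∩ V, g x ≤ ENNReal.ofReal ((2 / D) ^ d) * W := by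
      rw [hW, ← lintegral_const_mul _ hΦm]
      exact setLIntegral_mono' (measurableSet_closedBall.inter hVm) fun x hx => hΦg x hx.1
    have s2 : ∫⁻ x in closedBall y r ∩ Vᶜ, g x ≤
        ENNReal.ofReal (1 / 2 * (ω * t * (r / D) ^ d)) := by
      calc ∫⁻ x in closedBall y r ∩ Vᶜ, g x
          ≤ ∫⁻ _ in closedBall y r ∩ Vᶜ, ENNReal.ofReal ((2 / D) ^ d) *
              ENNReal.ofReal ((1 / 2) ^ (d + 1) * t) := by
            refine setLIntegral_mono' (measurableSet_closedBall.inter hVm.compl) fun x hx => ?_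
            refine (hΦg x hx.1).trans ?_
            gcongr
            exact not_lt.1 hx.2
        _ ≤ ENNReal.ofReal ((2 / D) ^ d) * ENNReal.ofReal ((1 / 2) ^ (d + 1) * t) *
              volume (closedBall y r) := by
            rw [setLIntegral_const]
            gcongr
            exact Set.inter_subset_left
        _ = _ := by
            rw [volume_closedBall_eq (by omega) y hr.le, ← hω, ← ENNReal.ofReal_mul (by positivity),
              ← ENNReal.ofReal_mul (by positivity)]
            congr 1
            rw [div_pow, div_pow, div_pow, pow_succ, one_pow]
            field_simp
            ring
    have s3 := lintegral_inter_add_sdiff (μ := volume) g (closedBall y r) hVm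
    rw [← s3, Set.sdiff_eq] at h1
    have s4 := h1.le.trans (add_le_add s1 s2)
    have e : ω * t * (r / D) ^ d = 1 / 2 * (ω * t * (r / D) ^ d) + 1 / 2 * (ω * t * (r / D) ^ d) := by
      ring
    have e' : ENNReal.ofReal (ω * t * (r / D) ^ d) =
        ENNReal.ofReal (1 / 2 * (ω * t * (r / D) ^ d)) +
          ENNReal.ofReal (1 / 2 * (ω * t * (r / D) ^ d)) := by
      rw [← ENNReal.ofReal_add (by positivity) (by positivity), ← e]
    replace s4 := (ENNReal.add_le_add_iff_right ofReal_ne_top).1 (e'.symm.le.trans s4)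
    calc ENNReal.ofReal (1 / 2 * ω * t * (r / 2) ^ d)
        = ENNReal.ofReal ((D / 2) ^ d) * ENNReal.ofReal (1 / 2 * (ω * t * (r / D) ^ d)) := by
          rw [← ENNReal.ofReal_mul (by positivity)]
          congr 1
          rw [div_pow, div_pow, div_pow]
          field_simp
      _ ≤ ENNReal.ofReal ((D / 2) ^ d) * (ENNReal.ofReal ((2 / D) ^ d) * W) := by gcongr
      _ = W := by
          rw [← mul_assoc, ← ENNReal.ofReal_mul (by positivity), ← mul_pow,
            show D / 2 * (2 / D) = 1 by field_simp, one_pow, ENNReal.ofReal_one, one_mul]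
  refine up.trans ?_
  refine le_trans (le_of_eq ?_) (mul_le_mul_right low _)
  rw [← ENNReal.ofReal_mul (by positivity)]
  congr 1
  have e3 : t ^ m = t ^ (m - 1) * t := by
    rw [Real.rpow_sub_one ht.ne']; field_simp
  rw [e3, div_pow, pow_succ]
  field_simp

/-- Level set estimate obtained from a reverse Hölder inequality by Calderón–Zygmund stopping. -/
lemma lintegral_superlevel_le {d : ℕ} (hd : 2 ≤ d) {A : ℝ} (hA : 0 < A) {g : Euc d → ℝ≥0∞}
    (hg : Measurable g) {z : Euc d} {ρ : ℝ}
    (hRH : ∀ (y : Euc d) (r : ℝ), 0 < r → ball y (2 * r) ⊆ ball z (2 * ρ) →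
      ∫⁻ x in ball y r, g x ^ ((d : ℝ) / (d - 1)) ≤
        (ENNReal.ofReal A * ENNReal.ofReal r⁻¹ * ∫⁻ x in ball y (2 * r), g x) ^
          ((d : ℝ) / (d - 1))) {ω t : ℝ} (hω : ω = (volume (ball (0 : Euc d) 1)).toReal)
    (ht : 0 < t) (hI : ∫⁻ y, g y ≤ ENNReal.ofReal (ω * t * (1 / 32) ^ d)) :
    ∫⁻ x in {x | ENNReal.ofReal t < ENNReal.ofReal (2 * ρ - dist x z) ^ d * g x},
        (ENNReal.ofReal (2 * ρ - dist x z) ^ d * g x) ^ ((d : ℝ) / (d - 1)) ≤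
      ENNReal.ofReal ((32 ^ d * A * ω / 8) ^ ((d : ℝ) / (d - 1)) * 2 ^ (d + 1) / ω *
        t ^ ((d : ℝ) / (d - 1) - 1)) *
      ∫⁻ x in {x | ENNReal.ofReal ((1 / 2) ^ (d + 1) * t) <
        ENNReal.ofReal (2 * ρ - dist x z) ^ d * g x},
          ENNReal.ofReal (2 * ρ - dist x z) ^ d * g x := by
  set m : ℝ := (d : ℝ) / (d - 1) with hm
  set Φ : Euc d → ℝ≥0∞ := fun x => ENNReal.ofReal (2 * ρ - dist x z) ^ d * g x with hΦ
  have hΦm : Measurable Φ := by fun_prop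
  set V := {x | ENNReal.ofReal ((1 / 2) ^ (d + 1) * t) < Φ x} with hV
  have hVm : MeasurableSet V := measurableSet_lt measurable_const hΦm
  set K := ENNReal.ofReal ((32 ^ d * A * ω / 8) ^ m * 2 ^ (d + 1) / ω * t ^ (m - 1)) with hK
  have hae : ∀ᵐ x, Filter.Tendsto
      (fun r => (∫⁻ y in closedBall x r, g y) / volume (closedBall x r))
      (nhdsWithin 0 (Set.Ioi 0)) (nhds (g x)) := by
    filter_upwards [(Besicovitch.vitaliFamily (volume : Measure (Euc d))).ae_tendsto_lintegral_div
      hg.aemeasurable (hI.trans_lt ofReal_lt_top).ne] with x hx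
    exact hx.comp (Besicovitch.tendsto_filterAt volume x)
  set S : Set (Euc d) := {x | ENNReal.ofReal t < Φ x ∧ Filter.Tendsto
      (fun r => (∫⁻ y in closedBall x r, g y) / volume (closedBall x r))
      (nhdsWithin 0 (Set.Ioi 0)) (nhds (g x))} with hS
  have hSae : ({x | ENNReal.ofReal t < Φ x} : Set (Euc d)) ≤ᵐ[volume] S := by
    filter_upwards [hae] with x hx h
    exact ⟨h, hx⟩
  have hDpos : ∀ x ∈ S, 0 < 2 * ρ - dist x z := by
    intro x hx
    by_contra h
    have h1 := hx.1
    rw [hΦ] at h1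
    simp only at h1
    rw [ENNReal.ofReal_of_nonpos (not_lt.1 h), zero_pow (by omega), zero_mul] at h1
    exact ENNReal.not_lt_zero h1
  have hex : ∀ x ∈ S, ∃ r : ℝ, 0 < r ∧ r ≤ (2 * ρ - dist x z) / 64 ∧
      ENNReal.ofReal (ω * t * (r / (2 * ρ - dist x z)) ^ d) < ∫⁻ y in closedBall x r, g y ∧
      ∫⁻ y in closedBall x (16 * r), g y ≤
        ENNReal.ofReal (ω * t * (16 * r / (2 * ρ - dist x z)) ^ d) := by
    intro x hx
    have := exists_stopping_radius (by omega) hx.2 (hDpos x hx) ht hx.1 (by rw [← hω]; exact hI)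
    rwa [← hω] at this
  choose! r hr0 hrD hr1 hr2 using hex
  obtain ⟨u, huS, hdisj, hcov⟩ := Vitali.exists_disjoint_subfamily_covering_enlargement_closedBall S
    id r (2 * ρ / 64) (fun x hx => (hrD x hx).trans (by
      have := dist_nonneg (x := x) (y := z)
      gcongr; linarith)) 4 (by norm_num)
  have hcount : u.Countable := hdisj.countable_of_nonempty_interior fun x hx =>
    ⟨x, ball_subset_interior_closedBall (mem_ball_self (hr0 x (huS hx)))⟩
  have hSsub : S ⊆ ⋃ x ∈ u, ball x (8 * r x) := by
    intro x hx
    obtain ⟨b, hb, hsub⟩ := hcov x hx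
    have h1 : x ∈ closedBall b (4 * r b) := hsub (mem_closedBall_self (hr0 x hx).le)
    refine Set.mem_iUnion₂.2 ⟨b, hb, ?_⟩
    rw [mem_closedBall] at h1
    have := hr0 b (huS hb)
    rw [mem_ball]
    linarith
  have := hcount.to_subtype
  calc ∫⁻ x in {x | ENNReal.ofReal t < Φ x}, Φ x ^ m
      ≤ ∫⁻ x in S, Φ x ^ m := lintegral_mono' (Measure.restrict_mono_ae hSae) le_rfl
    _ ≤ ∫⁻ x in ⋃ i : u, ball (i : Euc d) (8 * r i), Φ x ^ m := by
        refine lintegral_mono_set ?_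
        rwa [Set.biUnion_eq_iUnion] at hSsub
    _ ≤ ∑' i : u, ∫⁻ x in ball (i : Euc d) (8 * r i), Φ x ^ m := lintegral_iUnion_le _ _
    _ ≤ ∑' i : u, K * ∫⁻ x in closedBall (i : Euc d) (r i) ∩ V, Φ x := by
        refine ENNReal.tsum_le_tsum fun i => ?_
        have hi := huS i.2
        exact lintegral_stopping_ball_le hd hA hg hRH hω ht (hDpos _ hi) (hr0 _ hi) (hrD _ hi)
          (hr1 _ hi) (hr2 _ hi)
    _ = K * ∫⁻ x in ⋃ i : u, closedBall (i : Euc d) (r i) ∩ V, Φ x := by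
        rw [ENNReal.tsum_mul_left, lintegral_iUnion
          (fun i => measurableSet_closedBall.inter hVm)]
        intro i j hij
        exact (hdisj i.2 j.2 (fun h => hij (Subtype.ext h))).mono Set.inter_subset_left
          Set.inter_subset_left
    _ ≤ K * ∫⁻ x in V, Φ x := by
        gcongr
        exact Set.iUnion_subset fun i => Set.inter_subset_right

/-- Gehring's lemma for the densities under consideration. -/
lemma exists_gehring {d : ℕ} (hd : 2 ≤ d) {A : ℝ} (hA : 0 < A) :
    ∃ s : ℝ, (d : ℝ) / (d - 1) < s ∧ ∃ C : ℝ≥0∞, C ≠ ∞ ∧ ∀ g : Euc d → ℝ≥0∞, Measurable g →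
      ∫⁻ x, g x ≠ ∞ → ∀ (z : Euc d) (ρ : ℝ), 0 < ρ →
      (∀ (y : Euc d) (r : ℝ), 0 < r → ball y (2 * r) ⊆ ball z (2 * ρ) →
        ∫⁻ x in ball y r, g x ^ ((d : ℝ) / (d - 1)) ≤
        (ENNReal.ofReal A * ENNReal.ofReal r⁻¹ * ∫⁻ x in ball y (2 * r), g x) ^
          ((d : ℝ) / (d - 1))) →
      ∫⁻ x in ball z ρ, g x ^ s ≤
        C * ENNReal.ofReal ((ρ ^ d) ^ (1 - s)) * (∫⁻ x, g x) ^ s := by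
  have hd2 : (2 : ℝ) ≤ d := by exact_mod_cast hd
  have hd1 : (0 : ℝ) < d - 1 := by linarith
  set m : ℝ := (d : ℝ) / (d - 1) with hm
  have hm1 : 1 < m := by rw [hm, one_lt_div hd1]; linarith
  obtain ⟨ω, hω⟩ : ∃ ω : ℝ, ω = (volume (ball (0 : Euc d) 1)).toReal := ⟨_, rfl⟩
  have hω0 : 0 < ω := by
    rw [hω]
    exact ENNReal.toReal_pos (measure_ball_pos _ _ one_pos).ne' measure_ball_lt_top.ne
  obtain ⟨σ, hσ0, -, C', hC', H⟩ := exists_lintegral_rpow_le_of_level_sets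
    (volume : Measure (Euc d)) (m := m) (c := (1 / 2) ^ (d + 1))
    (C := (32 ^ d * A * ω / 8) ^ m * 2 ^ (d + 1) / ω)
    hm1 (by positivity) (pow_le_one₀ (by norm_num) (by norm_num)) (by positivity)
  set s := m + σ with hs
  have hs0 : 0 < s := by linarith
  refine ⟨s, by linarith, C' * ENNReal.ofReal ((32 ^ d / ω) ^ (s - 1) * 2 ^ d),
    ENNReal.mul_ne_top hC' ofReal_ne_top, fun g hg hI z ρ hρ hRH => ?_⟩
  rcases eq_or_ne (∫⁻ x, g x) 0 with h0 | h0
  · have : g =ᵐ[volume] 0 := (lintegral_eq_zero_iff hg).1 h0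
    have h1 : ∫⁻ x in ball z ρ, g x ^ s = 0 := by
      rw [lintegral_eq_zero_iff (by fun_prop)]
      filter_upwards [ae_restrict_of_ae this] with x hx
      simp [hx, hs0]
    rw [h1]; exact zero_le
  set I := ∫⁻ x, g x with hIdef
  have hI0 : 0 < I.toReal := ENNReal.toReal_pos h0 hI
  set Φ : Euc d → ℝ≥0∞ := fun x => ENNReal.ofReal (2 * ρ - dist x z) ^ d * g x with hΦ
  have hΦm : Measurable Φ := by fun_prop
  have hΦI : ∫⁻ x, Φ x ≤ ENNReal.ofReal (2 ^ d * ρ ^ d) * I := by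
    rw [hIdef, ← lintegral_const_mul _ hg]
    refine lintegral_mono fun x => mul_le_mul_left ?_ _
    rw [← mul_pow, ENNReal.ofReal_pow (by positivity)]
    gcongr
    have := dist_nonneg (x := x) (y := z)
    linarith
  have h1 := H Φ hΦm (hΦI.trans_lt (ENNReal.mul_lt_top ofReal_lt_top hI.lt_top)).ne
    (32 ^ d * I.toReal / ω) (by positivity) (fun t ht => by
      refine lintegral_superlevel_le hd hA hg hRH hω (lt_of_lt_of_le (by positivity) ht) ?_
      refine (ENNReal.ofReal_toReal hI).symm.le.trans ?_
      refine ENNReal.ofReal_le_ofReal ?_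
      calc I.toReal = ω * (32 ^ d * I.toReal / ω) * (1 / 32) ^ d := by
            rw [div_pow, one_pow]; field_simp
        _ ≤ _ := by gcongr)
  have h2 : ENNReal.ofReal ((ρ ^ d) ^ s) * ∫⁻ x in ball z ρ, g x ^ s ≤ ∫⁻ x, Φ x ^ s := by
    rw [← lintegral_const_mul _ (by fun_prop)]
    refine (setLIntegral_mono' measurableSet_ball fun x hx => ?_).trans
      (setLIntegral_le_lintegral (ball z ρ) _)
    rw [← ENNReal.ofReal_rpow_of_nonneg (by positivity) hs0.le,
      ← ENNReal.mul_rpow_of_nonneg _ _ hs0.le]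
    refine ENNReal.rpow_le_rpow (mul_le_mul_left ?_ _) hs0.le
    rw [ENNReal.ofReal_pow hρ.le]
    gcongr
    rw [mem_ball] at hx
    linarith
  have hP : (0 : ℝ) < (ρ ^ d) ^ s := by positivity
  have h3 : ∫⁻ x in ball z ρ, g x ^ s ≤
      ENNReal.ofReal ((ρ ^ d) ^ s)⁻¹ * ∫⁻ x, Φ x ^ s := by
    calc ∫⁻ x in ball z ρ, g x ^ s
        = ENNReal.ofReal ((ρ ^ d) ^ s)⁻¹ *
          (ENNReal.ofReal ((ρ ^ d) ^ s) * ∫⁻ x in ball z ρ, g x ^ s) := by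
          rw [← mul_assoc, ← ENNReal.ofReal_mul (by positivity), inv_mul_cancel₀ hP.ne',
            ENNReal.ofReal_one, one_mul]
      _ ≤ _ := by gcongr
  have hIr : ENNReal.ofReal I.toReal = I := ENNReal.ofReal_toReal hI
  calc ∫⁻ x in ball z ρ, g x ^ s
      ≤ ENNReal.ofReal ((ρ ^ d) ^ s)⁻¹ *
        (C' * ENNReal.ofReal (32 ^ d * I.toReal / ω) ^ (s - 1) *
          (ENNReal.ofReal (2 ^ d * ρ ^ d) * I)) := by
        refine h3.trans ?_
        gcongr
        exact h1.trans (by gcongr)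
    _ = _ := by
        have e1 : I ^ s = ENNReal.ofReal (I.toReal ^ (s - 1)) * I := by
          rw [← ENNReal.ofReal_rpow_of_nonneg toReal_nonneg (by linarith), hIr]
          conv_lhs => rw [show s = (s - 1) + 1 by ring]
          rw [ENNReal.rpow_add _ _ h0 hI, ENNReal.rpow_one]
        rw [e1, ENNReal.ofReal_rpow_of_nonneg (by positivity) (by linarith)]
        rw [show ∀ a b c e f : ℝ≥0∞, a * (b * c * (e * f)) = b * (a * c * e) * f by
          intros; ring, show ∀ a b c e f : ℝ≥0∞, a * b * c * (e * f) = a * (b * c * e) * f by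
          intros; ring, ← ENNReal.ofReal_mul (by positivity), ← ENNReal.ofReal_mul (by positivity),
          ← ENNReal.ofReal_mul (by positivity), ← ENNReal.ofReal_mul (by positivity)]
        congr 3
        rw [show 32 ^ d * I.toReal / ω = (32 ^ d / ω) * I.toReal by ring,
          Real.mul_rpow (by positivity) hI0.le, Real.rpow_sub (by positivity), Real.rpow_one]
        field_simp
        rw [← Real.rpow_add (by positivity)]; simp

/-- The normalised `L^p` average of `f` over `S`. -/
noncomputable def lpAvg {d : ℕ} (p : ℝ) (S : Set (Euc d)) (f : Euc d → ℝ≥0∞) : ℝ≥0∞ :=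
  ((volume S)⁻¹ * ∫⁻ x in S, f x ^ p) ^ (1 / p)

lemma lpAvg_mono_exponent {d : ℕ} {p q : ℝ} (hp : 0 < p) (hpq : p ≤ q) {S : Set (Euc d)}
    (h0 : volume S ≠ 0) (h1 : volume S ≠ ∞) {f : Euc d → ℝ≥0∞} (hf : Measurable f) :
    lpAvg p S f ≤ lpAvg q S f := by
  have : IsProbabilityMeasure ((volume S)⁻¹ • volume.restrict S) := by
    constructor
    rw [Measure.smul_apply, Measure.restrict_apply_univ, smul_eq_mul, ENNReal.inv_mul_cancel h0 h1]
  have := eLpNorm'_le_eLpNorm'_of_exponent_le hp hpq ((volume S)⁻¹ • volume.restrict S)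
    hf.aestronglyMeasurable
  simpa only [eLpNorm', lintegral_smul_measure, enorm_eq_self, smul_eq_mul] using! this

lemma exists_improved_local_estimate {d : ℕ} (hd : 2 ≤ d) {A : ℝ} (hA : 0 < A) :
    ∃ d₀ : ℝ, (d : ℝ) / 2 < d₀ ∧ d₀ < d ∧ ∃ C : ℝ≥0∞, C ≠ ∞ ∧
      ∀ G : Measure (Euc d), IsFiniteMeasure G → ∀ (z : Euc d) (ρ : ℝ), 0 < ρ →
      (∀ (y : Euc d) (r : ℝ), 0 < r → ball y (2 * r) ⊆ ball z (2 * ρ) →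
        ∀ f : Euc d → ℝ≥0∞, Measurable f → ∫⁻ x in ball y r, f x ∂G ≤
        ENNReal.ofReal A * ENNReal.ofReal r⁻¹ * (∫⁻ x in ball y r, f x ^ (d : ℝ)) ^ (1 / d : ℝ) *
          G (ball y (2 * r))) →
      ∀ f : Euc d → ℝ≥0∞, Measurable f →
        ∫⁻ x in ball z ρ, f x ∂G ≤ C * lpAvg d₀ (ball z ρ) f * G (ball z (2 * ρ)) := by
  have hd2 : (2 : ℝ) ≤ d := by exact_mod_cast hd
  have hd1 : (0 : ℝ) < d - 1 := by linarith
  obtain ⟨s, hs, C', hC', H⟩ := exists_gehring hd hA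
  have hs1 : 1 < s := lt_of_le_of_lt ((one_le_div hd1).2 (by linarith)) hs
  have hs0 : 0 < s := by linarith
  set s' : ℝ := s / (s - 1) with hs'
  have hconj : s'.HolderConjugate s := (Real.HolderConjugate.conjExponent hs1).symm
  have hs'0 : 0 < s' := hconj.pos
  have hs'd : s' < d := by
    rw [hs', div_lt_iff₀ (by linarith)]
    rw [div_lt_iff₀ hd1] at hs
    linarith
  have hexp : (1 - s) * (1 / s) = -(1 / s') := by
    rw [hs']; field_simp; ring
  refine ⟨max s' (3 * d / 4), lt_of_lt_of_le (by linarith) (le_max_right _ _),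
    max_lt hs'd (by linarith), volume (ball (0 : Euc d) 1) ^ (1 / s') * C' ^ (1 / s),
    ENNReal.mul_ne_top (ENNReal.rpow_ne_top_of_nonneg (by positivity) measure_ball_lt_top.ne)
      (ENNReal.rpow_ne_top_of_nonneg (by positivity) hC'), fun G hG z ρ hρ hyp f hf => ?_⟩
  obtain ⟨g, hg, hGg, hgr⟩ := exists_density_of_local_estimate hd (B₀ := ball z (2 * ρ)) isOpen_ball hyp
  have hmass : ∀ S : Set (Euc d), MeasurableSet S → S ⊆ ball z (2 * ρ) → G S = ∫⁻ x in S, g x := by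
    intro S hS hsub
    rw [← withDensity_apply _ hS, ← hGg, Measure.restrict_apply hS,
      Set.inter_eq_self_of_subset_left hsub]
  have htot : ∫⁻ x, g x = G (ball z (2 * ρ)) := by
    rw [← Measure.restrict_apply_univ (s := ball z (2 * ρ)), hGg, withDensity_apply _ .univ,
      Measure.restrict_univ]
  have h1 := H g hg (htot ▸ measure_ne_top _ _) z ρ hρ (fun y r hr hsub => by
    rw [← hmass _ measurableSet_ball hsub]
    exact hgr y r hr hsub)
  have hsub : ball z ρ ⊆ ball z (2 * ρ) := ball_subset_ball (by linarith)
  have hvol : volume (ball z ρ) = ENNReal.ofReal (ρ ^ d) * volume (ball (0 : Euc d) 1) := by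
    rw [Measure.addHaar_ball_of_pos _ _ hρ, finrank_euclideanSpace_fin]
  have hvol0 : volume (ball (0 : Euc d) 1) ≠ 0 := (measure_ball_pos _ _ one_pos).ne'
  have hvol1 : volume (ball (0 : Euc d) 1) ≠ ∞ := measure_ball_lt_top.ne
  have hkey : ∫⁻ x in ball z ρ, f x ∂G ≤
      volume (ball (0 : Euc d) 1) ^ (1 / s') * C' ^ (1 / s) * lpAvg s' (ball z ρ) f *
        G (ball z (2 * ρ)) := by
    calc ∫⁻ x in ball z ρ, f x ∂G
        = ∫⁻ x in ball z ρ, f x * g x := by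
          rw [← Set.inter_eq_self_of_subset_left hsub, ← Measure.restrict_restrict
            measurableSet_ball, hGg, setLIntegral_withDensity_eq_setLIntegral_mul _ hg hf
            measurableSet_ball, Set.inter_eq_self_of_subset_left hsub]
          simp only [Pi.mul_apply, mul_comm]
      _ ≤ (∫⁻ x in ball z ρ, f x ^ s') ^ (1 / s') * (∫⁻ x in ball z ρ, g x ^ s) ^ (1 / s) :=
          ENNReal.lintegral_mul_le_Lp_mul_Lq _ hconj hf.aemeasurable hg.aemeasurable
      _ ≤ (∫⁻ x in ball z ρ, f x ^ s') ^ (1 / s') *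
          (C' * ENNReal.ofReal ((ρ ^ d) ^ (1 - s)) * (∫⁻ x, g x) ^ s) ^ (1 / s) := by gcongr
      _ = _ := by
          rw [htot, ENNReal.mul_rpow_of_nonneg _ _ (by positivity),
            ENNReal.mul_rpow_of_nonneg _ _ (by positivity), ← ENNReal.rpow_mul,
            mul_one_div_cancel hs0.ne', ENNReal.rpow_one, lpAvg, hvol,
            ENNReal.mul_rpow_of_nonneg _ _ (by positivity), ENNReal.mul_inv (Or.inr hvol1)
              (Or.inr hvol0), ENNReal.mul_rpow_of_nonneg _ _ (by positivity),
            ENNReal.ofReal_rpow_of_nonneg (by positivity) (by positivity),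
            ← Real.rpow_mul (by positivity), hexp, Real.rpow_neg (by positivity),
            ENNReal.ofReal_inv_of_pos (by positivity),
            ← ENNReal.ofReal_rpow_of_nonneg (by positivity) (by positivity),
            ENNReal.inv_rpow, ENNReal.inv_rpow]
          have hc : volume (ball (0 : Euc d) 1) ^ (1 / s') *
              (volume (ball (0 : Euc d) 1) ^ (1 / s'))⁻¹ = 1 :=
            ENNReal.mul_inv_cancel (by simp [hvol0, hvol1])
              (ENNReal.rpow_ne_top_of_nonneg (by positivity) hvol1)
          generalize volume (ball (0 : Euc d) 1) ^ (1 / s') = X at hc ⊢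
          generalize X⁻¹ = Y at hc ⊢
          generalize (ENNReal.ofReal (ρ ^ d) ^ (1 / s'))⁻¹ = W
          generalize (∫⁻ x in ball z ρ, f x ^ s') ^ (1 / s') = F
          rw [← one_mul (F * _), ← hc]
          ring
  refine hkey.trans ?_
  gcongr
  exact lpAvg_mono_exponent hs'0 (le_max_left _ _) (measure_ball_pos _ _ hρ).ne'
    measure_ball_lt_top.ne hf

lemma lintegral_ball_swap {d : ℕ} {G : Measure (Euc d)} [SFinite G] {r : Euc d → ℝ}
    (hr : Measurable r) {k φ : Euc d → ℝ≥0∞} (hk : Measurable k) (hφ : Measurable φ) :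
    ∫⁻ y, k y * ∫⁻ x in ball y (r y), φ x ∂G =
      ∫⁻ x, φ x * (∫⁻ y in {y | dist x y < r y}, k y) ∂G := by
  set T : Set (Euc d × Euc d) := {p | dist p.1 p.2 < r p.2} with hT
  have hTm : MeasurableSet T := measurableSet_lt (by fun_prop) (by fun_prop)
  have hF : Measurable (T.indicator fun p => φ p.1 * k p.2) :=
    Measurable.indicator (by fun_prop) hTm
  have h1 : ∀ y, k y * ∫⁻ x in ball y (r y), φ x ∂G =
      ∫⁻ x, T.indicator (fun p => φ p.1 * k p.2) (x, y) ∂G := by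
    intro y
    rw [← lintegral_const_mul _ hφ, ← lintegral_indicator measurableSet_ball]
    refine lintegral_congr fun x => ?_
    simp only [Set.indicator, hT, mem_ball, Set.mem_ofPred_eq, mul_comm]
  have h2 : ∀ x, φ x * ∫⁻ y in {y | dist x y < r y}, k y =
      ∫⁻ y, T.indicator (fun p => φ p.1 * k p.2) (x, y) := by
    intro x
    rw [← lintegral_const_mul _ hk, ← lintegral_indicator
      (measurableSet_lt (by fun_prop) (by fun_prop))]
    refine lintegral_congr fun y => ?_
    simp only [Set.indicator, hT, Set.mem_ofPred_eq]
  simp only [h1, h2]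
  exact lintegral_lintegral_swap (f := fun y x => T.indicator (fun p => φ p.1 * k p.2) (x, y))
    (hF.comp measurable_swap).aemeasurable

lemma radius_le_of_ball_subset {d : ℕ} (hd : 0 < d) {y z : Euc d} {r ρ : ℝ} (hr : 0 < r)
    (hρ : 0 < ρ) (h : ball y r ⊆ ball z ρ) : r ≤ ρ := by
  have h1 := measure_mono (μ := volume) h
  rw [Measure.addHaar_ball_of_pos _ _ hr, Measure.addHaar_ball_of_pos _ _ hρ,
    finrank_euclideanSpace_fin, ENNReal.mul_le_mul_iff_left (measure_ball_pos _ _ one_pos).ne'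
    measure_ball_lt_top.ne, ENNReal.ofReal_le_ofReal_iff (by positivity)] at h1
  exact le_of_pow_le_pow_left₀ hd.ne' hρ.le h1

/-- Covering a ball by small balls: an estimate at scale `r / 8` yields one at scale `r`. -/
lemma lintegral_closedBall_le_of_small_balls {d : ℕ} {G : Measure (Euc d)}
    [SFinite G] {φ : Euc d → ℝ≥0∞} (hφ : Measurable φ) {y₀ : Euc d} {r : ℝ} (hr : 0 < r)
    {c : ℝ≥0∞} (h : ∀ y, ball y (2 * (r / 8)) ⊆ ball y₀ (2 * r) →
      ∫⁻ x in ball y (r / 8), φ x ∂G ≤ c * G (ball y (2 * (r / 8)))) :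
    ∫⁻ x in closedBall y₀ (3 / 2 * r), φ x ∂G ≤ c * 2 ^ d * G (ball y₀ (2 * r)) := by
  set K := ball y₀ (13 / 8 * r) with hK
  set v := volume (ball (0 : Euc d) (r / 8)) with hv
  have hv0 : v ≠ 0 := (measure_ball_pos _ _ (by positivity)).ne'
  have hv1 : v ≠ ∞ := measure_ball_lt_top.ne
  have hvb : ∀ x : Euc d, volume (ball x (r / 8)) = v := fun x =>
    Measure.addHaar_ball_center _ _ _
  have hv2 : ∀ x : Euc d, volume (ball x (2 * (r / 8))) = 2 ^ d * v := fun x => by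
    rw [Measure.addHaar_ball_of_pos _ _ (by positivity : 0 < 2 * (r / 8)), hv,
      Measure.addHaar_ball_of_pos _ _ (by positivity : 0 < r / 8), finrank_euclideanSpace_fin, mul_pow,
      ENNReal.ofReal_mul (by positivity), mul_assoc, ENNReal.ofReal_pow (by norm_num)]
    simp
  set k : Euc d → ℝ≥0∞ := K.indicator fun _ => v⁻¹ with hk
  have hkm : Measurable k := measurable_const.indicator measurableSet_ball
  have e1 : ∀ x : Euc d, {y : Euc d | dist x y < r / 8} = ball x (r / 8) := fun x => by
    ext y; simp [dist_comm]
  have e2 : ∀ x : Euc d, {y : Euc d | dist x y < 2 * (r / 8)} = ball x (2 * (r / 8)) := fun x => by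
    ext y; simp [dist_comm]
  calc ∫⁻ x in closedBall y₀ (3 / 2 * r), φ x ∂G
      ≤ ∫⁻ x in closedBall y₀ (3 / 2 * r), φ x * (∫⁻ y in {y | dist x y < r / 8}, k y) ∂G := by
        refine setLIntegral_mono' measurableSet_closedBall fun x hx => le_of_eq ?_
        rw [e1, hk, setLIntegral_indicator measurableSet_ball, setLIntegral_const,
          Set.inter_eq_self_of_subset_right, hvb, ENNReal.inv_mul_cancel hv0 hv1, mul_one]
        refine ball_subset_ball' ?_
        rw [mem_closedBall] at hx
        linarith
    _ ≤ ∫⁻ x, φ x * (∫⁻ y in {y | dist x y < r / 8}, k y) ∂G := setLIntegral_le_lintegral _ _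
    _ = ∫⁻ y, k y * ∫⁻ x in ball y (r / 8), φ x ∂G := (lintegral_ball_swap
        measurable_const hkm hφ).symm
    _ ≤ ∫⁻ y, k y * ∫⁻ x in ball y (2 * (r / 8)),
          (ball y₀ (2 * r)).indicator (fun _ => c) x ∂G := by
        refine lintegral_mono fun y => ?_
        by_cases hy : y ∈ K
        · have hsub : ball y (2 * (r / 8)) ⊆ ball y₀ (2 * r) := by
            refine ball_subset_ball' ?_
            rw [hK, mem_ball] at hy
            linarith
          refine mul_le_mul_right ((h y hsub).trans_eq ?_) _
          rw [setLIntegral_indicator measurableSet_ball, setLIntegral_const,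
            Set.inter_eq_self_of_subset_right hsub]
        · simp [hk, hy]
    _ = ∫⁻ x, (ball y₀ (2 * r)).indicator (fun _ => c) x *
          (∫⁻ y in {y | dist x y < 2 * (r / 8)}, k y) ∂G :=
        lintegral_ball_swap measurable_const hkm (measurable_const.indicator measurableSet_ball)
    _ ≤ ∫⁻ x, (ball y₀ (2 * r)).indicator (fun _ => c) x * 2 ^ d ∂G := by
        refine lintegral_mono fun x => mul_le_mul_right ?_ _
        calc ∫⁻ y in {y | dist x y < 2 * (r / 8)}, k y
            ≤ ∫⁻ y in {y | dist x y < 2 * (r / 8)}, v⁻¹ :=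
              lintegral_mono fun y => Set.indicator_le_self' (fun _ _ => zero_le) _
          _ = 2 ^ d := by
              rw [setLIntegral_const, e2, hv2, mul_comm, mul_assoc, ENNReal.mul_inv_cancel hv0 hv1,
                mul_one]
    _ = c * 2 ^ d * G (ball y₀ (2 * r)) := by
        rw [lintegral_mul_const _ (measurable_const.indicator measurableSet_ball),
          lintegral_indicator measurableSet_ball, setLIntegral_const]
        ring

/-- Improved local estimate with exponent `d₀ < d`, for operators with small drift. -/
lemma exists_improved_estimate_small_drift {d : ℕ} (hd : 2 ≤ d) {δ : ℝ} (hδ : 0 < δ) :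
    ∃ d₀ : ℝ, (d : ℝ) / 2 < d₀ ∧ d₀ < d ∧ ∃ C : ℝ≥0∞, C ≠ ∞ ∧
      ∀ (a : Euc d → Matrix (Fin d) (Fin d) ℝ) (b : Euc d → Euc d), Continuous a → Continuous b →
      (∀ x, a x ∈ Sdelta d δ) → ∀ (R : ℝ) (G : Measure (Euc d)), IsFiniteMeasure G →
      IsAdjSuper d a b R G → ∀ β : ℝ≥0∞, C * β ≤ 1 →
      (∀ (y : Euc d) (r : ℝ), 0 < r → ball y (2 * r) ⊆ ball 0 R →
        lpAvg d₀ (ball y r) (fun x => ‖b x‖ₑ) ≤ β * ENNReal.ofReal r⁻¹) →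
      ∀ (y : Euc d) (r : ℝ), 0 < r → ball y (2 * r) ⊆ ball 0 R →
      ∀ f : Euc d → ℝ≥0∞, Measurable f →
        ∫⁻ x in ball y r, f x ∂G ≤ C * lpAvg d₀ (ball y r) f * G (ball y (2 * r)) := by
  obtain ⟨C₁, hC₁, H₁⟩ := exists_local_estimate_lintegral d (by omega) hδ
  set A := C₁.toReal * (1 + 8 * 2 ^ d) + 1 with hA
  have hA0 : 0 < A := by positivity
  have hAC : C₁ * (1 + 8 * 2 ^ d) ≤ ENNReal.ofReal A := by
    have h1 : ENNReal.ofReal (1 + 8 * 2 ^ d) = 1 + 8 * 2 ^ d := by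
      rw [ENNReal.ofReal_add (by positivity) (by positivity), ENNReal.ofReal_mul (by positivity),
        ENNReal.ofReal_pow (by positivity)]
      simp
    rw [hA, ← h1]
    conv_lhs => rw [← ENNReal.ofReal_toReal hC₁]
    rw [← ENNReal.ofReal_mul toReal_nonneg]
    exact ENNReal.ofReal_le_ofReal (by linarith)
  obtain ⟨d₀, hd₀1, hd₀2, C, hC, H₂⟩ := exists_improved_local_estimate hd hA0
  refine ⟨d₀, hd₀1, hd₀2, C, hC, fun a b ha hb hax R G hG hadj β hβ hbb => ?_⟩
  have hbm : Measurable fun x => ‖b x‖ₑ := hb.enorm.measurable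
  set P : ℝ → Prop := fun ρ => ∀ (y : Euc d) (r : ℝ), 0 < r → r ≤ ρ → ball y (2 * r) ⊆ ball 0 R →
    ∫⁻ x in ball y r, ‖b x‖ₑ ∂G ≤ ENNReal.ofReal r⁻¹ * G (ball y (2 * r)) with hP
  have step : ∀ ρ, P ρ → ∀ (z : Euc d) (s : ℝ), 0 < s → s ≤ 8 * ρ → ball z (2 * s) ⊆ ball 0 R →
      ∀ f : Euc d → ℝ≥0∞, Measurable f →
        ∫⁻ x in ball z s, f x ∂G ≤ C * lpAvg d₀ (ball z s) f * G (ball z (2 * s)) := by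
    intro ρ hPρ z s hs hsρ hzs
    refine H₂ G hG z s hs fun y r hr hsub f hf => ?_
    have hrs : r ≤ s := by
      have := radius_le_of_ball_subset (by omega) (by positivity) (by positivity) hsub
      linarith
    have hsub' := hsub.trans hzs
    have hdrift := lintegral_closedBall_le_of_small_balls (G := G) hbm hr (y₀ := y)
      (c := ENNReal.ofReal (r / 8)⁻¹) fun w hw =>
        hPρ w (r / 8) (by positivity) (by linarith) (hw.trans hsub')
    have e : ENNReal.ofReal (r / 8)⁻¹ = 8 * ENNReal.ofReal r⁻¹ := by
      rw [inv_div, div_eq_mul_inv, ENNReal.ofReal_mul (by norm_num)]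
      simp
    rw [e] at hdrift
    calc ∫⁻ x in ball y r, f x ∂G
        ≤ C₁ * (∫⁻ x in ball y r, f x ^ (d : ℝ)) ^ (1 / d : ℝ) *
          (ENNReal.ofReal r⁻¹ * G (ball y (2 * r)) +
            ∫⁻ x in closedBall y (3 / 2 * r), ‖b x‖ₑ ∂G) :=
          H₁ a b ha hb hax R G hG hadj y r hr hsub' f hf
      _ ≤ C₁ * (∫⁻ x in ball y r, f x ^ (d : ℝ)) ^ (1 / d : ℝ) *
          (ENNReal.ofReal r⁻¹ * G (ball y (2 * r)) +
            8 * ENNReal.ofReal r⁻¹ * 2 ^ d * G (ball y (2 * r))) := by gcongr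
      _ = (C₁ * (1 + 8 * 2 ^ d)) * ENNReal.ofReal r⁻¹ *
          (∫⁻ x in ball y r, f x ^ (d : ℝ)) ^ (1 / d : ℝ) * G (ball y (2 * r)) := by ring
      _ ≤ _ := by gcongr
  have up : ∀ ρ, P ρ → P (8 * ρ) := by
    intro ρ hPρ y r hr hrρ hsub
    calc ∫⁻ x in ball y r, ‖b x‖ₑ ∂G
        ≤ C * lpAvg d₀ (ball y r) (fun x => ‖b x‖ₑ) * G (ball y (2 * r)) :=
          step ρ hPρ y r hr hrρ hsub _ hbm
      _ ≤ C * (β * ENNReal.ofReal r⁻¹) * G (ball y (2 * r)) := by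
          gcongr
          exact hbb y r hr hsub
      _ = (C * β) * (ENNReal.ofReal r⁻¹ * G (ball y (2 * r))) := by ring
      _ ≤ 1 * (ENNReal.ofReal r⁻¹ * G (ball y (2 * r))) := by gcongr
      _ = _ := one_mul _
  obtain ⟨M, hM⟩ : ∃ M : ℝ, ∀ x ∈ closedBall (0 : Euc d) R, ‖b x‖ ≤ M :=
    (isCompact_closedBall (0 : Euc d) R).exists_bound_of_continuousOn hb.continuousOn
  have base : P (1 / (|M| + 1)) := by
    intro y r hr hrρ hsub
    have hMr : |M| ≤ r⁻¹ := by
      rw [le_div_iff₀ (by positivity)] at hrρ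
      rw [← one_div, le_div_iff₀ hr]
      nlinarith
    have hs1 : ball y r ⊆ ball y (2 * r) := ball_subset_ball (by linarith)
    calc ∫⁻ x in ball y r, ‖b x‖ₑ ∂G ≤ ∫⁻ _ in ball y r, ENNReal.ofReal r⁻¹ ∂G := by
          refine setLIntegral_mono' measurableSet_ball fun x hx => ?_
          rw [← ofReal_norm]
          exact ENNReal.ofReal_le_ofReal (((hM x (ball_subset_closedBall
            (hsub (hs1 hx)))).trans (le_abs_self _)).trans hMr)
      _ = ENNReal.ofReal r⁻¹ * G (ball y r) := setLIntegral_const _ _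
      _ ≤ _ := mul_le_mul_right (measure_mono hs1) _
  have all : ∀ n : ℕ, P (8 ^ n * (1 / (|M| + 1))) := by
    intro n
    induction n with
    | zero => simpa using base
    | succ n ih => rw [pow_succ', mul_assoc]; exact up _ ih
  intro y r hr hsub
  obtain ⟨n, hn⟩ := pow_unbounded_of_one_lt (r * (|M| + 1)) (by norm_num : (1 : ℝ) < 8)
  refine step _ (all n) y r hr ?_ hsub
  have h2 : r < 8 ^ n * (1 / (|M| + 1)) := by
    rw [mul_one_div, lt_div_iff₀ (by positivity)]
    exact hn
  linarith

/-- Weighted estimate near the boundary from interior estimates, via Whitney-type averaging. -/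
lemma exists_whitney_estimate {d : ℕ} (hd : 0 < d) {μ θ : ℝ} (hθ : 0 ≤ θ) (hμ : θ ≤ μ) :
    ∃ C : ℝ≥0∞, C ≠ ∞ ∧ ∀ (G : Measure (Euc d)), IsFiniteMeasure G → ∀ (R h : ℝ), 1 / 2 ≤ R →
      R ≤ 1 → 0 < h → ∀ (φ : Euc d → ℝ≥0∞), Measurable φ → ∀ A : ℝ≥0∞, A ≠ ∞ →
      (∀ (y : Euc d) (r : ℝ), 0 < r → ball y (2 * r) ⊆ ball 0 R →
        ∫⁻ x in ball y r, φ x ∂G ≤ A * ENNReal.ofReal (r ^ (-θ)) * G (ball y (2 * r))) →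
      ∫⁻ x in closedBall 0 (R - h), φ x * ENNReal.ofReal ((R ^ 2 + h - ‖x‖ ^ 2) ^ (θ - μ)) ∂G ≤
        C * A * ∫⁻ x in ball 0 R, ENNReal.ofReal ((R ^ 2 + h - ‖x‖ ^ 2) ^ (-μ)) ∂G := by
  obtain ⟨ω, hω⟩ : ∃ ω : ℝ, ω = (volume (ball (0 : Euc d) 1)).toReal := ⟨_, rfl⟩
  have hω0 : 0 < ω := by
    rw [hω]
    exact ENNReal.toReal_pos (measure_ball_pos _ _ one_pos).ne' measure_ball_lt_top.ne
  have hvol : ∀ (x : Euc d) {r : ℝ}, 0 < r → volume (ball x r) = ENNReal.ofReal (r ^ d * ω) := by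
    intro x r hr
    rw [Measure.addHaar_ball_of_pos _ _ hr, finrank_euclideanSpace_fin,
      ENNReal.ofReal_mul (by positivity), hω, ENNReal.ofReal_toReal measure_ball_lt_top.ne]
  set β : ℝ := θ - μ with hβ
  have hβ0 : β ≤ 0 := by linarith
  set c₁ : ℝ := 2 ^ (-β) * (2 ^ (d - β) * 32 ^ d / ω) with hc₁
  have hc₁0 : 0 < c₁ := by positivity
  set c₂ : ℝ := 2 ^ (d + μ) * ω * 6 ^ μ with hc₂
  have hc₂0 : 0 < c₂ := by positivity
  refine ⟨ENNReal.ofReal c₁ * ENNReal.ofReal (16 ^ θ) * ENNReal.ofReal c₂,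
    ENNReal.mul_ne_top (ENNReal.mul_ne_top ofReal_ne_top ofReal_ne_top) ofReal_ne_top,
    fun G hG R h hR hR1 hh φ hφ A hA hyp => ?_⟩
  set t : Euc d → ℝ := fun y => R - ‖y‖ with ht
  have htm : Measurable t := by fun_prop
  have htl : ∀ x y : Euc d, t x ≤ t y + dist x y := by
    intro x y
    have : ‖y‖ - ‖x‖ ≤ ‖y - x‖ := norm_sub_norm_le y x
    rw [dist_comm, dist_eq_norm]
    simp only [ht]
    linarith
  have hτ : ∀ x : Euc d, R ^ 2 + h - ‖x‖ ^ 2 = t x * (R + ‖x‖) + h := fun x => by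
    simp only [ht]; ring
  set Z : Set (Euc d) := {y | h / 2 < t y} with hZ
  have hZm : MeasurableSet Z := measurableSet_lt measurable_const htm
  set k : Euc d → ℝ≥0∞ := Z.indicator fun y => ENNReal.ofReal (t y ^ (β - d)) with hk
  have hkm : Measurable k := Measurable.indicator (by fun_prop) hZm
  set k₂ : Euc d → ℝ≥0∞ := Z.indicator fun y => ENNReal.ofReal (t y ^ (-μ - d)) with hk₂
  have hk₂m : Measurable k₂ := Measurable.indicator (by fun_prop) hZm
  have hlow : ∀ x ∈ closedBall (0 : Euc d) (R - h), ENNReal.ofReal ((R ^ 2 + h - ‖x‖ ^ 2) ^ β) ≤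
      ENNReal.ofReal c₁ * ∫⁻ y in {y | dist x y < t y / 16}, k y := by
    intro x hx
    rw [mem_closedBall_zero_iff] at hx
    have hxt : h ≤ t x := by simp only [ht]; linarith
    have hxt0 : 0 < t x := hh.trans_le hxt
    have e1 : ENNReal.ofReal ((2 * t x) ^ (β - d)) * ENNReal.ofReal ((t x / 32) ^ d * ω) ≤
        ∫⁻ y in {y | dist x y < t y / 16}, k y := by
      rw [← hvol x (by positivity), ← setLIntegral_const]
      refine le_trans ?_ (lintegral_mono_set (s := ball x (t x / 32)) fun y hy => ?_)
      · refine setLIntegral_mono' measurableSet_ball fun y hy => ?_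
        rw [mem_ball, dist_comm] at hy
        have h1 := htl x y
        have h2 := htl y x
        rw [dist_comm] at h2
        have hyZ : y ∈ Z := by
          simp only [hZ, Set.mem_ofPred_eq]
          linarith
        rw [hk, Set.indicator_of_mem hyZ]
        refine ENNReal.ofReal_le_ofReal ?_
        refine Real.rpow_le_rpow_of_nonpos (by linarith) (by linarith) ?_
        have : (0 : ℝ) ≤ d := by positivity
        linarith
      · rw [mem_ball, dist_comm] at hy
        have h1 := htl x y
        simp only [Set.mem_ofPred_eq]
        linarith
    refine le_trans ?_ (mul_le_mul_right e1 _)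
    rw [← ENNReal.ofReal_mul (by positivity), ← ENNReal.ofReal_mul (by positivity)]
    refine ENNReal.ofReal_le_ofReal ?_
    have e2 : c₁ * ((2 * t x) ^ (β - d) * ((t x / 32) ^ d * ω)) = (t x / 2) ^ β := by
      rw [hc₁, Real.mul_rpow (by norm_num) hxt0.le, Real.rpow_sub hxt0, Real.rpow_natCast,
        Real.rpow_sub two_pos β, Real.rpow_sub two_pos (d : ℝ), Real.div_rpow hxt0.le (by norm_num),
        Real.rpow_neg (by norm_num), div_pow]
      field_simp
    rw [e2]
    refine Real.rpow_le_rpow_of_nonpos (by positivity) ?_ hβ0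
    rw [hτ]
    have := norm_nonneg x
    nlinarith
  have hup : ∀ x, ∫⁻ y in {y | dist x y < 2 * (t y / 16)}, k₂ y ≤
      (ball (0 : Euc d) R).indicator
        (fun x => ENNReal.ofReal c₂ * ENNReal.ofReal ((R ^ 2 + h - ‖x‖ ^ 2) ^ (-μ))) x := by
    intro x
    by_cases hxt : h / 4 ≤ t x
    · have hxt0 : 0 < t x := by linarith
      have hxR : x ∈ ball (0 : Euc d) R := by
        rw [mem_ball_zero_iff]; simp only [ht] at hxt0; linarith
      rw [Set.indicator_of_mem hxR]
      have hsm : MeasurableSet {y | dist x y < 2 * (t y / 16)} :=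
        measurableSet_lt (by fun_prop) (by fun_prop)
      calc ∫⁻ y in {y | dist x y < 2 * (t y / 16)}, k₂ y
          ≤ ∫⁻ y in {y | dist x y < 2 * (t y / 16)}, ENNReal.ofReal ((t x / 2) ^ (-μ - d)) := by
            refine setLIntegral_mono' hsm fun y hy => ?_
            by_cases hyZ : y ∈ Z
            · rw [hk₂, Set.indicator_of_mem hyZ]
              refine ENNReal.ofReal_le_ofReal
                (Real.rpow_le_rpow_of_nonpos (by positivity) ?_ ?_)
              · simp only [Set.mem_ofPred_eq, hZ] at hy hyZ
                have := htl x y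
                linarith
              · have : (0 : ℝ) ≤ d := by positivity
                linarith
            · simp [hk₂, hyZ]
        _ ≤ ENNReal.ofReal ((t x / 2) ^ (-μ - d)) * volume (ball x (t x)) := by
            rw [setLIntegral_const]
            refine mul_le_mul_right (measure_mono fun y hy => ?_) _
            simp only [Set.mem_ofPred_eq] at hy
            have := htl y x
            rw [mem_ball]
            rw [dist_comm] at hy
            linarith
        _ = ENNReal.ofReal (2 ^ (d + μ) * ω * t x ^ (-μ)) := by
            rw [hvol x hxt0, ← ENNReal.ofReal_mul (by positivity)]
            congr 1
            rw [Real.div_rpow hxt0.le (by norm_num), Real.rpow_sub hxt0, Real.rpow_natCast,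
              show -μ - (d : ℝ) = -(d + μ) by ring, Real.rpow_neg (by norm_num) (d + μ)]
            field_simp
        _ ≤ _ := by
            rw [← ENNReal.ofReal_mul hc₂0.le]
            refine ENNReal.ofReal_le_ofReal ?_
            rw [hc₂, mul_assoc _ (6 ^ μ)]
            refine mul_le_mul_of_nonneg_left ?_ (by positivity)
            have h0 := norm_nonneg x
            have hxn : ‖x‖ < R := by rwa [mem_ball_zero_iff] at hxR
            have hpos : 0 < R ^ 2 + h - ‖x‖ ^ 2 := by rw [hτ]; positivity
            calc t x ^ (-μ) ≤ ((R ^ 2 + h - ‖x‖ ^ 2) / 6) ^ (-μ) := by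
                  refine Real.rpow_le_rpow_of_nonpos (by positivity) ?_ (by linarith)
                  rw [hτ]
                  nlinarith
              _ = 6 ^ μ * (R ^ 2 + h - ‖x‖ ^ 2) ^ (-μ) := by
                  rw [Real.div_rpow hpos.le (by norm_num), Real.rpow_neg (by norm_num : (0 : ℝ) ≤ 6) μ]
                  field_simp
    · have : ∫⁻ y in {y | dist x y < 2 * (t y / 16)}, k₂ y = 0 := by
        rw [setLIntegral_eq_zero (measurableSet_lt (by fun_prop) (by fun_prop))]
        intro y hy
        simp only [Set.mem_ofPred_eq] at hy
        have h1 := htl y x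
        rw [dist_comm] at h1
        have hyZ : y ∉ Z := by
          simp only [hZ, Set.mem_ofPred_eq]
          push Not at hxt ⊢
          linarith
        simp [hk₂, hyZ]
      rw [this]; exact zero_le
  calc ∫⁻ x in closedBall 0 (R - h), φ x * ENNReal.ofReal ((R ^ 2 + h - ‖x‖ ^ 2) ^ β) ∂G
      ≤ ∫⁻ x in closedBall 0 (R - h),
          ENNReal.ofReal c₁ * (φ x * (∫⁻ y in {y | dist x y < t y / 16}, k y)) ∂G := by
        refine setLIntegral_mono' measurableSet_closedBall fun x hx => ?_
        rw [mul_left_comm]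
        exact mul_le_mul_right (hlow x hx) _
    _ ≤ ∫⁻ x, ENNReal.ofReal c₁ * (φ x * (∫⁻ y in {y | dist x y < t y / 16}, k y)) ∂G :=
        setLIntegral_le_lintegral _ _
    _ = ENNReal.ofReal c₁ * ∫⁻ y, k y * ∫⁻ x in ball y (t y / 16), φ x ∂G := by
        rw [lintegral_const_mul' _ _ ofReal_ne_top, lintegral_ball_swap (by fun_prop) hkm hφ]
    _ ≤ ENNReal.ofReal c₁ * ∫⁻ y, A * ENNReal.ofReal (16 ^ θ) *
          (k₂ y * ∫⁻ x in ball y (2 * (t y / 16)), 1 ∂G) := by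
        refine mul_le_mul_right (lintegral_mono fun y => ?_) _
        by_cases hyZ : y ∈ Z
        · have hyt : 0 < t y := by
            have : h / 2 < t y := hyZ
            linarith
          have h1 := hyp y (t y / 16) (by positivity) (by
            refine ball_subset_ball' ?_
            rw [dist_zero_right]
            simp only [ht] at hyt ⊢
            linarith)
          rw [setLIntegral_one, hk, hk₂, Set.indicator_of_mem hyZ, Set.indicator_of_mem hyZ]
          refine (mul_le_mul_right h1 _).trans_eq ?_
          have e : ENNReal.ofReal (t y ^ (β - d)) * ENNReal.ofReal ((t y / 16) ^ (-θ)) =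
              ENNReal.ofReal (16 ^ θ) * ENNReal.ofReal (t y ^ (-μ - d)) := by
            rw [← ENNReal.ofReal_mul (by positivity), ← ENNReal.ofReal_mul (by positivity)]
            congr 1
            rw [Real.div_rpow hyt.le (by norm_num), Real.rpow_neg (by norm_num : (0 : ℝ) ≤ 16) θ, hβ,
              show -μ - (d : ℝ) = (θ - μ - d) + (-θ) by ring, Real.rpow_add hyt]
            field_simp
          calc _ = A * (ENNReal.ofReal (t y ^ (β - d)) * ENNReal.ofReal ((t y / 16) ^ (-θ))) *
                G (ball y (2 * (t y / 16))) := by ring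
            _ = _ := by rw [e]; ring
        · simp [hk, hyZ]
    _ = ENNReal.ofReal c₁ * (A * ENNReal.ofReal (16 ^ θ) *
          ∫⁻ x, 1 * (∫⁻ y in {y | dist x y < 2 * (t y / 16)}, k₂ y) ∂G) := by
        rw [← lintegral_ball_swap (by fun_prop) hk₂m measurable_const,
          lintegral_const_mul' _ _ (ENNReal.mul_ne_top hA ofReal_ne_top)]
    _ ≤ ENNReal.ofReal c₁ * (A * ENNReal.ofReal (16 ^ θ) * ∫⁻ x, (ball (0 : Euc d) R).indicator
        (fun x => ENNReal.ofReal c₂ * ENNReal.ofReal ((R ^ 2 + h - ‖x‖ ^ 2) ^ (-μ))) x ∂G) := by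
        gcongr with x
        rw [one_mul]
        exact hup x
    _ = _ := by
        rw [lintegral_indicator measurableSet_ball, lintegral_const_mul' _ _ ofReal_ne_top]
        ring

lemma exists_contDiff_eventuallyEq {d : ℕ} {f : Euc d → ℝ} {R R' : ℝ} (hR : 0 < R) (hRR' : R < R')
    (hf : ContDiffOn ℝ 2 f (ball 0 R')) :
    ∃ w : Euc d → ℝ, ContDiff ℝ 2 w ∧ ∀ x ∈ closedBall (0 : Euc d) R, w =ᶠ[nhds x] f := by
  let χ : ContDiffBump (0 : Euc d) := ⟨(2 * R + R') / 3, (R + 2 * R') / 3, by linarith, by linarith⟩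
  refine ⟨fun x => χ x * f x, ?_, fun x hx => ?_⟩
  · refine contDiff_iff_contDiffAt.2 fun x => ?_
    by_cases h1 : x ∈ tsupport χ
    swap
    · refine (contDiffAt_const (c := (0 : ℝ))).congr_of_eventuallyEq ?_
      filter_upwards [notMem_tsupport_iff_eventuallyEq.1 h1] with y hy
      rw [hy]
      simp
    rw [χ.tsupport_eq] at h1
    have h2 : x ∈ ball (0 : Euc d) R' := by
      have h3 : dist x 0 ≤ (R + 2 * R') / 3 := h1
      rw [mem_ball]
      linarith
    exact χ.contDiff.contDiffAt.mul (hf.contDiffAt (isOpen_ball.mem_nhds h2))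
  · have h2 : x ∈ ball (0 : Euc d) χ.rIn := by
      have h3 : dist x 0 ≤ R := hx
      have h4 : χ.rIn = (2 * R + R') / 3 := rfl
      rw [mem_ball, h4]
      linarith
    filter_upwards [χ.eventuallyEq_one_of_mem_ball h2] with y hy
    rw [hy]
    simp

lemma Lop_congr_of_eventuallyEq {d : ℕ} (a : Euc d → Matrix (Fin d) (Fin d) ℝ)
    (b : Euc d → Euc d) {w f : Euc d → ℝ} {x : Euc d} (h : w =ᶠ[nhds x] f) :
    Lop d a b w x = Lop d a b f x := by
  have h1 : fderiv ℝ w =ᶠ[nhds x] fderiv ℝ f := h.fderiv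
  rw [Lop_eq, Lop_eq, h.fderiv_eq]
  unfold hess
  rw [h1.fderiv_eq]

lemma neg_Lop_rpow_ge {d : ℕ} (hd : 2 ≤ d) {δ : ℝ} (hδ : 0 < δ)
    {a : Euc d → Matrix (Fin d) (Fin d) ℝ} (b : Euc d → Euc d) {α S : ℝ} (hα : 0 < α)
    (hα1 : α < 1) {x : Euc d} (hx : ‖x‖ ≤ 1) (hxS : ‖x‖ ^ 2 < S) (hax : a x ∈ Sdelta d δ) :
    α * (S - ‖x‖ ^ 2) ^ (α - 2) * (4 * δ * (1 - α) * S - 2 * (S - ‖x‖ ^ 2) * ‖b x‖) ≤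
      -Lop d a b (fun y => (S - ‖y‖ ^ 2) ^ α) x := by
  have hd2 : (2 : ℝ) ≤ d := by exact_mod_cast hd
  have hτ : 0 < S - ‖x‖ ^ 2 := by linarith
  have hq : ∀ y : Euc d, HasFDerivAt (fun y : Euc d => S - ‖y‖ ^ 2) (-((2 : ℝ) • innerSL ℝ y)) y := by
    intro y
    have h := ((hasStrictFDerivAt_norm_sq (F := Euc d) y).hasFDerivAt).const_sub S
    convert! h using 1
    ext v; simp
  have hw : ∀ y : Euc d, 0 < S - ‖y‖ ^ 2 → HasFDerivAt (fun y : Euc d => (S - ‖y‖ ^ 2) ^ α)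
      ((-(2 * α) * (S - ‖y‖ ^ 2) ^ (α - 1)) • innerSL ℝ y) y := by
    intro y hy
    have h := (hq y).rpow_const (p := α) (Or.inl hy.ne')
    convert! h using 1
    ext v; simp; ring
  have hev : fderiv ℝ (fun y : Euc d => (S - ‖y‖ ^ 2) ^ α) =ᶠ[nhds x]
      fun y => (-(2 * α) * (S - ‖y‖ ^ 2) ^ (α - 1)) • innerSL ℝ y := by
    have : {y : Euc d | 0 < S - ‖y‖ ^ 2} ∈ nhds x :=
      (isOpen_lt continuous_const (by fun_prop)).mem_nhds hτ
    filter_upwards [this] with y hy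
    exact (hw y hy).fderiv
  have hc : HasFDerivAt (fun y : Euc d => -(2 * α) * (S - ‖y‖ ^ 2) ^ (α - 1))
      (-(2 * α) • (((α - 1) * (S - ‖x‖ ^ 2) ^ (α - 1 - 1)) • (-((2 : ℝ) • innerSL ℝ x)))) x :=
    ((hq x).rpow_const (p := α - 1) (Or.inl hτ.ne')).const_mul _
  obtain ⟨I, hI, hinn⟩ : ∃ I : Euc d →L[ℝ] Euc d →L[ℝ] ℝ, (∀ u v, I u v = inner ℝ u v) ∧
      HasFDerivAt (fun y : Euc d => innerSL ℝ y) I x :=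
    ⟨innerSL ℝ (E := Euc d), fun _ _ => rfl, (innerSL ℝ (E := Euc d)).hasFDerivAt⟩
  have hh : ∀ u v, hess (fun y : Euc d => (S - ‖y‖ ^ 2) ^ α) x u v =
      -(2 * α) * (S - ‖x‖ ^ 2) ^ (α - 1) * inner ℝ u v -
        4 * α * (1 - α) * (S - ‖x‖ ^ 2) ^ (α - 2) * (inner ℝ x u * inner ℝ x v) := by
    intro u v
    unfold hess
    rw [hev.fderiv_eq, (hc.fun_smul hinn).fderiv, show α - 1 - 1 = α - 2 by ring]
    simp [hI]
    ring
  have ht1 : (S - ‖x‖ ^ 2) ^ (α - 1) = (S - ‖x‖ ^ 2) ^ (α - 2) * (S - ‖x‖ ^ 2) := by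
    rw [show α - 1 = (α - 2) + 1 by ring, Real.rpow_add hτ, Real.rpow_one]
  have hT : 0 < (S - ‖x‖ ^ 2) ^ (α - 2) := by positivity
  have hB : ∀ u, 0 ≤ ((-1 : ℝ) • hess (fun y : Euc d => (S - ‖y‖ ^ 2) ^ α) x) u u := by
    intro u
    have h1 : ((-1 : ℝ) • hess (fun y : Euc d => (S - ‖y‖ ^ 2) ^ α) x) u u =
        -hess (fun y : Euc d => (S - ‖y‖ ^ 2) ^ α) x u u := by simp
    rw [h1, hh, ht1, real_inner_self_eq_norm_sq]
    have h3 : 0 ≤ 2 * α * ((S - ‖x‖ ^ 2) ^ (α - 2) * (S - ‖x‖ ^ 2)) * ‖u‖ ^ 2 := by positivity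
    have h4 : 0 ≤ 4 * α * (1 - α) * (S - ‖x‖ ^ 2) ^ (α - 2) * (inner ℝ x u * inner ℝ x u) :=
      mul_nonneg (mul_nonneg (mul_nonneg (by positivity) (by linarith)) hT.le)
        (mul_self_nonneg _)
    linarith
  have key := Sdelta_contr_ge hax hB
  have hsum : ∑ i, ((-1 : ℝ) • hess (fun y : Euc d => (S - ‖y‖ ^ 2) ^ α) x) (stdVec i) (stdVec i) =
      2 * α * ((S - ‖x‖ ^ 2) ^ (α - 2) * (S - ‖x‖ ^ 2)) * d +
        4 * α * (1 - α) * (S - ‖x‖ ^ 2) ^ (α - 2) * ‖x‖ ^ 2 := by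
    have h1 : ∀ i, ((-1 : ℝ) • hess (fun y : Euc d => (S - ‖y‖ ^ 2) ^ α) x) (stdVec i) (stdVec i) =
        2 * α * ((S - ‖x‖ ^ 2) ^ (α - 2) * (S - ‖x‖ ^ 2)) +
          4 * α * (1 - α) * (S - ‖x‖ ^ 2) ^ (α - 2) * x i ^ 2 := by
      intro i
      have h2 : ((-1 : ℝ) • hess (fun y : Euc d => (S - ‖y‖ ^ 2) ^ α) x) (stdVec i) (stdVec i) =
          -hess (fun y : Euc d => (S - ‖y‖ ^ 2) ^ α) x (stdVec i) (stdVec i) := by simp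
      rw [h2, hh, ht1, real_inner_self_eq_norm_sq, norm_stdVec,
        EuclideanSpace.inner_single_right]
      simp
      ring
    rw [Finset.sum_congr rfl fun i _ => h1 i, Finset.sum_add_distrib,
      ← Finset.mul_sum (f := fun i => x i ^ 2), ← EuclideanSpace.real_norm_sq_eq,
      Finset.sum_const, Finset.card_univ, Fintype.card_fin, nsmul_eq_mul]
    ring
  rw [contr_smul, hsum] at key
  rw [Lop_eq, (hw x hτ).fderiv]
  have hin : |inner ℝ x (b x)| ≤ ‖b x‖ := (abs_real_inner_le_norm x (b x)).trans (by
    have := norm_nonneg (b x)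
    nlinarith)
  have hin2 := (abs_le.1 hin).1
  have e1 : ((-(2 * α) * (S - ‖x‖ ^ 2) ^ (α - 1)) • innerSL ℝ x) (b x) =
      -(2 * α * ((S - ‖x‖ ^ 2) ^ (α - 2) * (S - ‖x‖ ^ 2))) * inner ℝ x (b x) := by
    rw [ht1]; simp
  rw [e1]
  set T := (S - ‖x‖ ^ 2) ^ (α - 2)
  have p1 : 0 ≤ 2 * α * (T * (S - ‖x‖ ^ 2)) * (‖b x‖ + inner ℝ x (b x)) :=
    mul_nonneg (by positivity) (by linarith)
  have p2 : 0 ≤ δ * (2 * α * (T * (S - ‖x‖ ^ 2)) * (d - 2 * (1 - α))) :=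
    mul_nonneg hδ.le (mul_nonneg (by positivity) (by linarith))
  linarith

lemma exists_weighted_estimate {d : ℕ} (hd : 0 < d) {μ θ : ℝ} (hθ : 0 ≤ θ) (hμ : θ ≤ μ) :
    ∃ C : ℝ≥0∞, C ≠ ∞ ∧ ∀ (G : Measure (Euc d)), IsFiniteMeasure G → ∀ (R h : ℝ), 1 / 2 ≤ R →
      R ≤ 1 → 0 < h → h ≤ 1 / 2 → ∀ (φ : Euc d → ℝ≥0∞), Measurable φ → ∀ A : ℝ≥0∞, A ≠ ∞ →
      (∀ (y : Euc d) (r : ℝ), 0 < r → ball y (2 * r) ⊆ ball 0 R →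
        ∫⁻ x in ball y r, φ x ∂G ≤ A * ENNReal.ofReal (r ^ (-θ)) * G (ball y (2 * r))) →
      ∀ M : ℝ, 0 ≤ M → (∀ x ∈ closedBall (0 : Euc d) R, φ x ≤ ENNReal.ofReal M) →
      ∫⁻ x in closedBall 0 R, φ x * ENNReal.ofReal ((R ^ 2 + h - ‖x‖ ^ 2) ^ (θ - μ)) ∂G ≤
        (C * A + ENNReal.ofReal (M * (3 * h) ^ θ)) *
          ∫⁻ x in closedBall 0 R, ENNReal.ofReal ((R ^ 2 + h - ‖x‖ ^ 2) ^ (-μ)) ∂G := by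
  obtain ⟨C, hC, H⟩ := exists_whitney_estimate hd hθ hμ
  refine ⟨C, hC, fun G hG R h hR hR1 hh hh1 φ hφ A hA hyp M hM hφM => ?_⟩
  have h1 := H G hG R h hR hR1 hh φ hφ A hA hyp
  have h2 : ∫⁻ x in closedBall 0 R \ closedBall 0 (R - h),
      φ x * ENNReal.ofReal ((R ^ 2 + h - ‖x‖ ^ 2) ^ (θ - μ)) ∂G ≤
      ENNReal.ofReal (M * (3 * h) ^ θ) *
        ∫⁻ x in closedBall 0 R, ENNReal.ofReal ((R ^ 2 + h - ‖x‖ ^ 2) ^ (-μ)) ∂G := by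
    rw [← lintegral_const_mul' _ _ ofReal_ne_top]
    refine le_trans ?_ (lintegral_mono_set (Set.sdiff_subset
      (s := closedBall (0 : Euc d) R) (t := closedBall 0 (R - h))))
    refine setLIntegral_mono' (measurableSet_closedBall.diff measurableSet_closedBall)
      fun x hx => ?_
    have hxR : ‖x‖ ≤ R := by simpa using hx.1
    have hxh : R - h < ‖x‖ := by simpa using hx.2
    have hn := norm_nonneg x
    have hτ : 0 < R ^ 2 + h - ‖x‖ ^ 2 := by nlinarith
    have hτ3 : R ^ 2 + h - ‖x‖ ^ 2 ≤ 3 * h := by nlinarith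
    calc φ x * ENNReal.ofReal ((R ^ 2 + h - ‖x‖ ^ 2) ^ (θ - μ))
        ≤ ENNReal.ofReal M * ENNReal.ofReal ((3 * h) ^ θ * (R ^ 2 + h - ‖x‖ ^ 2) ^ (-μ)) := by
          gcongr
          · exact hφM x hx.1
          · rw [show θ - μ = θ + -μ by ring, Real.rpow_add hτ]
            gcongr
      _ = _ := by
          rw [ENNReal.ofReal_mul (by positivity), ENNReal.ofReal_mul hM]
          ring
  have hsub : closedBall (0 : Euc d) (R - h) ⊆ closedBall 0 R := closedBall_subset_closedBall
    (by linarith)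
  rw [← lintegral_inter_add_sdiff _ (closedBall 0 R) (measurableSet_closedBall (x := (0 : Euc d))
    (ε := R - h)), Set.inter_eq_self_of_subset_right hsub, add_mul]
  refine add_le_add (h1.trans ?_) h2
  exact mul_le_mul_right (lintegral_mono_set ball_subset_closedBall) _

lemma barrier_lintegral_le {d : ℕ} (hd : 2 ≤ d) {δ : ℝ} (hδ : 0 < δ)
    {a : Euc d → Matrix (Fin d) (Fin d) ℝ} {b : Euc d → Euc d} (ha : Continuous a)
    (hb : Continuous b) (hax : ∀ x, a x ∈ Sdelta d δ) {R h μ : ℝ} (hR : 1 / 2 ≤ R) (hR1 : R ≤ 1)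
    (hh : 0 < h) (hh1 : h ≤ 1) (hμ : 1 < μ) (hμ2 : μ < 2) {G : Measure (Euc d)} [IsFiniteMeasure G]
    (hG0 : G (closedBall 0 R)ᶜ = 0) {x0 : Euc d} (hx0 : x0 ∈ ball 0 R)
    (hGreen : ∀ w, ContDiff ℝ 2 w → (∀ x ∈ sphere 0 R, 0 ≤ w x) →
      ∫ x, -(Lop d a b w x) ∂G ≤ w x0) :
    ENNReal.ofReal ((2 - μ) * δ * (μ - 1)) *
        ∫⁻ x in closedBall 0 R, ENNReal.ofReal ((R ^ 2 + h - ‖x‖ ^ 2) ^ (-μ)) ∂G ≤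
      2 + 2 * ∫⁻ x in closedBall 0 R,
        ‖b x‖ₑ * ENNReal.ofReal ((R ^ 2 + h - ‖x‖ ^ 2) ^ (1 - μ)) ∂G := by
  set S := R ^ 2 + h with hS
  set α := 2 - μ with hα
  have hα0 : 0 < α := by linarith
  have hα1 : α < 1 := by linarith
  have hS1 : 1 / 4 ≤ S := by nlinarith
  have hS2 : S ≤ 2 := by nlinarith
  have hτ : ∀ x ∈ closedBall (0 : Euc d) R, 0 < S - ‖x‖ ^ 2 := by
    intro x hx
    have : ‖x‖ ≤ R := by simpa using hx
    have := norm_nonneg x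
    nlinarith
  obtain ⟨w, hw, hwf⟩ := exists_contDiff_eventuallyEq (d := d)
    (f := fun y => (S - ‖y‖ ^ 2) ^ α) (R := R) (R' := √S) (by linarith)
    (Real.lt_sqrt_of_sq_lt (by linarith)) (by
      refine ContDiffOn.rpow_const_of_ne
        (contDiff_const.sub (contDiff_norm_sq ℝ)).contDiffOn fun x hx => ?_
      have h1 : ‖x‖ < √S := by simpa using hx
      have h2 := (Real.lt_sqrt (norm_nonneg x)).1 h1
      linarith)
  have hwe : ∀ x ∈ closedBall (0 : Euc d) R, w x = (S - ‖x‖ ^ 2) ^ α := fun x hx =>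
    (hwf x hx).eq_of_nhds
  have h1 := hGreen w hw fun x hx => by
    rw [hwe x (sphere_subset_closedBall hx)]
    exact Real.rpow_nonneg (hτ x (sphere_subset_closedBall hx)).le _
  have h2 : w x0 ≤ 2 := by
    have hx0' := ball_subset_closedBall hx0
    rw [hwe x0 hx0']
    calc (S - ‖x0‖ ^ 2) ^ α ≤ 2 ^ α := Real.rpow_le_rpow (hτ x0 hx0').le (by
            have := sq_nonneg ‖x0‖
            linarith) hα0.le
      _ ≤ 2 ^ (1 : ℝ) := Real.rpow_le_rpow_of_exponent_le (by norm_num) hα1.le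
      _ = 2 := by norm_num
  set Q : Euc d → ℝ := fun x => 2 * (‖b x‖ * (S - ‖x‖ ^ 2) ^ (1 - μ)) with hQ
  have hQc : ContinuousOn Q (closedBall 0 R) := by
    refine continuousOn_const.mul (hb.norm.continuousOn.mul ?_)
    exact ContinuousOn.rpow_const (by fun_prop) fun x hx => Or.inl (hτ x hx).ne'
  have hLc : Continuous fun x => -Lop d a b w x := (continuous_Lop ha hb hw).neg
  have hQi : IntegrableOn Q (closedBall 0 R) G :=
    hQc.integrableOn_compact (isCompact_closedBall _ _)
  have hLi : IntegrableOn (fun x => -Lop d a b w x) (closedBall 0 R) G :=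
    hLc.continuousOn.integrableOn_compact (isCompact_closedBall _ _)
  have hQ0 : ∀ x ∈ closedBall (0 : Euc d) R, 0 ≤ Q x := fun x hx => by
    have := hτ x hx
    positivity
  have hpt : ∀ x ∈ closedBall (0 : Euc d) R,
      α * δ * (μ - 1) * (S - ‖x‖ ^ 2) ^ (-μ) ≤ -Lop d a b w x + Q x := by
    intro x hx
    have hxR : ‖x‖ ≤ R := by simpa using hx
    have hτx := hτ x hx
    have := neg_Lop_rpow_ge hd hδ b hα0 hα1 (hxR.trans hR1) (by linarith : ‖x‖ ^ 2 < S) (hax x)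
    rw [Lop_congr_of_eventuallyEq a b (hwf x hx)]
    have e1 : (S - ‖x‖ ^ 2) ^ (1 - μ) = (S - ‖x‖ ^ 2) ^ (-μ) * (S - ‖x‖ ^ 2) := by
      rw [show 1 - μ = -μ + 1 by ring, Real.rpow_add hτx, Real.rpow_one]
    rw [show α - 2 = -μ by rw [hα]; ring] at this
    simp only [hQ, e1]
    have hT : 0 < (S - ‖x‖ ^ 2) ^ (-μ) := by positivity
    set T := (S - ‖x‖ ^ 2) ^ (-μ)
    have p1 : 0 ≤ α * T * (δ * (1 - α)) * (4 * S - 1) :=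
      mul_nonneg (mul_nonneg (by positivity) (mul_nonneg hδ.le (by linarith))) (by linarith)
    have p2 : 0 ≤ 2 * (1 - α) * (T * (S - ‖x‖ ^ 2) * ‖b x‖) :=
      mul_nonneg (by linarith) (by positivity)
    have e2 : μ - 1 = 1 - α := by rw [hα]; ring
    rw [e2]
    linarith
  have hrestr : G.restrict (closedBall 0 R) = G :=
    Measure.restrict_eq_self_of_ae_mem (by rw [ae_iff]; exact hG0)
  have hκ : 0 ≤ α * δ * (μ - 1) := mul_nonneg (by positivity) (by linarith)
  have hnn : 0 ≤ᵐ[G.restrict (closedBall 0 R)] fun x => -Lop d a b w x + Q x := by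
    refine (ae_restrict_iff' measurableSet_closedBall).2 (Filter.Eventually.of_forall fun x hx => ?_)
    refine le_trans ?_ (hpt x hx)
    exact mul_nonneg hκ (Real.rpow_nonneg (hτ x hx).le _)
  have hQe : ENNReal.ofReal (∫ x in closedBall 0 R, Q x ∂G) = 2 * ∫⁻ x in closedBall 0 R,
        ‖b x‖ₑ * ENNReal.ofReal ((S - ‖x‖ ^ 2) ^ (1 - μ)) ∂G := by
    rw [ofReal_integral_eq_lintegral_ofReal hQi ((ae_restrict_iff' measurableSet_closedBall).2
      (Filter.Eventually.of_forall hQ0)), ← lintegral_const_mul' _ _ (by norm_num)]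
    refine lintegral_congr fun x => ?_
    rw [hQ, ENNReal.ofReal_mul (by norm_num), ENNReal.ofReal_mul (norm_nonneg _), ofReal_norm]
    simp
  calc ENNReal.ofReal (α * δ * (μ - 1)) *
        ∫⁻ x in closedBall 0 R, ENNReal.ofReal ((S - ‖x‖ ^ 2) ^ (-μ)) ∂G
      = ∫⁻ x in closedBall 0 R, ENNReal.ofReal (α * δ * (μ - 1) * (S - ‖x‖ ^ 2) ^ (-μ)) ∂G := by
        rw [← lintegral_const_mul' _ _ ofReal_ne_top]
        simp only [ENNReal.ofReal_mul hκ]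
    _ ≤ ∫⁻ x in closedBall 0 R, ENNReal.ofReal (-Lop d a b w x + Q x) ∂G :=
        setLIntegral_mono' measurableSet_closedBall fun x hx => ENNReal.ofReal_le_ofReal (hpt x hx)
    _ = ENNReal.ofReal (∫ x in closedBall 0 R, (-Lop d a b w x + Q x) ∂G) :=
        (ofReal_integral_eq_lintegral_ofReal (hLi.add hQi) hnn).symm
    _ ≤ ENNReal.ofReal (2 + ∫ x in closedBall 0 R, Q x ∂G) := by
        refine ENNReal.ofReal_le_ofReal ?_
        rw [integral_add hLi hQi]
        rw [← hrestr] at h1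
        linarith
    _ ≤ 2 + ENNReal.ofReal (∫ x in closedBall 0 R, Q x ∂G) := by
        refine ENNReal.ofReal_add_le.trans ?_
        simp
    _ = _ := by rw [hQe]

lemma isAdjSuper_of_green {d : ℕ} {a : Euc d → Matrix (Fin d) (Fin d) ℝ} {b : Euc d → Euc d}
    {R : ℝ} {G : Measure (Euc d)} {x0 : Euc d}
    (hGreen : ∀ w, ContDiff ℝ 2 w → (∀ x ∈ sphere 0 R, 0 ≤ w x) →
      ∫ x, -(Lop d a b w x) ∂G ≤ w x0) : IsAdjSuper d a b R G := by
  intro w hw hw0 hw1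
  have h1 := hGreen (fun y => (-1) * w y) (contDiff_const.mul hw) fun x hx => by
    have hx' : ‖x‖ = R := by simpa using hx
    simp [hw1 x (by simp [hx'])]
  have h2 : ∀ x, -Lop d a b (fun y => (-1) * w y) x = Lop d a b w x := fun x => by
    rw [Lop_const_mul a b (-1) hw]; ring
  rw [integral_congr_ae (Filter.Eventually.of_forall h2)] at h1
  have h3 := hw0 x0
  linarith

lemma barrier_lintegral_le_const {d : ℕ} (hd : 2 ≤ d) {δ : ℝ} (hδ : 0 < δ) {μ : ℝ} (hμ : 1 < μ)
    (hμ2 : μ < 2) :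
    ∃ A₀ : ℝ, 0 < A₀ ∧ ∀ (a : Euc d → Matrix (Fin d) (Fin d) ℝ) (b : Euc d → Euc d),
      Continuous a → Continuous b → (∀ x, a x ∈ Sdelta d δ) → ∀ R : ℝ, 1 / 2 ≤ R → R ≤ 1 →
      ∀ G : Measure (Euc d), IsFiniteMeasure G → G (closedBall 0 R)ᶜ = 0 →
      ∀ x0 ∈ ball (0 : Euc d) R,
      (∀ w, ContDiff ℝ 2 w → (∀ x ∈ sphere 0 R, 0 ≤ w x) →
        ∫ x, -(Lop d a b w x) ∂G ≤ w x0) →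
      (∀ (y : Euc d) (r : ℝ), 0 < r → ball y (2 * r) ⊆ ball 0 R →
        ∫⁻ x in ball y r, ‖b x‖ₑ ∂G ≤ ENNReal.ofReal A₀ * ENNReal.ofReal r⁻¹ * G (ball y (2 * r))) →
      ∀ᶠ h : ℝ in nhdsWithin 0 (Set.Ioi 0),
        ∫⁻ x in closedBall 0 R, ENNReal.ofReal ((R ^ 2 + h - ‖x‖ ^ 2) ^ (-μ)) ∂G ≤
          ENNReal.ofReal (4 / ((2 - μ) * δ * (μ - 1))) := by
  obtain ⟨C, hC, H⟩ := exists_weighted_estimate (d := d) (by omega) zero_le_one hμ.le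
  set κ := (2 - μ) * δ * (μ - 1) with hκ
  have hκ0 : 0 < κ := mul_pos (mul_pos (by linarith) hδ) (by linarith)
  refine ⟨κ / 8 / (C.toReal + 1), by positivity, fun a b ha hb hax R hR hR1 G hG hG0 x0 hx0 hGreen
    hyp => ?_⟩
  set A₀ := κ / 8 / (C.toReal + 1) with hA₀
  have hA₀0 : 0 < A₀ := by positivity
  have hCA : C * ENNReal.ofReal A₀ ≤ ENNReal.ofReal (κ / 8) := by
    rw [← ENNReal.ofReal_toReal hC, ← ENNReal.ofReal_mul toReal_nonneg]
    refine ENNReal.ofReal_le_ofReal ?_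
    rw [hA₀, mul_div_assoc', div_le_iff₀ (by positivity)]
    nlinarith
  obtain ⟨M, hM⟩ := (isCompact_closedBall (0 : Euc d) R).exists_bound_of_continuousOn
    hb.continuousOn
  have hM0 : 0 ≤ M := (norm_nonneg _).trans (hM 0 (mem_closedBall_self (by linarith)))
  have hev : ∀ᶠ h : ℝ in nhdsWithin 0 (Set.Ioi 0), h < min (1 / 2) (κ / 8 / (3 * (M + 1))) :=
    mem_nhdsWithin_of_mem_nhds (Iio_mem_nhds (by positivity))
  filter_upwards [hev, self_mem_nhdsWithin] with h hhlt hh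
  have hh : 0 < h := hh
  have hh1 : h ≤ 1 / 2 := hhlt.le.trans (min_le_left _ _)
  have hh2 : M * (3 * h) ≤ κ / 8 := by
    have := hhlt.le.trans (min_le_right _ _)
    rw [le_div_iff₀ (by positivity)] at this
    nlinarith
  have h1 := barrier_lintegral_le hd hδ ha hb hax hR hR1 hh (by linarith) hμ hμ2 hG0 hx0 hGreen
  have h2 := H G hG R h hR hR1 hh hh1 (fun x => ‖b x‖ₑ) hb.measurable.enorm (ENNReal.ofReal A₀)
    ofReal_ne_top (fun y r hr hs => by
      rw [Real.rpow_neg_one]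
      exact hyp y r hr hs) M hM0 (fun x hx => by
      rw [← ofReal_norm]
      exact ENNReal.ofReal_le_ofReal (hM x hx))
  set J := ∫⁻ x in closedBall 0 R, ENNReal.ofReal ((R ^ 2 + h - ‖x‖ ^ 2) ^ (-μ)) ∂G with hJ
  have hJfin : J ≠ ∞ := by
    refine ne_top_of_le_ne_top (b := ENNReal.ofReal (h ^ (-μ)) * G (closedBall 0 R))
      (ENNReal.mul_ne_top ofReal_ne_top (measure_ne_top _ _)) ?_
    rw [hJ, ← setLIntegral_const]
    refine setLIntegral_mono' measurableSet_closedBall fun x hx => ENNReal.ofReal_le_ofReal ?_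
    have hxR : ‖x‖ ≤ R := by simpa using hx
    have := norm_nonneg x
    exact Real.rpow_le_rpow_of_nonpos hh (by nlinarith) (by linarith)
  have h3 : C * ENNReal.ofReal A₀ + ENNReal.ofReal (M * (3 * h) ^ (1 : ℝ)) ≤
      ENNReal.ofReal (κ / 4) := by
    rw [Real.rpow_one]
    calc _ ≤ ENNReal.ofReal (κ / 8) + ENNReal.ofReal (κ / 8) := by gcongr
      _ = _ := by
        rw [← ENNReal.ofReal_add (by positivity) (by positivity)]
        congr 1; ring
  have h4 : ENNReal.ofReal κ * J ≤ 2 + 2 * (ENNReal.ofReal (κ / 4) * J) :=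
    h1.trans (by gcongr; exact h2.trans (by gcongr))
  rw [← ENNReal.ofReal_toReal hJfin] at h4 ⊢
  have hj : 0 ≤ J.toReal := toReal_nonneg
  rw [show (2 : ℝ≥0∞) = ENNReal.ofReal 2 by simp, ← ENNReal.ofReal_mul hκ0.le,
    ← ENNReal.ofReal_mul (by positivity), ← ENNReal.ofReal_mul (by positivity),
    ← ENNReal.ofReal_add (by positivity) (by positivity),
    ENNReal.ofReal_le_ofReal_iff (by positivity)] at h4
  refine ENNReal.ofReal_le_ofReal ?_
  rw [le_div_iff₀ hκ0]
  linarith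

lemma exists_interior_bound {d : ℕ} (hd : 2 ≤ d) {δ : ℝ} (hδ : 0 < δ) :
    ∃ d₀ : ℝ, (d : ℝ) / 2 < d₀ ∧ d₀ < d ∧ ∀ μ : ℝ, 1 < μ → μ < 2 →
      ∃ β N : ℝ, 0 < β ∧ 0 < N ∧
      ∀ (a : Euc d → Matrix (Fin d) (Fin d) ℝ) (b : Euc d → Euc d),
      Continuous a → Continuous b → (∀ x, a x ∈ Sdelta d δ) → ∀ R : ℝ, 1 / 2 ≤ R → R ≤ 1 →
      ∀ G : Measure (Euc d), IsFiniteMeasure G → G (closedBall 0 R)ᶜ = 0 →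
      ∀ x0 ∈ ball (0 : Euc d) R,
      (∀ w, ContDiff ℝ 2 w → (∀ x ∈ sphere 0 R, 0 ≤ w x) →
        ∫ x, -(Lop d a b w x) ∂G ≤ w x0) →
      (∀ (y : Euc d) (r : ℝ), 0 < r → ball y (2 * r) ⊆ ball 0 R →
        lpAvg d₀ (ball y r) (fun x => ‖b x‖ₑ) ≤ ENNReal.ofReal β * ENNReal.ofReal r⁻¹) →
      ∀ f : Euc d → ℝ≥0∞, Measurable f → ∀ M : ℝ, 0 ≤ M →
      (∀ x ∈ closedBall (0 : Euc d) R, f x ≤ ENNReal.ofReal M) → ∀ F : ℝ≥0∞, F ≠ ∞ →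
      (∀ (y : Euc d) (r : ℝ), 0 < r → ball y (2 * r) ⊆ ball 0 R →
        lpAvg d₀ (ball y r) f ≤ F * ENNReal.ofReal (r ^ (-μ))) →
      ∫⁻ x in closedBall 0 R, f x ∂G ≤ ENNReal.ofReal N * F := by
  obtain ⟨d₀, hd₀, hd₀', C, hC, H⟩ := exists_improved_estimate_small_drift hd hδ
  refine ⟨d₀, hd₀, hd₀', fun μ hμ hμ2 => ?_⟩
  obtain ⟨A₀, hA₀, HJ⟩ := barrier_lintegral_le_const hd hδ hμ hμ2
  obtain ⟨C₂, hC₂, H₂⟩ := exists_weighted_estimate (d := d) (by omega) (by linarith : 0 ≤ μ) le_rfl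
  set κ := (2 - μ) * δ * (μ - 1) with hκ
  have hκ0 : 0 < κ := mul_pos (mul_pos (by linarith) hδ) (by linarith)
  have hβ : C * ENNReal.ofReal (min A₀ 1 / (C.toReal + 1)) ≤ ENNReal.ofReal (min A₀ 1) := by
    rw [← ENNReal.ofReal_toReal hC, ← ENNReal.ofReal_mul toReal_nonneg, toReal_ofReal toReal_nonneg]
    refine ENNReal.ofReal_le_ofReal ?_
    rw [mul_div_assoc', div_le_iff₀ (by positivity)]
    have : 0 < min A₀ 1 := by positivity
    nlinarith
  refine ⟨min A₀ 1 / (C.toReal + 1), (C₂ * C).toReal * (4 / κ) + 1, by positivity, by positivity,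
    fun a b ha hb hax R hR hR1 G hG hG0 x0 hx0 hGreen hbyp f hf M hM hfM F hF hfyp => ?_⟩
  set β := min A₀ 1 / (C.toReal + 1) with hβdef
  have hest := H a b ha hb hax R G hG (isAdjSuper_of_green hGreen) (ENNReal.ofReal β)
    (hβ.trans (by rw [← ENNReal.ofReal_one]; exact ENNReal.ofReal_le_ofReal (min_le_right _ _))) hbyp
  have hJ := HJ a b ha hb hax R hR hR1 G hG hG0 x0 hx0 hGreen fun y r hr hs => by
    refine (hest y r hr hs _ hb.measurable.enorm).trans ?_
    refine mul_le_mul_left ?_ _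
    calc C * lpAvg d₀ (ball y r) (fun x => ‖b x‖ₑ)
        ≤ C * (ENNReal.ofReal β * ENNReal.ofReal r⁻¹) := mul_le_mul_right (hbyp y r hr hs) _
      _ = C * ENNReal.ofReal β * ENNReal.ofReal r⁻¹ := by ring
      _ ≤ _ := mul_le_mul_left (hβ.trans (ENNReal.ofReal_le_ofReal (min_le_left _ _))) _
  have hfest : ∀ (y : Euc d) (r : ℝ), 0 < r → ball y (2 * r) ⊆ ball 0 R →
      ∫⁻ x in ball y r, f x ∂G ≤ C * F * ENNReal.ofReal (r ^ (-μ)) * G (ball y (2 * r)) := by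
    intro y r hr hs
    refine (hest y r hr hs f hf).trans (mul_le_mul_left ?_ _)
    rw [mul_assoc]
    exact mul_le_mul_right (hfyp y r hr hs) _
  have hbound : ∀ᶠ h : ℝ in nhdsWithin 0 (Set.Ioi 0), ∫⁻ x in closedBall 0 R, f x ∂G ≤
      (C₂ * (C * F) + ENNReal.ofReal (M * (3 * h) ^ μ)) * ENNReal.ofReal (4 / κ) := by
    have hev : ∀ᶠ h : ℝ in nhdsWithin 0 (Set.Ioi 0), h < 1 / 2 :=
      mem_nhdsWithin_of_mem_nhds (Iio_mem_nhds (by norm_num))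
    filter_upwards [hJ, hev, self_mem_nhdsWithin] with h hJh hh1 hh
    have h1 := H₂ G hG R h hR hR1 hh hh1.le f hf (C * F) (ENNReal.mul_ne_top hC hF) hfest M hM hfM
    simp only [sub_self, Real.rpow_zero, ENNReal.ofReal_one, mul_one] at h1
    exact h1.trans (mul_le_mul_right hJh _)
  have hlim : Filter.Tendsto (fun h : ℝ =>
      (C₂ * (C * F) + ENNReal.ofReal (M * (3 * h) ^ μ)) * ENNReal.ofReal (4 / κ))
      (nhdsWithin 0 (Set.Ioi 0)) (nhds ((C₂ * (C * F) + 0) * ENNReal.ofReal (4 / κ))) := by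
    refine ENNReal.Tendsto.mul_const (tendsto_const_nhds.add ?_) (Or.inr ofReal_ne_top)
    refine Filter.Tendsto.mono_left ?_ nhdsWithin_le_nhds
    have hc : Continuous fun h : ℝ => ENNReal.ofReal (M * (3 * h) ^ μ) :=
      ENNReal.continuous_ofReal.comp (continuous_const.mul
        ((continuous_const.mul continuous_id).rpow_const fun _ => Or.inr (by linarith)))
    convert! hc.tendsto 0 using 2
    simp [Real.zero_rpow (by linarith : μ ≠ 0)]
  refine (ge_of_tendsto hlim hbound).trans ?_
  rw [add_zero]
  calc C₂ * (C * F) * ENNReal.ofReal (4 / κ) = C₂ * C * ENNReal.ofReal (4 / κ) * F := by ring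
    _ ≤ _ := by
      refine mul_le_mul_left ?_ _
      nth_rewrite 1 [← ENNReal.ofReal_toReal (ENNReal.mul_ne_top hC₂ hC)]
      rw [← ENNReal.ofReal_mul toReal_nonneg]
      exact ENNReal.ofReal_le_ofReal (by linarith)

lemma lpAvg_le_morreyNorm {d : ℕ} (hd : 0 < d) {p s μ : ℝ} (hp : 0 < p) (hps : p ≤ s)
    {g g' : Euc d → ℝ} (hg' : Continuous g') {y : Euc d} {r : ℝ} (hr : 0 < r)
    (hsub : ball y (2 * r) ⊆ ball 0 1) (hgg' : ∀ x ∈ ball y r, g x = g' x) :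
    lpAvg p (ball y r) (fun x => ‖g' x‖ₑ) ≤ morreyNorm d s μ 1 g * ENNReal.ofReal (r ^ (-μ)) := by
  have hs : 0 < s := hp.trans_le hps
  have hvol0 : volume (ball y r) ≠ 0 := (measure_ball_pos _ _ hr).ne'
  have hvol1 : volume (ball y r) ≠ ∞ := measure_ball_lt_top.ne
  refine (lpAvg_mono_exponent hp hps hvol0 hvol1 hg'.measurable.enorm).trans ?_
  have hy : y ∈ ball (0 : Euc d) 1 := hsub (mem_ball_self (by positivity))
  have hr2 : r ≤ 2 := by
    have := radius_le_of_ball_subset hd (by positivity) one_pos hsub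
    linarith
  have hinter : ball (0 : Euc d) 1 ∩ ball y r = ball y r :=
    Set.inter_eq_self_of_subset_right ((ball_subset_ball (by linarith)).trans hsub)
  have hnorm : ENNReal.ofReal (r ^ μ *
      ((volume (ball y r)).toReal⁻¹ * ∫ x in ball y r, |g x| ^ s) ^ (1 / s)) ≤
      morreyNorm d s μ 1 g := by
    unfold morreyNorm
    refine le_iSup₂_of_le y hy (le_iSup₂_of_le r ⟨hr, by linarith⟩ ?_)
    rw [hinter]
  have hInt : ∫ x in ball y r, |g x| ^ s = ∫ x in ball y r, |g' x| ^ s :=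
    setIntegral_congr_fun measurableSet_ball fun x hx => by simp only [hgg' x hx]
  have hI : IntegrableOn (fun x => |g' x| ^ s) (ball y r) := by
    have hc : Continuous fun x => |g' x| ^ s := hg'.abs.rpow_const fun _ => Or.inr hs.le
    exact (hc.continuousOn.integrableOn_compact (isCompact_closedBall y r)).mono_set
      ball_subset_closedBall
  have h0 : 0 ≤ ∫ x in ball y r, |g' x| ^ s := integral_nonneg fun x => by positivity
  have heq : lpAvg s (ball y r) (fun x => ‖g' x‖ₑ) = ENNReal.ofReal
      (((volume (ball y r)).toReal⁻¹ * ∫ x in ball y r, |g' x| ^ s) ^ (1 / s)) := by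
    unfold lpAvg
    rw [← ENNReal.ofReal_rpow_of_nonneg (by positivity) (by positivity),
      ENNReal.ofReal_mul (by positivity), ENNReal.ofReal_inv_of_pos (toReal_pos hvol0 hvol1),
      ofReal_toReal hvol1, ofReal_integral_eq_lintegral_ofReal hI
        (Filter.Eventually.of_forall fun x => by positivity)]
    congr 3 with x
    rw [← ENNReal.ofReal_rpow_of_nonneg (abs_nonneg _) hs.le, ← Real.enorm_eq_ofReal_abs]
  rw [heq, ← hInt]
  refine le_trans (le_of_eq ?_) (mul_le_mul_left hnorm _)
  rw [← ENNReal.ofReal_mul (by rw [hInt]; positivity)]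
  congr 1
  rw [mul_right_comm, ← Real.rpow_add hr]
  simp

lemma exists_continuous_retraction {d : ℕ} {R : ℝ} (hR : 0 < R) :
    ∃ P : Euc d → Euc d, Continuous P ∧ (∀ x, P x ∈ closedBall (0 : Euc d) R) ∧
      ∀ x ∈ closedBall (0 : Euc d) R, P x = x := by
  have hm : ∀ x : Euc d, 0 < max R ‖x‖ := fun x => lt_max_of_lt_left hR
  refine ⟨fun x => (R / max R ‖x‖) • x, ?_, fun x => ?_, fun x hx => ?_⟩
  · exact (continuous_const.div (continuous_const.max continuous_norm)
      fun x => (hm x).ne').smul continuous_id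
  · rw [mem_closedBall_zero_iff, norm_smul, Real.norm_of_nonneg (by have := hm x; positivity),
      div_mul_eq_mul_div, div_le_iff₀ (hm x)]
    exact mul_le_mul_of_nonneg_left (le_max_right _ _) hR.le
  · have hx' : ‖x‖ ≤ R := by simpa using hx
    simp only [max_eq_left hx', div_self hR.ne', one_smul]

lemma exists_radius_le_on_sphere {d : ℕ} {v : Euc d → ℝ} (hv : ContinuousOn v (closedBall 0 1))
    (hv0 : ∀ x ∈ sphere (0 : Euc d) 1, v x = 0) {ε : ℝ} (hε : 0 < ε) {x0 : Euc d}
    (hx0 : x0 ∈ ball (0 : Euc d) 1) :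
    ∃ R : ℝ, 1 / 2 ≤ R ∧ R < 1 ∧ x0 ∈ ball (0 : Euc d) R ∧ ∀ x ∈ sphere (0 : Euc d) R, v x ≤ ε := by
  obtain ⟨η, hη, H⟩ := Metric.uniformContinuousOn_iff.1
    ((isCompact_closedBall (0 : Euc d) 1).uniformContinuousOn_of_continuous hv) ε hε
  have hx0' : ‖x0‖ < 1 := by simpa using hx0
  refine ⟨max (1 / 2) (max ((1 + ‖x0‖) / 2) (1 - η / 2)), le_max_left _ _,
    max_lt (by norm_num) (max_lt (by linarith) (by linarith)), ?_, ?_⟩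
  · rw [mem_ball_zero_iff]
    exact lt_max_of_lt_right (lt_max_of_lt_left (by linarith))
  set R := max (1 / 2) (max ((1 + ‖x0‖) / 2) (1 - η / 2)) with hRdef
  have hR : 1 / 2 ≤ R := le_max_left _ _
  have hR1 : R < 1 := max_lt (by norm_num) (max_lt (by linarith) (by linarith))
  have hRη : 1 - η / 2 ≤ R := (le_max_right _ _).trans (le_max_right _ _)
  intro x hx
  have hxR : ‖x‖ = R := by simpa using hx
  have hR0 : 0 < R := by linarith
  have hyn : ‖R⁻¹ • x‖ = 1 := by
    rw [norm_smul, hxR, Real.norm_of_nonneg (by positivity), inv_mul_cancel₀ hR0.ne']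
  have hdist : dist x (R⁻¹ • x) < η := by
    have h1 : x - R⁻¹ • x = (1 - R⁻¹) • x := by rw [sub_smul, one_smul]
    have h2 : 1 ≤ R⁻¹ := (one_le_inv₀ hR0).2 hR1.le
    rw [dist_eq_norm, h1, norm_smul, hxR, Real.norm_of_nonpos (by linarith), neg_sub, sub_mul,
      inv_mul_cancel₀ hR0.ne']
    linarith
  have h3 := H x (by simp [hxR, hR1.le]) (R⁻¹ • x) (by simp only [mem_closedBall_zero_iff, hyn, le_refl]) hdist
  rw [hv0 (R⁻¹ • x) (by simp only [mem_sphere_zero_iff_norm, hyn]), Real.dist_eq, sub_zero] at h3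
  exact (le_abs_self _).trans h3.le

lemma Lop_congr_coeff {d : ℕ} {a a' : Euc d → Matrix (Fin d) (Fin d) ℝ} {b b' : Euc d → Euc d}
    (v : Euc d → ℝ) {x : Euc d} (ha : a x = a' x) (hb : b x = b' x) :
    Lop d a b v x = Lop d a' b' v x := by
  rw [Lop_eq, Lop_eq, ha, hb]

lemma Lop_const {d : ℕ} (a : Euc d → Matrix (Fin d) (Fin d) ℝ) (b : Euc d → Euc d) (c : ℝ)
    (x : Euc d) : Lop d a b (fun _ => c) x = 0 := by
  rw [Lop_eq]
  simp [hess, contr]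

lemma ofReal_le_lintegral_neg_part {d : ℕ} {a : Euc d → Matrix (Fin d) (Fin d) ℝ}
    {b : Euc d → Euc d} (ha : Continuous a) (hb : Continuous b) {R : ℝ} {G : Measure (Euc d)}
    [IsFiniteMeasure G] (hG0 : G (closedBall 0 R)ᶜ = 0) {x0 : Euc d}
    (hGreen : ∀ w, ContDiff ℝ 2 w → (∀ x ∈ sphere 0 R, 0 ≤ w x) →
      ∫ x, -(Lop d a b w x) ∂G ≤ w x0) {w : Euc d → ℝ} (hw : ContDiff ℝ 2 w) {ε : ℝ}
    (hwε : ∀ x ∈ sphere (0 : Euc d) R, w x ≤ ε) :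
    ENNReal.ofReal (w x0) ≤ ENNReal.ofReal ε +
      ∫⁻ x in closedBall 0 R, ‖max (-(Lop d a b w x)) 0‖ₑ ∂G := by
  have h1 := hGreen (fun y => ε + (-1) * w y) (contDiff_const.add (contDiff_const.mul hw))
    fun x hx => by linarith [hwε x hx]
  have h2 : ∀ x, -Lop d a b (fun y => ε + (-1) * w y) x = Lop d a b w x := fun x => by
    rw [Lop_add a b contDiff_const (contDiff_const.mul hw), Lop_const, Lop_const_mul a b (-1) hw]
    ring
  have hrestr : G.restrict (closedBall 0 R) = G :=
    Measure.restrict_eq_self_of_ae_mem (by rw [ae_iff]; exact hG0)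
  have hLc := continuous_Lop ha hb hw
  rw [integral_congr_ae (Filter.Eventually.of_forall h2), ← hrestr] at h1
  have hLi : IntegrableOn (Lop d a b w) (closedBall 0 R) G :=
    hLc.continuousOn.integrableOn_compact (isCompact_closedBall _ _)
  have hMi : IntegrableOn (fun x => max (-(Lop d a b w x)) 0) (closedBall 0 R) G :=
    (hLc.neg.max continuous_const).continuousOn.integrableOn_compact (isCompact_closedBall _ _)
  have h3 : -∫ x in closedBall 0 R, Lop d a b w x ∂G ≤
      ∫ x in closedBall 0 R, max (-(Lop d a b w x)) 0 ∂G := by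
    rw [← integral_neg]
    exact integral_mono hLi.neg hMi fun x => le_max_left _ _
  have h4 : w x0 ≤ ε + ∫ x in closedBall 0 R, max (-(Lop d a b w x)) 0 ∂G := by linarith
  refine (ENNReal.ofReal_le_ofReal h4).trans (ENNReal.ofReal_add_le.trans ?_)
  rw [ofReal_integral_eq_lintegral_ofReal hMi (Filter.Eventually.of_forall fun x => le_max_right _ _)]
  refine le_of_eq (congrArg _ (lintegral_congr fun x => ?_))
  rw [Real.enorm_of_nonneg (le_max_right _ _)]

/-- Remark 2.1 of the paper: if `v`, `a`, `b` are as in Theorem 2.4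
with `v = 0` on `∂B_1`, then `v ≤ N ‖(Lv)_-‖_{E_{qp/d, d/p}(B_1)}` in `B_1`. -/
theorem aleksandrov_estimate_morrey_rhs (d : ℕ) (hd : 2 ≤ d) (δ : ℝ)
    (hδ0 : 0 < δ) (hδ1 : δ ≤ 1) :
    ∃ d₀ : ℝ, (d : ℝ) / 2 < d₀ ∧ d₀ < d ∧
      ∀ q p : ℝ, d₀ < q → q < d → d₀ * d / q < p → p < d →
        ∃ bbar N : ℝ, 0 < bbar ∧ 0 < N ∧
          ∀ a : EuclideanSpace ℝ (Fin d) → Matrix (Fin d) (Fin d) ℝ,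
            ContinuousOn a (ball (0 : EuclideanSpace ℝ (Fin d)) 1) →
            (∀ x ∈ ball (0 : EuclideanSpace ℝ (Fin d)) 1, a x ∈ Sdelta d δ) →
          ∀ b : EuclideanSpace ℝ (Fin d) → EuclideanSpace ℝ (Fin d),
            ContinuousOn b (ball (0 : EuclideanSpace ℝ (Fin d)) 1) →
            morreyNorm d q 1 1 (fun y => ‖b y‖) ≤ ENNReal.ofReal bbar →
          ∀ v : EuclideanSpace ℝ (Fin d) → ℝ,
            ContDiffOn ℝ 2 v (closedBall (0 : EuclideanSpace ℝ (Fin d)) 1) →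
            (∀ x ∈ sphere (0 : EuclideanSpace ℝ (Fin d)) 1, v x = 0) →
          ∀ x ∈ ball (0 : EuclideanSpace ℝ (Fin d)) 1,
            ENNReal.ofReal (v x) ≤ ENNReal.ofReal N *
              morreyNorm d (q * p / d) (d / p) 1
                (fun y => max (-(Lop d a b v y)) 0) := by
  obtain ⟨d₀, hd₀, hd₀', H⟩ := exists_interior_bound hd hδ0
  refine ⟨d₀, hd₀, hd₀', fun q p hq hqd hp hpd => ?_⟩
  have hd2 : (2 : ℝ) ≤ d := by exact_mod_cast hd
  have hd₀0 : 0 < d₀ := by linarith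
  have hq0 : 0 < q := by linarith
  rw [div_lt_iff₀ hq0] at hp
  have hp2 : (d : ℝ) / 2 < p := by
    by_contra! hcon
    have : p * q ≤ (d / 2) * d := by gcongr
    nlinarith
  have hp0 : 0 < p := by linarith
  have hexp : d₀ ≤ q * p / d := by
    rw [le_div_iff₀ (by linarith)]
    linarith
  obtain ⟨β, N, hβ, hN, H'⟩ := H (d / p) ((one_lt_div hp0).2 hpd)
    ((div_lt_iff₀ hp0).2 (by linarith))
  refine ⟨β, N, hβ, hN, fun a ha hax b hb hbn v hv hv0 x0 hx0 => ?_⟩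
  set F := morreyNorm d (q * p / d) (d / p) 1 (fun y => max (-(Lop d a b v y)) 0) with hF
  rcases eq_or_ne F ∞ with hFt | hFt
  · rw [hFt, ENNReal.mul_top (by simpa using hN)]
    exact le_top
  refine ENNReal.le_of_forall_pos_le_add fun ε hε _ => ?_
  have hε' : (0 : ℝ) < ε := hε
  obtain ⟨R, hR, hR1, hx0R, hvε⟩ := exists_radius_le_on_sphere hv.continuousOn hv0 hε' hx0
  have hR0 : 0 < R := by linarith
  obtain ⟨P, hP, hPR, hPid⟩ := exists_continuous_retraction (d := d) hR0
  have hcb : closedBall (0 : Euc d) R ⊆ ball 0 1 := closedBall_subset_ball hR1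
  have ha' : Continuous (a ∘ P) := ha.comp_continuous hP fun x => hcb (hPR x)
  have hb' : Continuous (b ∘ P) := hb.comp_continuous hP fun x => hcb (hPR x)
  have hax' : ∀ x, (a ∘ P) x ∈ Sdelta d δ := fun x => hax _ (hcb (hPR x))
  obtain ⟨w, hw, hwv⟩ := exists_contDiff_eventuallyEq hR0 hR1 (hv.mono ball_subset_closedBall)
  have hL : ∀ x ∈ closedBall (0 : Euc d) R, Lop d a b v x = Lop d (a ∘ P) (b ∘ P) w x := by
    intro x hx
    rw [Lop_congr_of_eventuallyEq _ _ (hwv x hx)]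
    exact Lop_congr_coeff v (by simp [hPid x hx]) (by simp [hPid x hx])
  obtain ⟨G, hG, hG0, hGreen⟩ := exists_green_measure (by omega) hδ0 hR0 ha' hb' hax' hx0R
  have hLc : Continuous fun x => max (-(Lop d (a ∘ P) (b ∘ P) w x)) 0 :=
    (continuous_Lop ha' hb' hw).neg.max continuous_const
  obtain ⟨M, hM⟩ := (isCompact_closedBall (0 : Euc d) R).exists_bound_of_continuousOn
    hLc.continuousOn
  have hM0 : 0 ≤ M := (norm_nonneg _).trans (hM 0 (mem_closedBall_self hR0.le))
  have hsmall : ∀ (y : Euc d) (r : ℝ), 0 < r → ball y (2 * r) ⊆ ball 0 R →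
      ball y r ⊆ closedBall (0 : Euc d) R := fun y r hr hs =>
    (ball_subset_ball (by linarith)).trans (hs.trans ball_subset_closedBall)
  have key := H' (a ∘ P) (b ∘ P) ha' hb' hax' R hR hR1.le G hG hG0 x0 hx0R hGreen
    (fun y r hr hs => by
      have h1 := lpAvg_le_morreyNorm (by omega) (μ := 1) hd₀0 hq.le (g := fun y => ‖b y‖) hb'.norm hr
        (hs.trans (ball_subset_ball hR1.le)) fun x hx => by
          simp [hPid x (hsmall y r hr hs hx)]
      simp only [enorm_norm, Real.rpow_neg_one] at h1
      exact h1.trans (mul_le_mul_left hbn _))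
    (fun x => ‖max (-(Lop d (a ∘ P) (b ∘ P) w x)) 0‖ₑ) hLc.measurable.enorm M hM0
    (fun x hx => by
      rw [← ofReal_norm]
      exact ENNReal.ofReal_le_ofReal (hM x hx)) F hFt
    (fun y r hr hs => lpAvg_le_morreyNorm (by omega) hd₀0 hexp hLc hr
      (hs.trans (ball_subset_ball hR1.le)) fun x hx => by
        simp only [hL x (hsmall y r hr hs hx)])
  have hfin := ofReal_le_lintegral_neg_part ha' hb' hG0 hGreen hw fun x hx => by
    rw [(hwv x (sphere_subset_closedBall hx)).eq_of_nhds]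
    exact hvε x hx
  rw [(hwv x0 (ball_subset_closedBall hx0R)).eq_of_nhds] at hfin
  calc ENNReal.ofReal (v x0) ≤ _ := hfin
    _ ≤ ENNReal.ofReal ε + ENNReal.ofReal N * F := by gcongr
    _ = _ := by rw [add_comm, ENNReal.ofReal_coe_nnreal]
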